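/- Let n ∈ ℕ, k, ℓ ∈ ℕ with ℓ ≤ k, p ∈ [1,∞), q ∈ (0,∞) satisfy n(1/p − 1/q) < ℓ, and let γ ∈ Γ_{p,q}. Then there exist a constant C > 0 and an increasing continuous function ψ : [0,∞) → [0,∞) such that for every A_1 weight υ on ℝ^n and every locally integrable f : ℝ^n → ℝ having weak derivatives of order ℓ with ∫_{ℝ^n} |∇^ℓ f|^p υ dx < ∞, sup_{λ∈(0,∞)} λ^p ∫_{ℝ^n}[∫_{ℝ^n} 1_{E_{λ,γ/q,k,ℓ}[f]}(x,h) |h|^{γ−n} dh]^{p/q} υ(x) dx ≤ C ψ([υ]_{A_1}) ∫_{ℝ^n} |∇^ℓ f(x)|^p υ(x) dx. -/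

import Mathlib

open MeasureTheory Filter Set
open scoped ENNReal NNReal BigOperators Topology Classical

noncomputable section

/-- `ℝ^n`. -/
abbrev En (n : ℕ) := EuclideanSpace ℝ (Fin n)

variable {n : ℕ}

/-- The `k`-th order difference `Δ_h^k f (x) = ∑_{j=0}^k (-1)^{k-j} C(k,j) f (x + j h)`. -/
def kDiff (k : ℕ) (f : En n → ℝ) (h x : En n) : ℝ :=
  ∑ j ∈ Finset.range (k + 1), (-1 : ℝ) ^ (k - j) * (k.choose j : ℝ) * f (x + (j : ℝ) • h)

/-- Membership of `(x,h)` in `E_{λ,b,k,ℓ}[f]`. -/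
def memE (k ℓ : ℕ) (lam b : ℝ) (f : En n → ℝ) (x h : En n) : Prop :=
  h ≠ 0 ∧ lam * ‖h‖ ^ ((ℓ : ℝ) + b) < |kDiff k f h x|

/-- `∫_{ℝ^n} 1_{E_{λ,b,k,ℓ}[f]}(x,h) |h|^{γ-n} dh`. -/
def innerInt (k ℓ : ℕ) (lam b γ : ℝ) (f : En n → ℝ) (x : En n) : ℝ≥0∞ :=
  ∫⁻ h, if memE k ℓ lam b f x h then ENNReal.ofReal (‖h‖ ^ (γ - (n : ℝ))) else 0

/-- `λ (∫_{ℝ^n} (∫_{ℝ^n} 1_E |h|^{γ-n} dh)^{p/q} dx)^{1/p}`. -/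
def bsvy (k ℓ : ℕ) (p q b γ : ℝ) (f : En n → ℝ) (lam : ℝ) : ℝ≥0∞ :=
  ENNReal.ofReal lam * (∫⁻ x, (innerInt k ℓ lam b γ f x) ^ (p / q)) ^ (1 / p)

/-- First-order partial derivative in the `i`-th coordinate direction. -/
def pd (i : Fin n) (ψ : En n → ℝ) : En n → ℝ :=
  fun x => fderiv ℝ ψ x (EuclideanSpace.single i (1 : ℝ))

/-- Higher-order partial derivative `∂^α` associated with a multi-index `α`. -/
def mpd (α : Fin n → ℕ) (φ : En n → ℝ) : En n → ℝ :=
  (List.finRange n).foldr (fun i ψ => (pd i)^[α i] ψ) φ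

/-- `g` is the family of `m`-th order weak partial derivatives of `f`. -/
def HasWeakDerivs (m : ℕ) (f : En n → ℝ) (g : (Fin n → ℕ) → En n → ℝ) : Prop :=
  (∀ α : Fin n → ℕ, (∑ i, α i) = m → LocallyIntegrable (g α) volume) ∧
  ∀ α : Fin n → ℕ, (∑ i, α i) = m →
    ∀ φ : En n → ℝ, ContDiff ℝ (⊤ : ℕ∞) φ → HasCompactSupport φ →
      ∫ x, f x * mpd α φ x = (-1 : ℝ) ^ m * ∫ x, g α x * φ x

/-- `|∇^m f| = (∑_{|α| = m} |∂^α f|^2)^{1/2}`, given the family `g` of weak derivatives. -/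
def gradLen (m : ℕ) (g : (Fin n → ℕ) → En n → ℝ) (x : En n) : ℝ :=
  Real.sqrt (∑' α : Fin n → ℕ, if (∑ i, α i) = m then (g α x) ^ 2 else 0)

/-- The parameter range `Γ_{p,q}`. -/
def Gam (p q : ℝ) : Set ℝ := if p = 1 then Iio (-q) ∪ Ioi 0 else {(0 : ℝ)}ᶜ

/-- `‖ |∇^m f| ‖_{L^p}` as an `ℝ≥0∞`-valued quantity. -/
def gradLp (p : ℝ) (m : ℕ) (g : (Fin n → ℕ) → En n → ℝ) : ℝ≥0∞ :=
  (∫⁻ x, ENNReal.ofReal (gradLen m g x ^ p)) ^ (1 / p)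

end

noncomputable section

open MeasureTheory Set
open scoped ENNReal Classical

variable {n : ℕ}

/-- An axis-parallel open cube with lower corner `a` and edge length `l`. -/
def cube (a : Fin n → ℝ) (l : ℝ) : Set (En n) := {x | ∀ i, x i ∈ Ioo (a i) (a i + l)}

/-- `υ(S) = ∫_S υ` as an `ℝ≥0∞`-valued quantity. -/
def wInt (υ : En n → ℝ) (S : Set (En n)) : ℝ≥0∞ := ∫⁻ x in S, ENNReal.ofReal (υ x)

/-- The average `⨍_S υ`. -/
def avgE (υ : En n → ℝ) (S : Set (En n)) : ℝ≥0∞ := wInt υ S / volume S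

/-- The Muckenhoupt `A_p` characteristic `[υ]_{A_p}`. -/
def ApConst (p : ℝ) (υ : En n → ℝ) : ℝ≥0∞ :=
  if p = 1 then
    ⨆ (a : Fin n → ℝ) (l : ℝ) (_ : 0 < l),
      avgE υ (cube a l) *
        essSup (fun x => (ENNReal.ofReal (υ x))⁻¹) (volume.restrict (cube a l))
  else
    ⨆ (a : Fin n → ℝ) (l : ℝ) (_ : 0 < l),
      avgE υ (cube a l) *
        (avgE (fun x => υ x ^ (1 - p / (p - 1))) (cube a l)) ^ (p - 1)

/-- `υ` is an `A_p` weight on `ℝ^n`. -/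
def IsAp (p : ℝ) (υ : En n → ℝ) : Prop :=
  (∀ x, 0 ≤ υ x) ∧ LocallyIntegrable υ volume ∧ ApConst p υ < ⊤

end

section

open MeasureTheory Filter Set
open scoped ENNReal NNReal BigOperators Topology Classical

variable {n : ℕ}

/-- Jensen's inequality for the power `r ≥ 1`. -/
theorem lintegral_rpow_le_measure_mul {α : Type*} [MeasurableSpace α] (μ : Measure α)
    {f : α → ℝ≥0∞} (hf : AEMeasurable f μ) {r : ℝ} (hr : 1 ≤ r) :
    (∫⁻ x, f x ∂μ) ^ r ≤ μ univ ^ (r - 1) * ∫⁻ x, f x ^ r ∂μ := by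
  rcases hr.eq_or_lt with rfl | hr1
  · simp
  have hc : r.HolderConjugate (r / (r - 1)) := Real.HolderConjugate.conjExponent hr1
  have h := ENNReal.lintegral_mul_le_Lp_mul_Lq μ hc hf (aemeasurable_const (b := (1 : ℝ≥0∞)))
  simp only [Pi.mul_apply, mul_one, ENNReal.one_rpow, lintegral_const, one_mul] at h
  have h0 : 0 < r := by linarith
  calc (∫⁻ x, f x ∂μ) ^ r
      ≤ ((∫⁻ x, f x ^ r ∂μ) ^ (1 / r) * μ univ ^ (1 / (r / (r - 1)))) ^ r := by gcongr
    _ = μ univ ^ (r - 1) * ∫⁻ x, f x ^ r ∂μ := by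
        rw [ENNReal.mul_rpow_of_nonneg _ _ h0.le, ← ENNReal.rpow_mul, ← ENNReal.rpow_mul, mul_comm]
        have h1 : r - 1 ≠ 0 := by linarith
        congr 2
        · field_simp
        · rw [one_div, inv_mul_cancel₀ h0.ne', ENNReal.rpow_one]

theorem ENNReal.tsum_rpow_le {ι : Type*} (f : ι → ℝ≥0∞) {θ : ℝ} (h0 : 0 < θ) (h1 : θ ≤ 1) :
    (∑' i, f i) ^ θ ≤ ∑' i, f i ^ θ := by
  have hfin : ∀ s : Finset ι, (∑ i ∈ s, f i) ^ θ ≤ ∑ i ∈ s, f i ^ θ := by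
    intro s
    induction s using Finset.induction_on with
    | empty => simp [h0]
    | insert a s ha ih =>
      rw [Finset.sum_insert ha, Finset.sum_insert ha]
      exact (ENNReal.rpow_add_le_add_rpow _ _ h0.le h1).trans (by gcongr)
  rw [ENNReal.tsum_eq_iSup_sum, ← ENNReal.le_rpow_inv_iff h0]
  refine iSup_le fun s => ?_
  rw [ENNReal.le_rpow_inv_iff h0]
  exact (hfin s).trans (ENNReal.sum_le_tsum s)

/-- A two-sided geometric progression summed up to a cutoff is comparable to its last term. -/
theorem tsum_geometric_le_cutoff {ρ α : ℝ} (hρ : 0 < ρ) (hρ1 : ρ ≠ 1) (hα : 0 < α) :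
    ∃ C : ℝ≥0∞, C ≠ ⊤ ∧ C ≠ 0 ∧ ∀ (c : ℝ) (X : ℝ≥0∞), 0 < c →
      ∑' i : ℤ, (if ENNReal.ofReal (c * ρ ^ i) ≤ X then ENNReal.ofReal (c * ρ ^ i) ^ α else 0)
        ≤ C * X ^ α := by
  wlog hρ2 : 1 < ρ generalizing ρ
  · obtain ⟨C, hC, hC0, h⟩ := this (ρ := ρ⁻¹) (by positivity) (by simpa using hρ1)
      (by rw [one_lt_inv₀ hρ]; exact lt_of_le_of_ne (not_lt.1 hρ2) hρ1)
    refine ⟨C, hC, hC0, fun c X hc => ?_⟩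
    refine le_trans (le_of_eq ?_) (h c X hc)
    rw [← (Equiv.neg ℤ).tsum_eq]
    simp
  set κ : ℝ≥0∞ := ENNReal.ofReal (ρ⁻¹) ^ α with hκ
  have hκ1 : κ < 1 := by
    rw [hκ]
    refine ENNReal.rpow_lt_one ?_ hα
    rw [ENNReal.ofReal_lt_one]
    exact inv_lt_one_of_one_lt₀ hρ2
  refine ⟨(1 - κ)⁻¹, ?_, by simp, fun c X hc => ?_⟩
  · simp [tsub_eq_zero_iff_le, hκ1]
  rcases eq_or_ne X ⊤ with rfl | hX
  · rw [ENNReal.top_rpow_of_pos hα, ENNReal.mul_top (by simp)]; exact le_top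
  rcases eq_or_ne X 0 with rfl | hX0
  · have : ∀ i : ℤ, ¬ (c * ρ ^ i ≤ 0) := fun i => by push Not; positivity
    simp [this, hα]
  have hXr : 0 < X.toReal := ENNReal.toReal_pos hX0 hX
  obtain ⟨i0, hi1, hi2⟩ := exists_mem_Ico_zpow (div_pos hXr hc) hρ2
  have key : ∀ i : ℤ, (if ENNReal.ofReal (c * ρ ^ i) ≤ X then
      ENNReal.ofReal (c * ρ ^ i) ^ α else 0) ≤
      ∑' m : ℕ, if i = i0 - m then κ ^ m * X ^ α else 0 := by
    intro i
    split_ifs with h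
    · rw [ENNReal.ofReal_le_iff_le_toReal hX] at h
      have hi : i ≤ i0 := by
        by_contra hlt
        push Not at hlt
        have : ρ ^ (i0 + 1) ≤ ρ ^ i := zpow_le_zpow_right₀ hρ2.le hlt
        have h3 : c * ρ ^ i ≤ X.toReal := h
        have h4 : X.toReal < c * ρ ^ (i0 + 1) := by rwa [div_lt_iff₀' hc] at hi2
        nlinarith
      obtain ⟨m, hm⟩ := Int.eq_ofNat_of_zero_le (sub_nonneg.2 hi)
      refine le_trans ?_ (ENNReal.le_tsum m)
      rw [if_pos (by omega)]
      have h5 : ENNReal.ofReal (c * ρ ^ i) ≤ ENNReal.ofReal (ρ⁻¹) ^ m * X := by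
        rw [← ENNReal.ofReal_toReal hX, ← ENNReal.ofReal_pow (by positivity),
          ← ENNReal.ofReal_mul (by positivity)]
        refine ENNReal.ofReal_le_ofReal ?_
        have : i = i0 - m := by omega
        rw [this, zpow_sub₀ hρ.ne', zpow_natCast, inv_pow]
        rw [le_div_iff₀ hc] at hi1
        calc c * (ρ ^ i0 / ρ ^ m) = (ρ ^ m)⁻¹ * (ρ ^ i0 * c) := by ring
          _ ≤ _ := by gcongr
      calc ENNReal.ofReal (c * ρ ^ i) ^ α ≤ (ENNReal.ofReal (ρ⁻¹) ^ m * X) ^ α := by gcongr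
        _ = κ ^ m * X ^ α := by
          rw [ENNReal.mul_rpow_of_nonneg _ _ hα.le, hκ, ← ENNReal.rpow_natCast,
            ← ENNReal.rpow_natCast, ← ENNReal.rpow_mul, ← ENNReal.rpow_mul, mul_comm α]
    · exact zero_le
  calc _ ≤ ∑' i : ℤ, ∑' m : ℕ, (if i = i0 - m then κ ^ m * X ^ α else 0) := ENNReal.tsum_le_tsum key
    _ = ∑' m : ℕ, κ ^ m * X ^ α := by
        rw [ENNReal.tsum_comm]
        congr 1; ext m
        rw [tsum_ite_eq]
    _ = _ := by rw [ENNReal.tsum_mul_right, ENNReal.tsum_geometric]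

theorem tsum_geometric_ge_cutoff {ρ α : ℝ} (hρ : 0 < ρ) (hρ1 : ρ ≠ 1) (hα : α < 0) :
    ∃ C : ℝ≥0∞, C ≠ ⊤ ∧ C ≠ 0 ∧ ∀ (c : ℝ) (X : ℝ≥0∞), 0 < c →
      ∑' i : ℤ, (if X ≤ ENNReal.ofReal (c * ρ ^ i) then ENNReal.ofReal (c * ρ ^ i) ^ α else 0)
        ≤ C * X ^ α := by
  obtain ⟨C, hC, hC0, h⟩ := tsum_geometric_le_cutoff (ρ := ρ⁻¹) (α := -α) (by positivity)
    (by simpa using hρ1) (by linarith)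
  refine ⟨C, hC, hC0, fun c X hc => ?_⟩
  convert h c⁻¹ X⁻¹ (by positivity) using 1
  · congr 1; ext i
    have : c⁻¹ * ρ⁻¹ ^ i = (c * ρ ^ i)⁻¹ := by rw [mul_inv, inv_zpow]
    rw [this, ENNReal.ofReal_inv_of_pos (by positivity), ENNReal.inv_rpow, ENNReal.rpow_neg,
      inv_inv]
    simp only [ENNReal.inv_le_inv]
  · rw [ENNReal.inv_rpow, ENNReal.rpow_neg, inv_inv]

/-- A family of constants indexed by a real parameter is dominated by a continuous increasing
function. -/
theorem exists_continuous_monotone_ge (K : ℕ → ℝ≥0∞) (hK : ∀ N, K N ≠ ⊤) :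
    ∃ ψ : ℝ → ℝ, MonotoneOn ψ (Ici 0) ∧ ContinuousOn ψ (Ici 0) ∧
      ∀ t, 0 ≤ t → K ⌈t⌉₊ ≤ ENNReal.ofReal (ψ t) := by
  set k : ℕ → ℝ := fun N => ∑ i ∈ Finset.range (N + 1), (K i).toReal with hk
  have hk0 : ∀ N, 0 ≤ k N := fun N => Finset.sum_nonneg fun i _ => ENNReal.toReal_nonneg
  have hkm : Monotone k := by
    intro a b hab
    refine Finset.sum_le_sum_of_subset_of_nonneg (fun i hi => ?_)
      (fun i _ _ => ENNReal.toReal_nonneg)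
    simp at hi ⊢; omega
  have hm : Monotone fun s : ℝ => k ⌈s⌉₊ := fun a b hab => hkm (Nat.ceil_mono hab)
  have h_int : ∀ a b : ℝ, IntervalIntegrable (fun s : ℝ => k ⌈s⌉₊) volume a b :=
    fun a b => hm.intervalIntegrable
  refine ⟨fun t => ∫ s in (0 : ℝ)..(t + 2), k ⌈s⌉₊, ?_, ?_, ?_⟩
  · intro a ha b hb hab
    simp only
    rw [← intervalIntegral.integral_add_adjacent_intervals (h_int 0 (a + 2)) (h_int (a + 2) (b + 2))]
    have : 0 ≤ ∫ s in (a + 2)..(b + 2), k ⌈s⌉₊ :=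
      intervalIntegral.integral_nonneg (by linarith) fun s _ => hk0 _
    linarith
  · have h1 : Continuous fun b => ∫ s in (0 : ℝ)..b, k ⌈s⌉₊ :=
      intervalIntegral.continuous_primitive h_int 0
    exact (h1.comp (continuous_id.add continuous_const)).continuousOn
  · intro t ht
    have h1 : k ⌈t⌉₊ ≤ ∫ s in (0 : ℝ)..(t + 2), k ⌈s⌉₊ := by
      rw [← intervalIntegral.integral_add_adjacent_intervals (h_int 0 (t + 1))
        (h_int (t + 1) (t + 2))]
      have h2 : 0 ≤ ∫ s in (0 : ℝ)..(t + 1), k ⌈s⌉₊ :=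
        intervalIntegral.integral_nonneg (by linarith) fun s _ => hk0 _
      have h3 : ∫ s in (t + 1)..(t + 2), k ⌈t⌉₊ ≤ ∫ s in (t + 1)..(t + 2), k ⌈s⌉₊ := by
        refine intervalIntegral.integral_mono_on (by linarith) (by simp) (h_int _ _) ?_
        intro s hs
        exact hm (by linarith [hs.1])
      rw [intervalIntegral.integral_const] at h3
      simp only [add_sub_add_left_eq_sub, smul_eq_mul] at h3
      linarith
    refine le_trans ?_ (ENNReal.ofReal_le_ofReal h1)
    refine ENNReal.le_ofReal_iff_toReal_le (hK _) (hk0 _) |>.2 ?_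
    exact Finset.single_le_sum (f := fun i => (K i).toReal)
      (fun i _ => ENNReal.toReal_nonneg) (by simp)

/-- The measure with density `w`. -/
noncomputable abbrev wm {n : ℕ} (w : En n → ℝ≥0∞) : Measure (En n) := volume.withDensity w

/-- A nontrivial measurable weight satisfying the `A_1` condition on balls with constant `A`. -/
structure A1W {n : ℕ} (A : ℝ≥0∞) (w : En n → ℝ≥0∞) : Prop where
  meas : Measurable w
  fin : ∀ c R, wm w (Metric.ball c R) ≠ ⊤
  pos : ∀ c R, 0 < R → wm w (Metric.ball c R) ≠ 0
  ae : ∀ᵐ z, ∀ c R, z ∈ Metric.ball c R →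
    wm w (Metric.ball c R) ≤ A * volume (Metric.ball c R) * w z


theorem En.norm_le_sum (x : En n) : ‖x‖ ≤ ∑ i, |x i| := by
  have h : x = ∑ i, x i • EuclideanSpace.single i (1 : ℝ) := by
    have := (EuclideanSpace.basisFun (Fin n) ℝ).sum_repr x
    simpa using this.symm
  calc ‖x‖ = ‖∑ i, x i • EuclideanSpace.single i (1 : ℝ)‖ := by rw [← h]
    _ ≤ ∑ i, ‖x i • EuclideanSpace.single i (1 : ℝ)‖ := norm_sum_le _ _
    _ = _ := by simp [norm_smul]

theorem En.abs_apply_le (x : En n) (i : Fin n) : |x i| ≤ ‖x‖ := by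
  simpa using PiLp.norm_apply_le x i

theorem volume_ball_mul (c : En n) {t : ℝ} (ht : 0 < t) (R : ℝ) :
    volume (Metric.ball c (t * R)) = ENNReal.ofReal (t ^ n) * volume (Metric.ball c R) := by
  rw [Measure.addHaar_ball_mul_of_pos _ _ ht, finrank_euclideanSpace, Fintype.card_fin,
    Measure.addHaar_ball_center volume c]

theorem volume_ball_ne_zero (c : En n) {R : ℝ} (hR : 0 < R) : volume (Metric.ball c R) ≠ 0 :=
  (Metric.measure_ball_pos volume c hR).ne'

theorem volume_ball_ne_top (c : En n) (R : ℝ) : volume (Metric.ball c R) ≠ ⊤ :=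
  measure_ball_lt_top.ne

theorem lintegral_comp_add_smul {F : En n → ℝ≥0∞} (hF : Measurable F) (a : En n) {σ : ℝ}
    (hσ : 0 < σ) : ∫⁻ v, F (a + σ • v) = ENNReal.ofReal (σ ^ n)⁻¹ * ∫⁻ u, F u := by
  have h := Measure.map_addHaar_smul (volume : Measure (En n)) hσ.ne'
  rw [finrank_euclideanSpace, Fintype.card_fin, abs_of_nonneg (by positivity)] at h
  calc ∫⁻ v, F (a + σ • v) = ∫⁻ u, F (a + u) ∂(Measure.map (fun v => σ • v) volume) := by
        rw [lintegral_map (by fun_prop) (by fun_prop)]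
    _ = ENNReal.ofReal (σ ^ n)⁻¹ * ∫⁻ u, F (a + u) := by
        rw [h, lintegral_smul_measure, smul_eq_mul]
    _ = _ := by rw [lintegral_add_left_eq_self]

/-- The volume is itself an `A_1` weight. -/
theorem A1W_one : A1W (n := n) 1 (fun _ => 1) where
  meas := measurable_const
  fin c R := by simpa [wm] using volume_ball_ne_top c R
  pos c R hR := by simpa [wm] using volume_ball_ne_zero c hR
  ae := by simp [wm]

namespace A1W

variable {A : ℝ≥0∞} {w : En n → ℝ≥0∞}

theorem lintegral_wm (hw : A1W A w) {F : En n → ℝ≥0∞} (hF : Measurable F) (S : Set (En n))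
    (hS : MeasurableSet S) : ∫⁻ x in S, F x ∂(wm w) = ∫⁻ x in S, w x * F x := by
  rw [wm, restrict_withDensity hS, lintegral_withDensity_eq_lintegral_mul _ hw.meas hF]; rfl

theorem mul_lintegral_ball_le (hw : A1W A w) {F : En n → ℝ≥0∞} (hF : Measurable F)
    (c : En n) (R : ℝ) :
    wm w (Metric.ball c R) * ∫⁻ x in Metric.ball c R, F x
      ≤ A * volume (Metric.ball c R) * ∫⁻ x in Metric.ball c R, F x ∂(wm w) := by
  rw [hw.lintegral_wm hF _ measurableSet_ball, ← lintegral_const_mul _ hF,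
    ← lintegral_const_mul _ (f := fun x => w x * F x) (hw.meas.mul hF)]
  refine lintegral_mono_ae ?_
  filter_upwards [ae_restrict_of_ae hw.ae, ae_restrict_mem measurableSet_ball] with z hz hm
  calc wm w (Metric.ball c R) * F z ≤ A * volume (Metric.ball c R) * w z * F z := by
        gcongr; exact hz c R hm
    _ = _ := by ring

theorem measure_ball_le (hw : A1W A w) (c c' : En n) {R R' t : ℝ} (hR : 0 < R) (ht : 0 < t)
    (hR' : R' ≤ t * R) (hsub : Metric.ball c R ⊆ Metric.ball c' R') :
    wm w (Metric.ball c' R') ≤ A * ENNReal.ofReal (t ^ n) * wm w (Metric.ball c R) := by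
  have h := hw.mul_lintegral_ball_le (F := (Metric.ball c R).indicator 1)
    (measurable_one.indicator measurableSet_ball) c' R'
  rw [lintegral_indicator_one measurableSet_ball, lintegral_indicator_one measurableSet_ball,
    Measure.restrict_apply measurableSet_ball, Measure.restrict_apply measurableSet_ball,
    inter_eq_left.2 hsub] at h
  have hv : volume (Metric.ball c' R') ≤ ENNReal.ofReal (t ^ n) * volume (Metric.ball c R) := by
    calc volume (Metric.ball c' R') ≤ volume (Metric.ball c' (t * R)) :=
          measure_mono (Metric.ball_subset_ball hR')
      _ = ENNReal.ofReal (t ^ n) * volume (Metric.ball c' R) := volume_ball_mul _ ht _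
      _ = _ := by rw [Measure.addHaar_ball_center, Measure.addHaar_ball_center volume c]
  have h2 : wm w (Metric.ball c' R') * volume (Metric.ball c R) ≤
      (A * ENNReal.ofReal (t ^ n) * wm w (Metric.ball c R)) * volume (Metric.ball c R) := by
    refine h.trans ?_
    calc _ ≤ A * (ENNReal.ofReal (t ^ n) * volume (Metric.ball c R)) * wm w (Metric.ball c R) := by
          gcongr
      _ = _ := by ring
  exact (ENNReal.mul_le_mul_iff_left (volume_ball_ne_zero c hR) (volume_ball_ne_top c R)).1 h2

theorem ae_lintegral_sub_smul_le (hw : A1W A w) :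
    ∀ᵐ u, ∀ σ ρ : ℝ, 0 < σ → 0 < ρ →
      ∫⁻ v in Metric.ball 0 ρ, w (u - σ • v) ≤ A * volume (Metric.ball (0 : En n) ρ) * w u := by
  filter_upwards [hw.ae] with u hu σ ρ hσ hρ
  have h1 : ∫⁻ v in Metric.ball 0 ρ, w (u - σ • v) =
      ∫⁻ v, ((Metric.ball u (σ * ρ)).indicator w) (u + σ • v) := by
    rw [← lintegral_indicator measurableSet_ball, ← lintegral_neg_eq_self]
    congr 1; ext v
    have : u + σ • v ∈ Metric.ball u (σ * ρ) ↔ -v ∈ Metric.ball (0 : En n) ρ := by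
      simp [norm_smul, abs_of_pos hσ, hσ]
    by_cases hv : -v ∈ Metric.ball (0 : En n) ρ
    · rw [indicator_of_mem hv, indicator_of_mem (this.2 hv)]; simp
    · rw [indicator_of_notMem hv, indicator_of_notMem (fun h => hv (this.1 h))]
  rw [h1, lintegral_comp_add_smul (hw.meas.indicator measurableSet_ball) u hσ,
    lintegral_indicator measurableSet_ball, ← withDensity_apply _ measurableSet_ball]
  calc _ ≤ ENNReal.ofReal (σ ^ n)⁻¹ * (A * volume (Metric.ball u (σ * ρ)) * w u) := by
        gcongr; exact hu u _ (Metric.mem_ball_self (by positivity))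
    _ = (ENNReal.ofReal (σ ^ n)⁻¹ * ENNReal.ofReal (σ ^ n)) *
        (A * volume (Metric.ball (0 : En n) ρ) * w u) := by
        rw [volume_ball_mul _ hσ, Measure.addHaar_ball_center]; ring
    _ = _ := by
        rw [← ENNReal.ofReal_mul (by positivity), inv_mul_cancel₀ (by positivity)]; simp

end A1W

/-- A weight in the class `A_1` is either trivial or satisfies the ball version of the `A_1`
condition. -/
theorem exists_A1W_of_ApConst (hn : 0 < n) :
    ∃ κ : ℝ≥0∞, κ ≠ ⊤ ∧ ∀ υ : En n → ℝ, IsAp 1 υ →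
      ∃ w : En n → ℝ≥0∞, w =ᵐ[volume] (fun x => ENNReal.ofReal (υ x)) ∧
        (w =ᵐ[volume] 0 ∨ A1W (κ * ApConst 1 υ) w) := by
  refine ⟨ENNReal.ofReal ((4 * n : ℝ) ^ n), ENNReal.ofReal_ne_top, fun υ hυ => ?_⟩
  obtain ⟨h0, hloc, hA⟩ := hυ
  have hae : AEMeasurable (fun x => ENNReal.ofReal (υ x)) volume :=
    hloc.aestronglyMeasurable.aemeasurable.ennreal_ofReal
  refine ⟨hae.mk _, hae.ae_eq_mk.symm, ?_⟩
  set w := hae.mk _ with hw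
  have hwm : Measurable w := hae.measurable_mk
  have hwe : w =ᵐ[volume] fun x => ENNReal.ofReal (υ x) := hae.ae_eq_mk.symm
  have hn' : (0 : ℝ) < n := by exact_mod_cast hn
  have hopen : ∀ (a : Fin n → ℝ) (l : ℝ), IsOpen (cube a l) := by
    intro a l
    have : cube a l = ⋂ i, (fun x : En n => x i) ⁻¹' Ioo (a i) (a i + l) := by
      ext x; simp [cube]
    rw [this]
    exact isOpen_iInter_of_finite fun i => isOpen_Ioo.preimage (by fun_prop)
  have hcube : ∀ (a : Fin n → ℝ) (l : ℝ), 0 < l → volume (cube a l) ≠ 0 →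
      volume (cube a l) ≠ ⊤ → ∀ᵐ z, z ∈ cube a l →
        wm w (cube a l) ≤ ApConst 1 υ * volume (cube a l) * w z := by
    intro a l hl hv0 hvt
    have h1 : avgE υ (cube a l) * essSup (fun x => (ENNReal.ofReal (υ x))⁻¹)
        (volume.restrict (cube a l)) ≤ ApConst 1 υ := by
      rw [ApConst, if_pos rfl]
      exact le_iSup_of_le a (le_iSup_of_le l (le_iSup_of_le hl le_rfl))
    have h2 := ae_le_essSup (f := fun x => (ENNReal.ofReal (υ x))⁻¹)
      (μ := volume.restrict (cube a l))
    rw [ae_restrict_iff' (hopen a l).measurableSet] at h2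
    have h4 : wm w (cube a l) = wInt υ (cube a l) := by
      rw [wm, withDensity_apply _ (hopen a l).measurableSet, wInt]
      exact lintegral_congr_ae (ae_restrict_of_ae hwe)
    filter_upwards [h2, hwe] with z hz hwz hm
    have h3 : avgE υ (cube a l) * (w z)⁻¹ ≤ ApConst 1 υ := by
      rw [hwz]; refine le_trans ?_ h1; gcongr; exact hz hm
    have h5 : avgE υ (cube a l) ≤ ApConst 1 υ * w z := by
      rcases eq_or_ne (w z) 0 with hz0 | hz0
      · rw [hz0, ENNReal.inv_zero] at h3
        have : avgE υ (cube a l) = 0 := by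
          by_contra hne
          rw [ENNReal.mul_top hne] at h3
          exact absurd hA (not_lt.2 h3)
        simp [this]
      · rw [← div_eq_mul_inv] at h3
        have hzt : w z ≠ ⊤ := by rw [hwz]; simp
        exact (ENNReal.div_le_iff hz0 hzt).1 h3
    rw [avgE, ENNReal.div_le_iff hv0 hvt] at h5
    rw [h4]
    refine h5.trans (le_of_eq ?_)
    ring
  have hall : ∀ᵐ z, ∀ (a : Fin n → ℚ) (l : ℚ), 0 < (l : ℝ) →
      volume (cube (fun i => (a i : ℝ)) l) ≠ 0 →
      volume (cube (fun i => (a i : ℝ)) l) ≠ ⊤ → z ∈ cube (fun i => (a i : ℝ)) l →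
        wm w (cube (fun i => (a i : ℝ)) l) ≤
          ApConst 1 υ * volume (cube (fun i => (a i : ℝ)) l) * w z := by
    rw [ae_all_iff]; intro a
    rw [ae_all_iff]; intro l
    by_cases hl : 0 < (l : ℝ)
    · by_cases hv0 : volume (cube (fun i => (a i : ℝ)) l) ≠ 0
      · by_cases hvt : volume (cube (fun i => (a i : ℝ)) l) ≠ ⊤
        · filter_upwards [hcube _ _ hl hv0 hvt] with z hz _ _ _ using hz
        · exact Eventually.of_forall fun z _ _ h => absurd h hvt
      · exact Eventually.of_forall fun z _ h => absurd h hv0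
    · exact Eventually.of_forall fun z h => absurd h hl
  have hball : ∀ᵐ z, ∀ c R, z ∈ Metric.ball c R →
      wm w (Metric.ball c R) ≤
        (ENNReal.ofReal ((4 * n : ℝ) ^ n) * ApConst 1 υ) * volume (Metric.ball c R) * w z := by
    filter_upwards [hall] with z hz c R hm
    have hR : 0 < R := Metric.pos_of_mem_ball hm
    have ha : ∀ i, ∃ q : ℚ, c i - 3 / 2 * R < q ∧ (q : ℝ) < c i - R := fun i =>
      exists_rat_btwn (by linarith)
    choose a ha1 ha2 using ha
    obtain ⟨l, hl1, hl2⟩ := exists_rat_btwn (show 5 / 2 * R < 3 * R by linarith)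
    have hsub : Metric.ball c R ⊆ cube (fun i => (a i : ℝ)) l := by
      intro x hx i
      have h1 := En.abs_apply_le (x - c) i
      rw [Metric.mem_ball, dist_eq_norm] at hx
      have h2 : |x i - c i| < R := lt_of_le_of_lt (by simpa using h1) hx
      rw [abs_lt] at h2
      constructor <;> linarith [ha1 i, ha2 i]
    have hsub2 : cube (fun i => (a i : ℝ)) l ⊆ Metric.ball c (4 * n * R) := by
      intro x hx
      rw [Metric.mem_ball, dist_eq_norm]
      have h1 : ∀ i, |(x - c) i| < 4 * R := by
        intro i
        have := hx i
        simp only [mem_Ioo] at this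
        simp only [PiLp.sub_apply]
        rw [abs_lt]
        constructor <;> linarith [ha1 i, ha2 i]
      have : Nonempty (Fin n) := ⟨⟨0, hn⟩⟩
      calc ‖x - c‖ ≤ ∑ i, |(x - c) i| := En.norm_le_sum _
        _ < ∑ i : Fin n, 4 * R := Finset.sum_lt_sum_of_nonempty Finset.univ_nonempty
            fun i _ => h1 i
        _ = 4 * n * R := by simp; ring
    have hv : volume (cube (fun i => (a i : ℝ)) l) ≤
        ENNReal.ofReal ((4 * n : ℝ) ^ n) * volume (Metric.ball c R) := by
      rw [← volume_ball_mul c (by positivity)]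
      exact measure_mono hsub2
    calc wm w (Metric.ball c R) ≤ wm w (cube (fun i => (a i : ℝ)) l) := measure_mono hsub
      _ ≤ ApConst 1 υ * volume (cube (fun i => (a i : ℝ)) l) * w z :=
          hz a l (by linarith)
            (fun h => volume_ball_ne_zero c hR (measure_mono_null hsub h))
            (ne_top_of_le_ne_top (by finiteness [volume_ball_ne_top c R]) hv) (hsub hm)
      _ ≤ ApConst 1 υ * (ENNReal.ofReal ((4 * n : ℝ) ^ n) * volume (Metric.ball c R)) * w z := by
          gcongr
      _ = _ := by ring
  by_cases hpos : ∀ c R, 0 < R → wm w (Metric.ball c R) ≠ 0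
  · refine Or.inr ⟨hwm, fun c R => ?_, hpos, hball⟩
    rw [wm, withDensity_apply _ measurableSet_ball]
    have h1 : ∫⁻ x in Metric.ball c R, w x = ∫⁻ x in Metric.ball c R, ENNReal.ofReal (υ x) :=
      lintegral_congr_ae (ae_restrict_of_ae hwe)
    rw [h1]
    have h2 : IntegrableOn υ (Metric.ball c R) :=
      (hloc.integrableOn_isCompact (isCompact_closedBall c R)).mono_set Metric.ball_subset_closedBall
    refine ne_top_of_le_ne_top h2.2.ne (lintegral_mono fun x => ?_)
    exact Real.ofReal_le_enorm _
  · left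
    push Not at hpos
    obtain ⟨c, R, hR, hz⟩ := hpos
    have hz' : ∀ᵐ x ∂(volume.restrict (Metric.ball c R)), w x = 0 := by
      rw [wm, withDensity_apply _ measurableSet_ball, lintegral_eq_zero_iff hwm] at hz
      exact hz
    have hbig : ∀ N : ℕ, ∀ᵐ x ∂(volume.restrict (Metric.ball c (R + N))), w x = 0 := by
      intro N
      have : ∃ z ∈ Metric.ball c R, w z = 0 ∧ ∀ c R, z ∈ Metric.ball c R →
          wm w (Metric.ball c R) ≤
          (ENNReal.ofReal ((4 * n : ℝ) ^ n) * ApConst 1 υ) * volume (Metric.ball c R) * w z := by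
        have : NeBot (ae (volume.restrict (Metric.ball c R))) := by
          rw [ae_neBot, Ne, Measure.restrict_eq_zero]; exact volume_ball_ne_zero c hR
        obtain ⟨z, hz1, hz2, hz3⟩ := (hz'.and ((ae_restrict_of_ae hball).and
          (ae_restrict_mem measurableSet_ball))).exists
        exact ⟨z, hz3, hz1, hz2⟩
      obtain ⟨z, hzm, hz0, hzb⟩ := this
      have h1 := hzb c (R + N) (Metric.ball_subset_ball (by simp) hzm)
      rw [hz0, mul_zero, nonpos_iff_eq_zero, wm, withDensity_apply _ measurableSet_ball,
        lintegral_eq_zero_iff hwm] at h1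
      exact h1
    have hN : ∀ᵐ x, ∀ N : ℕ, x ∈ Metric.ball c (R + N) → w x = 0 := by
      rw [ae_all_iff]; intro N
      exact (ae_restrict_iff' measurableSet_ball).1 (hbig N)
    filter_upwards [hN] with x hx
    obtain ⟨N, hN⟩ := exists_nat_gt (dist x c)
    exact hx N (by rw [Metric.mem_ball]; linarith)

/-- The averaged potential operator of order `d + 1` on the ball `ball c R`. -/
noncomputable def Jop (d : ℕ) (c : En n) (R : ℝ) (Γ : En n → ℝ≥0∞) (z : En n) : ℝ≥0∞ :=
  ∫⁻ σ in Ioo (0 : ℝ) 1, ENNReal.ofReal (σ ^ d) *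
    ((volume (Metric.ball c R))⁻¹ * ∫⁻ y in Metric.ball c R, Γ (z + σ • (y - z)))

theorem measurable_lintegral_segment {Γ : En n → ℝ≥0∞} (hΓ : Measurable Γ) (S : Set (En n)) :
    Measurable fun p : ℝ × En n => ∫⁻ y in S, Γ (p.2 + p.1 • (y - p.2)) := by
  refine Measurable.lintegral_prod_right'
    (f := fun q : (ℝ × En n) × En n => Γ (q.1.2 + q.1.1 • (q.2 - q.1.2))) ?_
  exact hΓ.comp (by fun_prop)

theorem measurable_Jop (d : ℕ) (c : En n) (R : ℝ) {Γ : En n → ℝ≥0∞} (hΓ : Measurable Γ) :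
    Measurable (Jop d c R Γ) := by
  unfold Jop
  refine Measurable.lintegral_prod_right'
    (f := fun q : En n × ℝ => ENNReal.ofReal (q.2 ^ d) *
    ((volume (Metric.ball c R))⁻¹ * ∫⁻ y in Metric.ball c R, Γ (q.1 + q.2 • (y - q.1)))) ?_
  have := (measurable_lintegral_segment hΓ (Metric.ball c R)).comp
    (measurable_swap : Measurable (Prod.swap : En n × ℝ → ℝ × En n))
  exact Measurable.mul (by fun_prop) (this.const_mul _)

theorem segment_mem_ball {c : En n} {R : ℝ} {z y : En n} {σ : ℝ} (hσ : σ ∈ Ioo (0 : ℝ) 1)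
    (hz : z ∈ Metric.ball c R) (hy : y ∈ Metric.ball c R) :
    z + σ • (y - z) ∈ Metric.ball c R := by
  have := (convex_ball c R) hz hy (a := 1 - σ) (b := σ) (by linarith [hσ.2]) hσ.1.le (by ring)
  convert this using 1
  rw [smul_sub, sub_smul, one_smul]; abel

theorem lintegral_segment_le (c : En n) (R : ℝ) {F : En n → ℝ≥0∞}
    (hF : Measurable F) {σ : ℝ} (hσ : σ ∈ Ioo (0 : ℝ) 1) {z : En n} (hz : z ∈ Metric.ball c R) :
    ∫⁻ y in Metric.ball c R, F (z + σ • (y - z)) ≤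
      ENNReal.ofReal (σ ^ n)⁻¹ * ∫⁻ u in Metric.ball c R, F u := by
  rw [← lintegral_indicator measurableSet_ball, ← lintegral_indicator measurableSet_ball,
    ← lintegral_comp_add_smul (hF.indicator measurableSet_ball) z hσ.1,
    ← lintegral_sub_right_eq_self (fun v => (Metric.ball c R).indicator F (z + σ • v)) z]
  refine lintegral_mono fun y => ?_
  by_cases hy : y ∈ Metric.ball c R
  · simp only [indicator_of_mem hy, indicator_of_mem (segment_mem_ball hσ hz hy)]; exact le_rfl
  · simp [indicator_of_notMem hy]

theorem A1W.lintegral_lintegral_segment_le {A : ℝ≥0∞} {w : En n → ℝ≥0∞} (hw : A1W A w)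
    (c : En n) {R : ℝ} (hR : 0 < R) {F : En n → ℝ≥0∞}
    (hF : Measurable F) {σ : ℝ} (hσ : σ ∈ Ioo (0 : ℝ) 1) :
    ∫⁻ z in Metric.ball c R, (∫⁻ y in Metric.ball c R, F (z + σ • (y - z))) ∂(wm w) ≤
      A * volume (Metric.ball (0 : En n) (2 * R)) * ∫⁻ u in Metric.ball c R, F u ∂(wm w) := by
  set G := (Metric.ball c R).indicator F with hG
  have hGm : Measurable G := hF.indicator measurableSet_ball
  have hm : Measurable fun z : En n => ∫⁻ y in Metric.ball c R, F (z + σ • (y - z)) :=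
    (measurable_lintegral_segment hF _).comp (measurable_const.prodMk measurable_id)
  rw [hw.lintegral_wm hm _ measurableSet_ball, hw.lintegral_wm hF _ measurableSet_ball]
  calc ∫⁻ z in Metric.ball c R, w z * ∫⁻ y in Metric.ball c R, F (z + σ • (y - z))
      ≤ ∫⁻ z, w z * ∫⁻ v in Metric.ball (0 : En n) (2 * R), G (z + σ • v) := by
        rw [← lintegral_indicator measurableSet_ball]
        refine lintegral_mono fun z => ?_
        by_cases hz : z ∈ Metric.ball c R
        swap
        · simp [indicator_of_notMem hz]
        rw [indicator_of_mem hz]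
        gcongr w z * ?_
        rw [← lintegral_indicator measurableSet_ball, ← lintegral_indicator measurableSet_ball,
          ← lintegral_sub_right_eq_self
            ((Metric.ball (0 : En n) (2 * R)).indicator fun v => G (z + σ • v)) z]
        refine lintegral_mono fun y => ?_
        by_cases hy : y ∈ Metric.ball c R
        swap
        · simp [indicator_of_notMem hy]
        have h1 : y - z ∈ Metric.ball (0 : En n) (2 * R) := by
          rw [mem_ball_zero_iff, ← dist_eq_norm]
          calc dist y z ≤ dist y c + dist z c := dist_triangle_right _ _ _
            _ < 2 * R := by
              rw [Metric.mem_ball] at hy hz; linarith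
        rw [indicator_of_mem hy, indicator_of_mem h1, hG,
          indicator_of_mem (segment_mem_ball hσ hz hy)]
    _ = ∫⁻ z, ∫⁻ v in Metric.ball (0 : En n) (2 * R), w z * G (z + σ • v) := by
        congr 1; ext z
        rw [lintegral_const_mul _ (f := fun v => G (z + σ • v)) (hGm.comp (by fun_prop))]
    _ = ∫⁻ v in Metric.ball (0 : En n) (2 * R), ∫⁻ z, w z * G (z + σ • v) := by
        rw [lintegral_lintegral_swap]
        exact ((hw.meas.comp measurable_fst).mul (hGm.comp (by fun_prop))).aemeasurable
    _ = ∫⁻ v in Metric.ball (0 : En n) (2 * R), ∫⁻ u, w (u - σ • v) * G u := by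
        congr 1; ext v
        rw [← lintegral_sub_right_eq_self _ (σ • v)]
        simp
    _ = ∫⁻ u, ∫⁻ v in Metric.ball (0 : En n) (2 * R), w (u - σ • v) * G u := by
        rw [lintegral_lintegral_swap]
        exact ((hw.meas.comp (by fun_prop)).mul (hGm.comp measurable_snd)).aemeasurable
    _ = ∫⁻ u, (∫⁻ v in Metric.ball (0 : En n) (2 * R), w (u - σ • v)) * G u := by
        congr 1; ext u
        rw [lintegral_mul_const _ (f := fun v => w (u - σ • v)) (hw.meas.comp (by fun_prop))]
    _ ≤ ∫⁻ u, A * volume (Metric.ball (0 : En n) (2 * R)) * (w u * G u) := by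
        refine lintegral_mono_ae ?_
        filter_upwards [hw.ae_lintegral_sub_smul_le] with u hu
        rw [← mul_assoc]
        gcongr
        exact hu σ (2 * R) hσ.1 (by positivity)
    _ = _ := by
        rw [lintegral_const_mul _ (f := fun u => w u * G u) (hw.meas.mul hGm), ← lintegral_indicator measurableSet_ball]
        congr 2; ext u
        by_cases hu : u ∈ Metric.ball c R <;> simp [hG, hu]

theorem lintegral_rpow_Ioo_ne_top {δ : ℝ} (hδ : 0 < δ) :
    ∫⁻ σ in Ioo (0 : ℝ) 1, ENNReal.ofReal (σ ^ (δ - 1)) ≠ ⊤ := by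
  have h : IntegrableOn (fun σ : ℝ => σ ^ (δ - 1)) (Ioo 0 1) :=
    (intervalIntegral.integrableOn_Ioo_rpow_iff one_pos).2 (by linarith)
  exact ne_top_of_le_ne_top h.2.ne (lintegral_mono fun σ => Real.ofReal_le_enorm _)

/-- Weighted local Sobolev-type inequality for the averaged potential operator. -/
theorem Jop_rpow_le (d : ℕ) {s r : ℝ} (hs : 1 ≤ s) (hsr : s ≤ r)
    (h : (n : ℝ) * (1 / s - 1 / r) < d + 1) {A : ℝ≥0∞} (hA : A ≠ ⊤) :
    ∃ K : ℝ≥0∞, K ≠ ⊤ ∧ ∀ w : En n → ℝ≥0∞, A1W A w → ∀ (c : En n) (R : ℝ), 0 < R →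
      ∀ Γ : En n → ℝ≥0∞, Measurable Γ →
        ∫⁻ z in Metric.ball c R, Jop d c R Γ z ^ r ∂(wm w) ≤
          K * wm w (Metric.ball c R) *
            ((∫⁻ z in Metric.ball c R, Γ z ^ s ∂(wm w)) / wm w (Metric.ball c R)) ^ (r / s) := by
  have hs0 : 0 < s := by linarith
  have hr0 : 0 < r := by linarith
  have hrs : 1 ≤ r / s := by rwa [le_div_iff₀ hs0, one_mul]
  set β : ℝ := n * (1 / s - 1 / r) with hβ
  set δ : ℝ := d + 1 - β with hδ
  have hδ0 : 0 < δ := by linarith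
  set V : ℝ≥0∞ := ∫⁻ σ in Ioo (0 : ℝ) 1, ENNReal.ofReal (σ ^ (δ - 1)) with hV
  have hVt : V ≠ ⊤ := lintegral_rpow_Ioo_ne_top hδ0
  refine ⟨V ^ (r - 1) * (A ^ (r / s - 1) * (A * ENNReal.ofReal (2 ^ n)) * V), ?_, ?_⟩
  · have h1 : V ^ (r - 1) ≠ ⊤ := ENNReal.rpow_ne_top_of_nonneg (by linarith) hVt
    have h2 : A ^ (r / s - 1) ≠ ⊤ := ENNReal.rpow_ne_top_of_nonneg (by linarith) hA
    finiteness
  intro w hw c R hR Γ hΓ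
  set B := Metric.ball c R with hB
  set vB := volume B with hvB
  have hvB0 : vB ≠ 0 := volume_ball_ne_zero c hR
  have hvBt : vB ≠ ⊤ := volume_ball_ne_top c R
  set m := wm w with hm
  have hm0 : m B ≠ 0 := hw.pos c R hR
  have hmt : m B ≠ ⊤ := hw.fin c R
  set Y : ℝ≥0∞ := (∫⁻ z in B, Γ z ^ s ∂m) / m B with hY
  have hYm : ∫⁻ z in B, Γ z ^ s ∂m = Y * m B := (ENNReal.div_mul_cancel hm0 hmt).symm
  set ν : Measure ℝ := (volume.restrict (Ioo (0 : ℝ) 1)).withDensity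
    (fun σ => ENNReal.ofReal (σ ^ (δ - 1))) with hν
  have hdm : Measurable fun σ : ℝ => ENNReal.ofReal (σ ^ (δ - 1)) := by fun_prop
  have hνu : ν univ = V := by rw [hν, withDensity_apply _ MeasurableSet.univ]; simp [hV]
  have : IsFiniteMeasure ν := ⟨by rw [hνu]; exact hVt.lt_top⟩
  have hνmem : ∀ᵐ σ ∂ν, σ ∈ Ioo (0 : ℝ) 1 :=
    (withDensity_absolutelyContinuous _ _).ae_le (ae_restrict_mem measurableSet_Ioo)
  have hΓs : Measurable fun z => Γ z ^ s := hΓ.pow_const s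
  set H : ℝ → En n → ℝ≥0∞ := fun σ z => vB⁻¹ * ∫⁻ y in B, Γ (z + σ • (y - z)) with hH
  have hHm : Measurable fun p : ℝ × En n => H p.1 p.2 :=
    (measurable_lintegral_segment hΓ B).const_mul _
  have hJ : ∀ z, Jop d c R Γ z = ∫⁻ σ, ENNReal.ofReal (σ ^ β) * H σ z ∂ν := by
    intro z
    rw [hν, lintegral_withDensity_eq_lintegral_mul _ hdm, Jop]
    · refine setLIntegral_congr_fun measurableSet_Ioo fun σ hσ => ?_
      simp only [Pi.mul_apply]
      rw [← mul_assoc (ENNReal.ofReal (σ ^ (δ - 1))), ← ENNReal.ofReal_mul (Real.rpow_nonneg hσ.1.le _), ← Real.rpow_add hσ.1]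
      have : δ - 1 + β = (d : ℕ) := by rw [hδ]; ring
      rw [this, Real.rpow_natCast]
    · exact Measurable.mul (by fun_prop) (hHm.comp (measurable_id.prodMk measurable_const))
  have hJr : ∀ z, Jop d c R Γ z ^ r ≤
      V ^ (r - 1) * ∫⁻ σ, ENNReal.ofReal (σ ^ β) ^ r * H σ z ^ r ∂ν := by
    intro z
    rw [hJ]
    have := lintegral_rpow_le_measure_mul ν (f := fun σ => ENNReal.ofReal (σ ^ β) * H σ z)
      (Measurable.mul (by fun_prop) (hHm.comp (measurable_id.prodMk measurable_const))).aemeasurable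
      (r := r) (by linarith)
    rw [hνu] at this
    simpa only [ENNReal.mul_rpow_of_nonneg _ _ hr0.le] using this
  have hHs : ∀ σ z, H σ z ^ s ≤ vB⁻¹ * ∫⁻ y in B, Γ (z + σ • (y - z)) ^ s := by
    intro σ z
    have h1 := lintegral_rpow_le_measure_mul (volume.restrict B)
      (f := fun y => Γ (z + σ • (y - z))) (hΓ.comp (by fun_prop)).aemeasurable hs
    rw [Measure.restrict_apply_univ] at h1
    rw [hH]; simp only
    rw [ENNReal.mul_rpow_of_nonneg _ _ hs0.le]
    calc vB⁻¹ ^ s * (∫⁻ y in B, Γ (z + σ • (y - z))) ^ s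
        ≤ vB⁻¹ ^ s * (vB ^ (s - 1) * ∫⁻ y in B, Γ (z + σ • (y - z)) ^ s) := by gcongr
      _ = vB⁻¹ * ∫⁻ y in B, Γ (z + σ • (y - z)) ^ s := by
        rw [← mul_assoc, ENNReal.inv_rpow, ← ENNReal.rpow_neg, ← ENNReal.rpow_add _ _ hvB0 hvBt]
        congr 1
        rw [show -s + (s - 1) = -1 by ring, ENNReal.rpow_neg_one]
  have hPoint : ∀ σ ∈ Ioo (0 : ℝ) 1, ∀ z ∈ B,
      vB⁻¹ * ∫⁻ y in B, Γ (z + σ • (y - z)) ^ s ≤ ENNReal.ofReal (σ ^ n)⁻¹ * (A * Y) := by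
    intro σ hσ z hz
    have h1 := lintegral_segment_le c R hΓs hσ hz
    have h2 := hw.mul_lintegral_ball_le hΓs c R
    have h3 : vB⁻¹ * ∫⁻ u in B, Γ u ^ s ≤ A * Y := by
      rw [hYm] at h2
      have h4 : m B * (∫⁻ u in B, Γ u ^ s) ≤ m B * (A * Y * vB) := by
        refine h2.trans (le_of_eq ?_); ring
      have h5 := (ENNReal.mul_le_mul_iff_right hm0 hmt).1 h4
      rw [mul_comm, ← div_eq_mul_inv]
      exact (ENNReal.div_le_iff hvB0 hvBt).2 h5
    calc vB⁻¹ * ∫⁻ y in B, Γ (z + σ • (y - z)) ^ s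
        ≤ vB⁻¹ * (ENNReal.ofReal (σ ^ n)⁻¹ * ∫⁻ u in B, Γ u ^ s) := by gcongr
      _ = ENNReal.ofReal (σ ^ n)⁻¹ * (vB⁻¹ * ∫⁻ u in B, Γ u ^ s) := by ring
      _ ≤ _ := by gcongr
  have hInt : ∀ σ ∈ Ioo (0 : ℝ) 1, ENNReal.ofReal (σ ^ β) ^ r * ∫⁻ z in B, H σ z ^ r ∂m ≤
      A ^ (r / s - 1) * (A * ENNReal.ofReal (2 ^ n)) * (m B * Y ^ (r / s)) := by
    intro σ hσ
    have hσn : (0 : ℝ) < σ ^ n := pow_pos hσ.1 n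
    have h1 : ∀ z ∈ B, H σ z ^ r ≤ (ENNReal.ofReal (σ ^ n)⁻¹ * (A * Y)) ^ (r / s - 1) *
        (vB⁻¹ * ∫⁻ y in B, Γ (z + σ • (y - z)) ^ s) := by
      intro z hz
      calc H σ z ^ r = (H σ z ^ s) ^ (r / s) := by
            rw [← ENNReal.rpow_mul]; congr 1; field_simp
        _ ≤ (vB⁻¹ * ∫⁻ y in B, Γ (z + σ • (y - z)) ^ s) ^ (r / s) := by gcongr; exact hHs σ z
        _ = (vB⁻¹ * ∫⁻ y in B, Γ (z + σ • (y - z)) ^ s) ^ (r / s - 1) *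
            (vB⁻¹ * ∫⁻ y in B, Γ (z + σ • (y - z)) ^ s) := by
          conv_rhs => rw [← ENNReal.rpow_one (vB⁻¹ * ∫⁻ y in B, Γ (z + σ • (y - z)) ^ s),
            ← ENNReal.rpow_mul, one_mul]
          rw [← ENNReal.rpow_add_of_nonneg _ _ (by linarith) zero_le_one]
          congr 1; ring
        _ ≤ _ := by
          refine mul_le_mul' (ENNReal.rpow_le_rpow (hPoint σ hσ z hz) (by linarith)) le_rfl
    have h2 : ∫⁻ z in B, (vB⁻¹ * ∫⁻ y in B, Γ (z + σ • (y - z)) ^ s) ∂m ≤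
        A * ENNReal.ofReal (2 ^ n) * (Y * m B) := by
      have hmz : Measurable fun z : En n => ∫⁻ y in B, Γ (z + σ • (y - z)) ^ s :=
        (measurable_lintegral_segment hΓs _).comp (measurable_const.prodMk measurable_id)
      rw [lintegral_const_mul _ hmz]
      calc _ ≤ vB⁻¹ * (A * volume (Metric.ball (0 : En n) (2 * R)) *
            ∫⁻ u in B, Γ u ^ s ∂m) := by
            gcongr; exact hw.lintegral_lintegral_segment_le c hR hΓs hσ
        _ = (vB⁻¹ * vB) * (A * ENNReal.ofReal (2 ^ n) * (Y * m B)) := by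
            rw [hYm, volume_ball_mul _ two_pos, hvB, hB, Measure.addHaar_ball_center volume c]
            ring
        _ = _ := by rw [ENNReal.inv_mul_cancel hvB0 hvBt, one_mul]
    have h3 : ∫⁻ z in B, H σ z ^ r ∂m ≤ (ENNReal.ofReal (σ ^ n)⁻¹ * (A * Y)) ^ (r / s - 1) *
        (A * ENNReal.ofReal (2 ^ n) * (Y * m B)) := by
      have hmz : Measurable fun z : En n => ∫⁻ y in B, Γ (z + σ • (y - z)) ^ s :=
        (measurable_lintegral_segment hΓs _).comp (measurable_const.prodMk measurable_id)
      calc _ ≤ ∫⁻ z in B, (ENNReal.ofReal (σ ^ n)⁻¹ * (A * Y)) ^ (r / s - 1) *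
            (vB⁻¹ * ∫⁻ y in B, Γ (z + σ • (y - z)) ^ s) ∂m :=
            setLIntegral_mono ((hmz.const_mul _).const_mul _) h1
        _ = (ENNReal.ofReal (σ ^ n)⁻¹ * (A * Y)) ^ (r / s - 1) *
            ∫⁻ z in B, (vB⁻¹ * ∫⁻ y in B, Γ (z + σ • (y - z)) ^ s) ∂m := by
            rw [lintegral_const_mul _ (hmz.const_mul _)]
        _ ≤ _ := by gcongr
    have h4 : ENNReal.ofReal (σ ^ β) ^ r * ENNReal.ofReal (σ ^ n)⁻¹ ^ (r / s - 1) = 1 := by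
      rw [ENNReal.ofReal_rpow_of_nonneg (Real.rpow_nonneg hσ.1.le _) hr0.le,
        ENNReal.ofReal_rpow_of_nonneg (by positivity) (by linarith),
        ← ENNReal.ofReal_mul (by positivity [Real.rpow_nonneg hσ.1.le β]), ENNReal.ofReal_eq_one,
        ← Real.rpow_natCast, ← Real.rpow_neg hσ.1.le, ← Real.rpow_mul hσ.1.le,
        ← Real.rpow_mul hσ.1.le, ← Real.rpow_add hσ.1]
      have : β * r + -(n : ℝ) * (r / s - 1) = 0 := by rw [hβ]; field_simp; ring
      rw [this, Real.rpow_zero]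
    calc _ ≤ ENNReal.ofReal (σ ^ β) ^ r * ((ENNReal.ofReal (σ ^ n)⁻¹ * (A * Y)) ^ (r / s - 1) *
        (A * ENNReal.ofReal (2 ^ n) * (Y * m B))) := by gcongr
      _ = (ENNReal.ofReal (σ ^ β) ^ r * ENNReal.ofReal (σ ^ n)⁻¹ ^ (r / s - 1)) *
          (A ^ (r / s - 1) * (A * ENNReal.ofReal (2 ^ n)) * (m B * (Y ^ (r / s - 1) * Y))) := by
          rw [ENNReal.mul_rpow_of_nonneg _ _ (by linarith),
            ENNReal.mul_rpow_of_nonneg _ _ (by linarith)]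
          ring
      _ = _ := by
          rw [h4, one_mul]
          congr 2
          conv_lhs => rw [← ENNReal.rpow_one Y, ← ENNReal.rpow_mul, one_mul]
          rw [← ENNReal.rpow_add_of_nonneg _ _ (by linarith) zero_le_one]
          congr 1; ring
  have hmeas2 : Measurable fun p : En n × ℝ =>
      ENNReal.ofReal (p.2 ^ β) ^ r * H p.2 p.1 ^ r :=
    Measurable.mul (by fun_prop) ((hHm.comp measurable_swap).pow_const r)
  calc ∫⁻ z in B, Jop d c R Γ z ^ r ∂m
      ≤ ∫⁻ z in B, V ^ (r - 1) * ∫⁻ σ, ENNReal.ofReal (σ ^ β) ^ r * H σ z ^ r ∂ν ∂m :=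
        lintegral_mono fun z => hJr z
    _ = V ^ (r - 1) * ∫⁻ z in B, ∫⁻ σ, ENNReal.ofReal (σ ^ β) ^ r * H σ z ^ r ∂ν ∂m := by
        rw [lintegral_const_mul _ hmeas2.lintegral_prod_right']
    _ = V ^ (r - 1) * ∫⁻ σ, ∫⁻ z in B, ENNReal.ofReal (σ ^ β) ^ r * H σ z ^ r ∂m ∂ν := by
        rw [lintegral_lintegral_swap hmeas2.aemeasurable]
    _ = V ^ (r - 1) * ∫⁻ σ, ENNReal.ofReal (σ ^ β) ^ r * ∫⁻ z in B, H σ z ^ r ∂m ∂ν := by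
        congr 2; ext σ
        rw [lintegral_const_mul _ (f := fun z => H σ z ^ r)
          ((hHm.comp (measurable_const.prodMk measurable_id)).pow_const r)]
    _ ≤ V ^ (r - 1) * ∫⁻ σ, A ^ (r / s - 1) * (A * ENNReal.ofReal (2 ^ n)) *
          (m B * Y ^ (r / s)) ∂ν := by
        gcongr 1
        refine lintegral_mono_ae ?_
        filter_upwards [hνmem] with σ hσ using hInt σ hσ
    _ = _ := by
        rw [lintegral_const, hνu]
        ring

/-- The mixed partial derivative along a tuple of coordinate directions. -/
noncomputable def Dt {j : ℕ} (f : En n → ℝ) (ι : Fin j → Fin n) (x : En n) : ℝ :=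
  iteratedFDeriv ℝ j f x fun i => EuclideanSpace.single (ι i) (1 : ℝ)

theorem continuous_Dt {j : ℕ} {f : En n → ℝ} (hf : ContDiff ℝ (⊤ : ℕ∞) f) (ι : Fin j → Fin n) :
    Continuous (Dt f ι) := by
  have h := hf.continuous_iteratedFDeriv (m := j) (by exact_mod_cast le_top)
  unfold Dt
  fun_prop

theorem iteratedFDeriv_apply_const {j : ℕ} (f : En n → ℝ) (x v : En n) :
    iteratedFDeriv ℝ j f x (fun _ => v) = ∑ ι : Fin j → Fin n, (∏ i, v (ι i)) * Dt f ι x := by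
  have h : v = ∑ i, v i • EuclideanSpace.single i (1 : ℝ) := by
    have := (EuclideanSpace.basisFun (Fin n) ℝ).sum_repr v
    simpa using this.symm
  conv_lhs => rw [h]
  rw [ContinuousMultilinearMap.map_sum]
  refine Finset.sum_congr rfl fun ι _ => ?_
  rw [ContinuousMultilinearMap.map_smul_univ]
  rfl

theorem hasDerivAt_iteratedFDeriv_line {f : En n → ℝ} (hf : ContDiff ℝ (⊤ : ℕ∞) f) (j : ℕ)
    (y v : En n) (t : ℝ) :
    HasDerivAt (fun t : ℝ => iteratedFDeriv ℝ j f (y + t • v) (fun _ => v))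
      (iteratedFDeriv ℝ (j + 1) f (y + t • v) (fun _ => v)) t := by
  have h1 : HasFDerivAt (iteratedFDeriv ℝ j f) (fderiv ℝ (iteratedFDeriv ℝ j f) (y + t • v))
      (y + t • v) :=
    (hf.differentiable_iteratedFDeriv (m := j)
      (by exact_mod_cast ENat.natCast_lt_top j) _).hasFDerivAt
  have h2 : HasDerivAt (fun t : ℝ => y + t • v) v t := by
    simpa using ((hasDerivAt_id t).smul_const v).const_add y
  have h3 := h1.comp_hasDerivAt t h2
  have h4 := ((ContinuousMultilinearMap.apply ℝ (fun _ : Fin j => En n) ℝ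
    (fun _ => v)).hasFDerivAt).comp_hasDerivAt t h3
  exact h4

theorem kDiff_eq_zero_of_polynomial {k : ℕ} {P : En n → ℝ} {h x : En n} (p : Polynomial ℝ)
    (hp : p.natDegree < k) (hP : ∀ s : ℝ, P (x + s • h) = p.eval s) : kDiff k P h x = 0 := by
  have h1 := congrFun (Polynomial.fwdDiff_iter_eq_zero_of_degree_lt hp) 0
  rw [fwdDiff_iter_eq_sum_shift] at h1
  rw [kDiff, ← show (0 : ℝ → ℝ) 0 = 0 from rfl, ← h1]
  refine Finset.sum_congr rfl fun j _ => ?_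
  rw [hP]
  simp

/-- The restriction of `P` to every line is a polynomial of degree `< k`. -/
def PolyLT (k : ℕ) (P : En n → ℝ) : Prop :=
  ∀ x h : En n, ∃ p : Polynomial ℝ, p.natDegree < k ∧ ∀ s : ℝ, P (x + s • h) = p.eval s

theorem PolyLT.add {k : ℕ} {P Q : En n → ℝ} (hP : PolyLT k P) (hQ : PolyLT k Q) :
    PolyLT k fun z => P z + Q z := by
  intro x h
  obtain ⟨p, hp, hp'⟩ := hP x h
  obtain ⟨q, hq, hq'⟩ := hQ x h
  exact ⟨p + q, lt_of_le_of_lt (Polynomial.natDegree_add_le _ _) (max_lt hp hq), fun s => by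
    simp [hp', hq']⟩

theorem PolyLT.sum {ι : Type*} (S : Finset ι) {k : ℕ} (hk : 0 < k) {P : ι → En n → ℝ}
    (hP : ∀ i ∈ S, PolyLT k (P i)) : PolyLT k fun z => ∑ i ∈ S, P i z := by
  induction S using Finset.induction_on with
  | empty => exact fun x h => ⟨0, by simpa using hk, by simp⟩
  | insert a s ha ih =>
    simp only [Finset.sum_insert ha]
    exact (hP a (by simp)).add (ih fun i hi => hP i (by simp [hi]))

theorem polyLT_monomial {j k : ℕ} (hjk : j < k) (ι : Fin j → Fin n) (y : En n) (a : ℝ) :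
    PolyLT k fun z : En n => (∏ i, (z - y) (ι i)) * a := by
  intro x h
  refine ⟨(∏ i, (Polynomial.C (h (ι i)) * Polynomial.X + Polynomial.C ((x - y) (ι i)))) *
    Polynomial.C a, lt_of_le_of_lt ?_ hjk, fun s => ?_⟩
  · refine (Polynomial.natDegree_mul_C_le _ _).trans ?_
    refine (Polynomial.natDegree_prod_le _ _).trans ?_
    refine (Finset.sum_le_card_nsmul _ _ 1 fun i _ => Polynomial.natDegree_linear_le).trans ?_
    simp
  · simp only [Polynomial.eval_mul, Polynomial.eval_prod, Polynomial.eval_add, Polynomial.eval_C,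
      Polynomial.eval_X]
    congr 1
    refine Finset.prod_congr rfl fun i _ => ?_
    simp only [PiLp.sub_apply, PiLp.add_apply, PiLp.smul_apply, smul_eq_mul]
    ring

theorem taylor_remainder_le {G : ℕ → ℝ → ℝ} (hG : ∀ j t, HasDerivAt (G j) (G (j + 1) t) t)
    (d : ℕ) (m : ℝ) :
    ENNReal.ofReal |G 0 1 - (∑ j ∈ Finset.range (d + 1), (j.factorial : ℝ)⁻¹ * G j 0 +
        ((d + 1).factorial : ℝ)⁻¹ * m)| ≤
      ∫⁻ σ in Ioo (0 : ℝ) 1, ENNReal.ofReal (σ ^ d) * ENNReal.ofReal |G (d + 1) (1 - σ) - m| := by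
  have hcont : ∀ j, Continuous (G j) := fun j =>
    continuous_iff_continuousAt.2 fun t => (hG j t).continuousAt
  have hderiv : ∀ j, deriv (G j) = G (j + 1) := fun j => funext fun t => (hG j t).deriv
  have hit : ∀ j, iteratedDeriv j (G 0) = G j := by
    intro j
    induction j with
    | zero => simp
    | succ j ih => rw [iteratedDeriv_succ, ih, hderiv]
  have hsm : ∀ N : ℕ, ContDiff ℝ N (G 0) := by
    intro N
    rw [contDiff_nat_iff_iteratedDeriv]
    refine ⟨fun j _ => by rw [hit]; exact hcont j, fun j _ => by
      rw [hit]; exact fun t => (hG j t).differentiableAt⟩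
  have hun : UniqueDiffOn ℝ (uIcc (0 : ℝ) 1) := uniqueDiffOn_uIcc zero_ne_one
  have hw : ∀ j, ∀ t ∈ uIcc (0 : ℝ) 1, iteratedDerivWithin j (G 0) (uIcc 0 1) t = G j t := by
    intro j t ht
    rw [iteratedDerivWithin_eq_iteratedDeriv hun (hsm j).contDiffAt ht, hit]
  have hT := taylor_integral_remainder (f := G 0) (x₀ := 0) (x := 1) (n := d) (hsm _).contDiffOn
  rw [taylor_within_apply] at hT
  have h1 : ∑ j ∈ Finset.range (d + 1), ((j.factorial : ℝ)⁻¹ * (1 - 0) ^ j) •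
      iteratedDerivWithin j (G 0) (uIcc 0 1) 0 =
      ∑ j ∈ Finset.range (d + 1), (j.factorial : ℝ)⁻¹ * G j 0 := by
    refine Finset.sum_congr rfl fun j _ => ?_
    rw [hw j 0 (by simp)]; simp
  have h2 : ∫ t in (0 : ℝ)..1, ((1 - t) ^ d / d.factorial) •
      iteratedDerivWithin (d + 1) (G 0) (uIcc 0 1) t =
      ∫ t in (0 : ℝ)..1, ((1 - t) ^ d / d.factorial) * G (d + 1) t := by
    refine intervalIntegral.integral_congr fun t ht => ?_
    simp only [smul_eq_mul]
    rw [hw _ t ht]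
  have h3 : ∫ t in (0 : ℝ)..1, ((1 - t) ^ d / d.factorial) * m = ((d + 1).factorial : ℝ)⁻¹ * m := by
    rw [intervalIntegral.integral_mul_const, intervalIntegral.integral_div,
      intervalIntegral.integral_comp_sub_left (fun t => t ^ d) 1, integral_pow, Nat.factorial_succ]
    congr 1
    simp
    field_simp
  rw [h1, h2] at hT
  have h_int : Continuous fun t => ((1 - t) ^ d / d.factorial) * (G (d + 1) t - m) := by
    have := hcont (d + 1)
    fun_prop
  have h4 : G 0 1 - (∑ j ∈ Finset.range (d + 1), (j.factorial : ℝ)⁻¹ * G j 0 +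
        ((d + 1).factorial : ℝ)⁻¹ * m) =
      ∫ t in (0 : ℝ)..1, ((1 - t) ^ d / d.factorial) * (G (d + 1) t - m) := by
    rw [← sub_sub, hT, ← h3, ← intervalIntegral.integral_sub]
    · congr 1; ext t; ring
    · have := hcont (d + 1)
      exact Continuous.intervalIntegrable (by fun_prop) _ _
    · exact Continuous.intervalIntegrable (by fun_prop) _ _
  have h5 : ∫ t in (0 : ℝ)..1, ((1 - t) ^ d / d.factorial) * (G (d + 1) t - m) =
      ∫ σ in (0 : ℝ)..1, (σ ^ d / d.factorial) * (G (d + 1) (1 - σ) - m) := by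
    have := intervalIntegral.integral_comp_sub_left (a := 0) (b := 1)
      (fun σ => (σ ^ d / d.factorial) * (G (d + 1) (1 - σ) - m)) 1
    simpa using this
  rw [h4, h5, intervalIntegral.integral_of_le zero_le_one, integral_Ioc_eq_integral_Ioo,
    ← Real.norm_eq_abs, ofReal_norm]
  refine (enorm_integral_le_lintegral_enorm _).trans ?_
  refine setLIntegral_mono' measurableSet_Ioo fun σ hσ => ?_
  rw [← ofReal_norm, ← ENNReal.ofReal_mul (pow_nonneg hσ.1.le _)]
  refine ENNReal.ofReal_le_ofReal ?_
  rw [norm_mul, Real.norm_eq_abs, Real.norm_eq_abs, abs_of_nonneg (by have := hσ.1; positivity)]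
  gcongr
  exact div_le_self (pow_nonneg hσ.1.le _) (by exact_mod_cast d.factorial_pos)

/-- The oscillation of the derivatives of order `j` around the constants `M`. -/
noncomputable def oscG {j : ℕ} (f : En n → ℝ) (M : (Fin j → Fin n) → ℝ) (x : En n) : ℝ≥0∞ :=
  ∑ ι : Fin j → Fin n, ENNReal.ofReal |Dt f ι x - M ι|

theorem measurable_oscG {j : ℕ} {f : En n → ℝ} (hf : ContDiff ℝ (⊤ : ℕ∞) f)
    (M : (Fin j → Fin n) → ℝ) : Measurable (oscG f M) := by
  unfold oscG
  refine Finset.measurable_sum _ fun ι _ => ?_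
  have := (continuous_Dt hf ι).measurable
  fun_prop

theorem exists_polyLT_sub_le {f : En n → ℝ} (hf : ContDiff ℝ (⊤ : ℕ∞) f) (k d : ℕ)
    (M : (Fin (d + 1) → Fin n) → ℝ) (hk : d + 1 < k ∨ d < k ∧ ∀ ι, M ι = 0) (y : En n) :
    ∃ P : En n → ℝ, PolyLT k P ∧ ∀ z, ENNReal.ofReal |f z - P z| ≤
      ENNReal.ofReal (‖z - y‖ ^ (d + 1)) * ∫⁻ σ in Ioo (0 : ℝ) 1,
        ENNReal.ofReal (σ ^ d) * oscG f M (z + σ • (y - z)) := by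
  have hk0 : 0 < k := by omega
  refine ⟨fun z => (∑ j ∈ Finset.range (d + 1), ∑ ι : Fin j → Fin n,
    (∏ i, (z - y) (ι i)) * ((j.factorial : ℝ)⁻¹ * Dt f ι y)) +
      ∑ ι : Fin (d + 1) → Fin n, (∏ i, (z - y) (ι i)) * (((d + 1).factorial : ℝ)⁻¹ * M ι), ?_, ?_⟩
  · refine PolyLT.add (PolyLT.sum _ hk0 fun j hj => PolyLT.sum _ hk0 fun ι _ =>
      polyLT_monomial (by simp at hj; omega) ι y _) (PolyLT.sum _ hk0 fun ι _ => ?_)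
    rcases hk with hk | ⟨_, hM⟩
    · exact polyLT_monomial hk ι y _
    · simp only [hM, mul_zero]
      exact fun x h => ⟨0, by simpa using hk0, by simp⟩
  · intro z
    set m : ℝ := ∑ ι : Fin (d + 1) → Fin n, (∏ i, (z - y) (ι i)) * M ι with hm
    have h := taylor_remainder_le
      (G := fun j t => iteratedFDeriv ℝ j f (y + t • (z - y)) (fun _ => z - y))
      (fun j t => hasDerivAt_iteratedFDeriv_line hf j y (z - y) t) d m
    have h0 : iteratedFDeriv ℝ 0 f (y + (1 : ℝ) • (z - y)) (fun _ => z - y) = f z := by simp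
    have h1 : ∑ j ∈ Finset.range (d + 1), (j.factorial : ℝ)⁻¹ *
        iteratedFDeriv ℝ j f (y + (0 : ℝ) • (z - y)) (fun _ => z - y) =
        ∑ j ∈ Finset.range (d + 1), ∑ ι : Fin j → Fin n,
          (∏ i, (z - y) (ι i)) * ((j.factorial : ℝ)⁻¹ * Dt f ι y) := by
      refine Finset.sum_congr rfl fun j _ => ?_
      rw [iteratedFDeriv_apply_const, Finset.mul_sum, zero_smul, add_zero]
      exact Finset.sum_congr rfl fun ι _ => by ring
    have h2 : ((d + 1).factorial : ℝ)⁻¹ * m =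
        ∑ ι : Fin (d + 1) → Fin n, (∏ i, (z - y) (ι i)) * (((d + 1).factorial : ℝ)⁻¹ * M ι) := by
      rw [hm, Finset.mul_sum]
      exact Finset.sum_congr rfl fun ι _ => by ring
    beta_reduce
    rw [← h2, ← h1]
    simp only [h0] at h
    refine h.trans ?_
    rw [← lintegral_const_mul']
    swap
    · exact ENNReal.ofReal_ne_top
    refine setLIntegral_mono' measurableSet_Ioo fun σ hσ => ?_
    have h3 : y + (1 - σ) • (z - y) = z + σ • (y - z) := by
      rw [sub_smul, one_smul, smul_sub, smul_sub]; abel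
    rw [h3, iteratedFDeriv_apply_const, hm, ← Finset.sum_sub_distrib, ← mul_assoc,
      mul_comm (ENNReal.ofReal (‖z - y‖ ^ (d + 1))), mul_assoc]
    gcongr ENNReal.ofReal (σ ^ d) * ?_
    rw [oscG, Finset.mul_sum]
    refine (ENNReal.ofReal_le_ofReal (Finset.abs_sum_le_sum_abs _ _)).trans ?_
    rw [ENNReal.ofReal_sum_of_nonneg fun _ _ => abs_nonneg _]
    refine Finset.sum_le_sum fun ι _ => ?_
    rw [← mul_sub, abs_mul, ← ENNReal.ofReal_mul (by positivity), Finset.abs_prod]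
    refine ENNReal.ofReal_le_ofReal ?_
    gcongr
    calc ∏ i, |(z - y) (ι i)| ≤ ∏ _i : Fin (d + 1), ‖z - y‖ :=
          Finset.prod_le_prod (fun _ _ => abs_nonneg _) fun i _ => En.abs_apply_le _ _
      _ = _ := by simp

theorem abs_kDiff_le (k : ℕ) (f P : En n → ℝ) {h x : En n} (hP : PolyLT k P) :
    ENNReal.ofReal |kDiff k f h x| ≤ 2 ^ k * ∑ j ∈ Finset.range (k + 1),
      ENNReal.ofReal |f (x + (j : ℝ) • h) - P (x + (j : ℝ) • h)| := by
  obtain ⟨p, hp, hp'⟩ := hP x h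
  have h0 := kDiff_eq_zero_of_polynomial p hp hp'
  have h1 : kDiff k f h x = ∑ j ∈ Finset.range (k + 1), (-1 : ℝ) ^ (k - j) * (k.choose j : ℝ) *
      (f (x + (j : ℝ) • h) - P (x + (j : ℝ) • h)) := by
    rw [← sub_zero (kDiff k f h x), ← h0, kDiff, kDiff, ← Finset.sum_sub_distrib]
    exact Finset.sum_congr rfl fun j _ => by ring
  rw [h1, Finset.mul_sum]
  refine (ENNReal.ofReal_le_ofReal (Finset.abs_sum_le_sum_abs _ _)).trans ?_
  rw [ENNReal.ofReal_sum_of_nonneg fun _ _ => abs_nonneg _]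
  refine Finset.sum_le_sum fun j hj => ?_
  rw [abs_mul, abs_mul, abs_pow, abs_neg, abs_one, one_pow, one_mul, Nat.abs_cast,
    ENNReal.ofReal_mul (by positivity)]
  gcongr
  have : k.choose j ≤ 2 ^ k := Nat.choose_le_two_pow k j
  rw [ENNReal.ofReal_natCast]
  exact_mod_cast this

theorem measurable_lintegral_segment_right (d : ℕ) {Γ : En n → ℝ≥0∞} (hΓ : Measurable Γ)
    (z : En n) : Measurable fun y => ∫⁻ σ in Ioo (0 : ℝ) 1,
      ENNReal.ofReal (σ ^ d) * Γ (z + σ • (y - z)) := by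
  have hjm : Measurable fun q : En n × ℝ =>
      ENNReal.ofReal (q.2 ^ d) * Γ (z + q.2 • (q.1 - z)) :=
    Measurable.mul (by fun_prop) (hΓ.comp (by fun_prop))
  exact Measurable.lintegral_prod_right' hjm

theorem setLIntegral_lintegral_segment (d : ℕ) {Γ : En n → ℝ≥0∞} (hΓ : Measurable Γ)
    (c : En n) {R : ℝ} (hR : 0 < R) (z : En n) :
    ∫⁻ y in Metric.ball c R, ∫⁻ σ in Ioo (0 : ℝ) 1, ENNReal.ofReal (σ ^ d) *
      Γ (z + σ • (y - z)) = volume (Metric.ball c R) * Jop d c R Γ z := by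
  have hB0 : volume (Metric.ball c R) ≠ 0 := volume_ball_ne_zero c hR
  have hBt : volume (Metric.ball c R) ≠ ⊤ := volume_ball_ne_top c R
  have hjm : Measurable fun q : En n × ℝ =>
      ENNReal.ofReal (q.2 ^ d) * Γ (z + q.2 • (q.1 - z)) :=
    Measurable.mul (by fun_prop) (hΓ.comp (by fun_prop))
  rw [lintegral_lintegral_swap hjm.aemeasurable, Jop, ← lintegral_const_mul' _ _ hBt]
  refine lintegral_congr fun σ => ?_
  rw [lintegral_const_mul' _ _ ENNReal.ofReal_ne_top, mul_left_comm, ← mul_assoc (volume _),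
    ENNReal.mul_inv_cancel hB0 hBt, one_mul]

theorem kDiff_le_sum_segment {f : En n → ℝ} (hf : ContDiff ℝ (⊤ : ℕ∞) f) (k d : ℕ)
    (M : (Fin (d + 1) → Fin n) → ℝ) (hk : d + 1 < k ∨ d < k ∧ ∀ ι, M ι = 0)
    {c : En n} {R : ℝ} {x h : En n}
    (hx : ∀ j ∈ Finset.range (k + 1), x + (j : ℝ) • h ∈ Metric.ball c R)
    {y : En n} (hy : y ∈ Metric.ball c R) :
    ENNReal.ofReal |kDiff k f h x| ≤ ENNReal.ofReal (2 ^ k * (2 * R) ^ (d + 1)) *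
      ∑ j ∈ Finset.range (k + 1), ∫⁻ σ in Ioo (0 : ℝ) 1,
        ENNReal.ofReal (σ ^ d) * oscG f M (x + (j : ℝ) • h + σ • (y - (x + (j : ℝ) • h))) := by
  obtain ⟨P, hP, hb⟩ := exists_polyLT_sub_le hf k d M hk y
  refine (abs_kDiff_le k f P hP).trans ?_
  rw [ENNReal.ofReal_mul (pow_nonneg zero_le_two _), mul_assoc,
    ENNReal.ofReal_pow zero_le_two k, ENNReal.ofReal_ofNat]
  refine mul_le_mul' le_rfl ?_
  rw [Finset.mul_sum]
  refine Finset.sum_le_sum fun j hj => (hb _).trans ?_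
  refine mul_le_mul' (ENNReal.ofReal_le_ofReal ?_) le_rfl
  refine pow_le_pow_left₀ (norm_nonneg _) ?_ _
  rw [← dist_eq_norm]
  have h2 := hx j hj
  rw [Metric.mem_ball] at hy h2
  linarith [dist_triangle_right (x + (j : ℝ) • h) y c]

theorem kDiff_le_Jop {f : En n → ℝ} (hf : ContDiff ℝ (⊤ : ℕ∞) f) (k d : ℕ)
    (M : (Fin (d + 1) → Fin n) → ℝ) (hk : d + 1 < k ∨ d < k ∧ ∀ ι, M ι = 0)
    {c : En n} {R : ℝ} (hR : 0 < R) {x h : En n}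
    (hx : ∀ j ∈ Finset.range (k + 1), x + (j : ℝ) • h ∈ Metric.ball c R) :
    ENNReal.ofReal |kDiff k f h x| ≤ ENNReal.ofReal (2 ^ k * (2 * R) ^ (d + 1)) *
      ∑ j ∈ Finset.range (k + 1), Jop d c R (oscG f M) (x + (j : ℝ) • h) := by
  have hB0 : volume (Metric.ball c R) ≠ 0 := volume_ball_ne_zero c hR
  have hBt : volume (Metric.ball c R) ≠ ⊤ := volume_ball_ne_top c R
  have hΓ := measurable_oscG hf M
  have h1 : volume (Metric.ball c R) * ENNReal.ofReal |kDiff k f h x| ≤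
      ∫⁻ y in Metric.ball c R, ENNReal.ofReal (2 ^ k * (2 * R) ^ (d + 1)) *
      ∑ j ∈ Finset.range (k + 1), ∫⁻ σ in Ioo (0 : ℝ) 1,
        ENNReal.ofReal (σ ^ d) *
          oscG f M (x + (j : ℝ) • h + σ • (y - (x + (j : ℝ) • h))) := by
    rw [mul_comm, ← setLIntegral_const]
    exact setLIntegral_mono' measurableSet_ball fun y hy =>
      kDiff_le_sum_segment hf k d M hk hx hy
  rw [lintegral_const_mul' _ _ ENNReal.ofReal_ne_top, lintegral_finsetSum _ fun j _ =>
    measurable_lintegral_segment_right d hΓ _] at h1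
  simp only [setLIntegral_lintegral_segment d hΓ c hR] at h1
  rw [← Finset.mul_sum, mul_left_comm] at h1
  exact (ENNReal.mul_le_mul_iff_right hB0 hBt).1 h1

theorem kDiff_le_osc_zero {f : En n → ℝ} {k : ℕ} (hk : 0 < k) (M : (Fin 0 → Fin n) → ℝ)
    {x h : En n} :
    ENNReal.ofReal |kDiff k f h x| ≤ 2 ^ k *
      ∑ j ∈ Finset.range (k + 1), oscG f M (x + (j : ℝ) • h) := by
  have h1 := abs_kDiff_le k f (fun _ => M default) (x := x) (h := h)
    (fun x h => ⟨Polynomial.C (M default), by simpa using hk, by simp⟩)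
  convert h1 using 4 with j hj
  simp [oscG, Dt]

/-- The lattice points of the scale `Λ ^ i`. -/
noncomputable def ctr (Λ : ℝ) (i : ℤ) (m : Fin n → ℤ) : En n :=
  WithLp.toLp 2 fun j => Λ ^ i * (m j : ℝ)

theorem exists_mem_ball_ctr (hn : 0 < n) {Λ : ℝ} (hΛ : 0 < Λ) (i : ℤ) (x : En n) :
    ∃ m, x ∈ Metric.ball (ctr Λ i m) (n * Λ ^ i) := by
  have hi : 0 < Λ ^ i := by positivity
  refine ⟨fun j => round (x j / Λ ^ i), ?_⟩
  rw [Metric.mem_ball, dist_eq_norm]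
  refine (En.norm_le_sum _).trans_lt ?_
  have h1 : ∀ j, |(x - ctr Λ i fun j => round (x j / Λ ^ i)) j| ≤ Λ ^ i / 2 := by
    intro j
    have h2 := abs_sub_round (x j / Λ ^ i)
    have h3 : (x - ctr Λ i fun j => round (x j / Λ ^ i)) j =
        Λ ^ i * (x j / Λ ^ i - round (x j / Λ ^ i)) := by
      simp only [ctr, PiLp.sub_apply]
      field_simp
    rw [h3, abs_mul, abs_of_pos hi]
    nlinarith
  calc ∑ j, |(x - ctr Λ i fun j => round (x j / Λ ^ i)) j| ≤ ∑ _j : Fin n, Λ ^ i / 2 :=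
        Finset.sum_le_sum fun j _ => h1 j
    _ = n * (Λ ^ i / 2) := by simp
    _ < n * Λ ^ i := by
        have : (0 : ℝ) < n := by exact_mod_cast hn
        nlinarith [mul_pos this hi]

theorem exists_card_ctr_le (n : ℕ) (D : ℝ) : ∃ N : ℕ, ∀ (Λ : ℝ), 0 < Λ → ∀ (i : ℤ) (x : En n),
    ∃ S : Finset (Fin n → ℤ), S.card ≤ N ∧
      ∀ m, dist x (ctr Λ i m) < D * Λ ^ i → m ∈ S := by
  refine ⟨(2 * ⌈D⌉₊ + 1) ^ n, fun Λ hΛ i x => ?_⟩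
  have hi : 0 < Λ ^ i := by positivity
  refine ⟨Fintype.piFinset fun j => Finset.Icc (⌊x j / Λ ^ i⌋ - ⌈D⌉₊) (⌊x j / Λ ^ i⌋ + ⌈D⌉₊), ?_,
    fun m hm => ?_⟩
  · rw [Fintype.card_piFinset]
    simp only [Int.card_Icc]
    rw [Finset.prod_congr rfl (g := fun _ => 2 * ⌈D⌉₊ + 1)]
    · simp
    · intro j _
      omega
  · rw [Fintype.mem_piFinset]
    intro j
    have h1 : |x j - Λ ^ i * m j| < D * Λ ^ i := by
      refine lt_of_le_of_lt ?_ hm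
      rw [dist_eq_norm]
      exact En.abs_apply_le (x - ctr Λ i m) j
    have h2 : |x j / Λ ^ i - m j| < D := by
      have h3 : x j - Λ ^ i * m j = Λ ^ i * (x j / Λ ^ i - m j) := by field_simp
      rw [h3, abs_mul, abs_of_pos hi, mul_comm] at h1
      exact lt_of_mul_lt_mul_right h1 hi.le
    have h4 := abs_lt.1 (h2.trans_le (Nat.le_ceil D))
    rw [Finset.mem_Icc]
    constructor
    · have h5 : (⌊x j / Λ ^ i⌋ : ℝ) ≤ x j / Λ ^ i := Int.floor_le _
      have : ((⌊x j / Λ ^ i⌋ - ⌈D⌉₊ : ℤ) : ℝ) < m j := by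
        push_cast; linarith [h4.2]
      exact_mod_cast this.le
    · have h6 : m j - ⌈D⌉₊ ≤ ⌊x j / Λ ^ i⌋ := by
        rw [Int.le_floor]; push_cast; linarith [h4.1]
      omega

/-- Bounded overlap of the balls of one scale. -/
theorem exists_tsum_indicator_le (n : ℕ) (D : ℝ) : ∃ N : ℝ≥0∞, N ≠ ⊤ ∧ ∀ (Λ : ℝ), 0 < Λ →
    ∀ (i : ℤ) (F : En n → ℝ≥0∞) (x : En n),
      ∑' m, (Metric.ball (ctr Λ i m) (D * Λ ^ i)).indicator F x ≤ N * F x := by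
  obtain ⟨N, hN⟩ := exists_card_ctr_le n D
  refine ⟨N, by simp, fun Λ hΛ i F x => ?_⟩
  obtain ⟨S, hS, hm⟩ := hN Λ hΛ i x
  rw [tsum_eq_sum (s := S)]
  · refine (Finset.sum_le_card_nsmul S _ (F x) fun m _ => indicator_le_self' (by simp) x).trans ?_
    rw [nsmul_eq_mul]
    gcongr
  · intro m hmS
    refine indicator_of_notMem (fun hx => hmS (hm m ?_)) _
    exact hx

theorem exists_tsum_setLIntegral_le (n : ℕ) (D : ℝ) : ∃ N : ℝ≥0∞, N ≠ ⊤ ∧ ∀ (Λ : ℝ), 0 < Λ →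
    ∀ (i : ℤ) (μ : Measure (En n)) (F : En n → ℝ≥0∞), Measurable F →
      ∑' m, ∫⁻ x in Metric.ball (ctr Λ i m) (D * Λ ^ i), F x ∂μ ≤ N * ∫⁻ x, F x ∂μ := by
  obtain ⟨N, hN, h⟩ := exists_tsum_indicator_le n D
  refine ⟨N, hN, fun Λ hΛ i μ F hF => ?_⟩
  simp only [← lintegral_indicator measurableSet_ball]
  rw [← lintegral_tsum fun m => (hF.indicator measurableSet_ball).aemeasurable,
    ← lintegral_const_mul _ hF]
  exact lintegral_mono fun x => h Λ hΛ i F x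

theorem tsum_scale_le {ρ p q q' : ℝ} (hρ : 0 < ρ) (hρ1 : ρ ≠ 1) (hp : 0 < p) (hq : 0 < q)
    (hqq : q < q') (E0 : ℝ≥0∞) (hE0 : E0 ≠ ⊤) :
    ∃ C : ℝ≥0∞, C ≠ ⊤ ∧ ∀ e : ℤ → ℝ≥0∞, (∀ i, e i ≤ E0) →
      (∑' i, ENNReal.ofReal (ρ ^ i) ^ q * e i) ^ (p / q) ≤
        C * ∑' i, ENNReal.ofReal (ρ ^ i) ^ p * e i ^ (p / q') := by
  obtain ⟨C1, hC1, -, h1⟩ := tsum_geometric_le_cutoff hρ hρ1 hq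
  obtain ⟨C2, hC2, -, h2⟩ := tsum_geometric_ge_cutoff (α := q - q') hρ hρ1 (by linarith)
  have hq' : 0 < q' := hq.trans hqq
  refine ⟨(E0 * C1 + C2) ^ (p / q), ENNReal.rpow_ne_top_of_nonneg (by positivity) (by finiteness),
    fun e he => ?_⟩
  set T := ∑' i, ENNReal.ofReal (ρ ^ i) ^ p * e i ^ (p / q') with hT
  set S := T ^ (1 / p) with hS
  have hSq : (S ^ q) ^ (p / q) = T := by
    rw [hS, ← ENNReal.rpow_mul, ← ENNReal.rpow_mul]
    have : 1 / p * (q * (p / q)) = 1 := by field_simp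
    rw [this, ENNReal.rpow_one]
  have h3 : ∀ i, ENNReal.ofReal (ρ ^ i) ^ q * e i ≤
      E0 * (if ENNReal.ofReal (1 * ρ ^ i) ≤ S then ENNReal.ofReal (1 * ρ ^ i) ^ q else 0) +
      S ^ q' * (if S ≤ ENNReal.ofReal (1 * ρ ^ i) then ENNReal.ofReal (1 * ρ ^ i) ^ (q - q')
        else 0) := by
    intro i
    rw [one_mul]
    rcases le_total (ENNReal.ofReal (ρ ^ i)) S with h | h
    · rw [if_pos h, mul_comm]
      exact le_add_right (by gcongr; exact he i)
    · rw [if_pos h]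
      refine le_add_left ?_
      set a := ENNReal.ofReal (ρ ^ i) with ha
      have ha0 : a ≠ 0 := by
        rw [ha, Ne, ENNReal.ofReal_eq_zero, not_le]; positivity
      have hat : a ≠ ⊤ := ENNReal.ofReal_ne_top
      have h4 : a ^ p * e i ^ (p / q') ≤ T := ENNReal.le_tsum i
      have h5 : a ^ q' * e i ≤ S ^ q' := by
        have := ENNReal.rpow_le_rpow h4 (z := q' / p) (by positivity)
        rw [ENNReal.mul_rpow_of_nonneg _ _ (by positivity), ← ENNReal.rpow_mul,
          ← ENNReal.rpow_mul, show p * (q' / p) = q' by field_simp,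
          show p / q' * (q' / p) = 1 by field_simp, ENNReal.rpow_one] at this
        rwa [hS, ← ENNReal.rpow_mul, show 1 / p * q' = q' / p by ring]
      calc a ^ q * e i = (a ^ q' * e i) * a ^ (q - q') := by
            rw [mul_right_comm, ← ENNReal.rpow_add _ _ ha0 hat]; ring_nf
        _ ≤ _ := by gcongr
  have h6 : ∑' i, ENNReal.ofReal (ρ ^ i) ^ q * e i ≤ (E0 * C1 + C2) * S ^ q := by
    refine (ENNReal.tsum_le_tsum h3).trans ?_
    rw [ENNReal.tsum_add, ENNReal.tsum_mul_left, ENNReal.tsum_mul_left, add_mul]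
    refine add_le_add ?_ ?_
    · rw [mul_assoc]
      gcongr
      exact h1 1 S one_pos
    · refine (mul_le_mul' le_rfl (h2 1 S one_pos)).trans ?_
      rw [mul_left_comm]
      gcongr
      by_cases hS0 : S = 0
      · simp [hS0, hq']
      by_cases hSt : S = ⊤
      · rw [hSt, ENNReal.top_rpow_of_pos hq]; exact le_top
      rw [← ENNReal.rpow_add _ _ hS0 hSt]
      ring_nf; exact le_rfl
  refine (ENNReal.rpow_le_rpow h6 (by positivity)).trans ?_
  rw [ENNReal.mul_rpow_of_nonneg _ _ (by positivity), hSq]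

/-- The annulus of scale `Λ ^ i`. -/
def Ann (n : ℕ) (Λ : ℝ) (i : ℤ) : Set (En n) := {h | ‖h‖ ∈ Ico (Λ ^ i) (Λ ^ (i + 1))}

theorem measurableSet_Ann (Λ : ℝ) (i : ℤ) : MeasurableSet (Ann n Λ i) :=
  measurable_norm measurableSet_Ico

theorem rpow_le_of_mem_Ico {Λ t : ℝ} (hΛ : 1 < Λ) {i : ℤ} (ht : t ∈ Ico (Λ ^ i) (Λ ^ (i + 1)))
    (s : ℝ) : min 1 (Λ ^ s) * (Λ ^ s) ^ i ≤ t ^ s ∧ t ^ s ≤ max 1 (Λ ^ s) * (Λ ^ s) ^ i := by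
  have h0 : 0 < Λ := by linarith
  have hi : 0 < Λ ^ i := by positivity
  have ht0 : 0 < t := hi.trans_le ht.1
  have hb : (Λ ^ s) ^ i = (Λ ^ i) ^ s := by
    rw [← Real.rpow_intCast, ← Real.rpow_intCast, ← Real.rpow_mul h0.le, ← Real.rpow_mul h0.le,
      mul_comm]
  have hc : Λ ^ s * (Λ ^ s) ^ i = (Λ ^ (i + 1)) ^ s := by
    rw [hb, zpow_add_one₀ h0.ne', Real.mul_rpow hi.le h0.le, mul_comm]
  have hp : 0 < (Λ ^ s) ^ i := by positivity
  rcases le_total 0 s with hs | hs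
  · have h1 := Real.rpow_le_rpow hi.le ht.1 hs
    have h2 := Real.rpow_le_rpow ht0.le ht.2.le hs
    rw [← hb] at h1; rw [← hc] at h2
    refine ⟨(mul_le_of_le_one_left hp.le (min_le_left _ _)).trans h1, h2.trans ?_⟩
    gcongr
    exact le_max_right _ _
  · have h1 := Real.rpow_le_rpow_of_nonpos hi ht.1 hs
    have h2 := Real.rpow_le_rpow_of_nonpos ht0 ht.2.le hs
    rw [← hb] at h1; rw [← hc] at h2
    refine ⟨le_trans ?_ h2, h1.trans (le_mul_of_one_le_left hp.le (le_max_left _ _))⟩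
    gcongr
    exact min_le_right _ _

/-- The normalized measure of the part of a set of increments at the scale `Λ ^ i`. -/
noncomputable def eS (Λ : ℝ) (i : ℤ) (E : Set (En n × En n)) (x : En n) : ℝ≥0∞ :=
  ENNReal.ofReal ((Λ ^ i) ^ n)⁻¹ * volume {h | h ∈ Ann n Λ i ∧ (x, h) ∈ E}

theorem measurable_eS (Λ : ℝ) (i : ℤ) {E : Set (En n × En n)} (hE : MeasurableSet E) :
    Measurable (eS Λ i E) := by
  have : MeasurableSet {z : En n × En n | z.2 ∈ Ann n Λ i ∧ z ∈ E} :=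
    (measurable_snd (measurableSet_Ann Λ i)).inter hE
  exact (measurable_measure_prodMk_left this).const_mul _

theorem exists_lintegral_le_tsum_eS {Λ : ℝ} (hΛ : 1 < Λ) (γ : ℝ) :
    ∃ C : ℝ≥0∞, C ≠ ⊤ ∧ ∀ E : Set (En n × En n), MeasurableSet E → (∀ x, (x, 0) ∉ E) → ∀ x,
      ∫⁻ h, (if (x, h) ∈ E then ENNReal.ofReal (‖h‖ ^ (γ - n)) else 0) ≤
        C * ∑' i : ℤ, ENNReal.ofReal ((Λ ^ γ) ^ i) * eS Λ i E x := by
  have h0 : 0 < Λ := by linarith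
  refine ⟨ENNReal.ofReal (max 1 (Λ ^ (γ - n))), ENNReal.ofReal_ne_top, fun E hE hE0 x => ?_⟩
  set S : ℤ → Set (En n) := fun i => {h | h ∈ Ann n Λ i ∧ (x, h) ∈ E} with hS
  have hSm : ∀ i, MeasurableSet (S i) := fun i =>
    (measurableSet_Ann Λ i).inter (measurable_prodMk_left hE)
  set a : ℤ → ℝ≥0∞ := fun i =>
    ENNReal.ofReal (max 1 (Λ ^ (γ - n)) * (Λ ^ (γ - n)) ^ i) with ha
  have h1 : ∀ h : En n, (if (x, h) ∈ E then ENNReal.ofReal (‖h‖ ^ (γ - n)) else 0) ≤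
      ∑' i, (S i).indicator (fun _ => a i) h := by
    intro h
    split_ifs with hh
    · have hne : h ≠ 0 := fun h' => hE0 x (h' ▸ hh)
      obtain ⟨i, hi⟩ := exists_mem_Ico_zpow (norm_pos_iff.2 hne) hΛ
      refine le_trans ?_ (ENNReal.le_tsum i)
      rw [indicator_of_mem (show h ∈ S i from ⟨hi, hh⟩)]
      exact ENNReal.ofReal_le_ofReal (rpow_le_of_mem_Ico hΛ hi _).2
    · exact zero_le
  refine (lintegral_mono h1).trans ?_
  rw [lintegral_tsum fun i => (measurable_const.indicator (hSm i)).aemeasurable,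
    ← ENNReal.tsum_mul_left]
  refine ENNReal.tsum_le_tsum fun i => ?_
  rw [lintegral_indicator_const (hSm i), eS, ← mul_assoc, ← mul_assoc]
  gcongr
  rw [ha, ← ENNReal.ofReal_mul (by positivity), ← ENNReal.ofReal_mul (by positivity)]
  refine ENNReal.ofReal_le_ofReal (le_of_eq ?_)
  rw [mul_assoc]
  congr 1
  rw [Real.rpow_sub h0, div_zpow, Real.rpow_natCast, div_eq_mul_inv, ← zpow_natCast, ← zpow_natCast,
    ← zpow_mul, ← zpow_mul, mul_comm i]

/-- The local functional attached to a subset `D` of a ball `B`. -/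
noncomputable def PhiS (w : En n → ℝ≥0∞) (θ : ℝ) (B D : Set (En n)) : ℝ≥0∞ :=
  wm w D + wm w B * (volume D / volume B) ^ θ

theorem PhiS_mono (w : En n → ℝ≥0∞) {θ : ℝ} (hθ : 0 ≤ θ) (B : Set (En n)) {D D' : Set (En n)}
    (h : D ⊆ D') : PhiS w θ B D ≤ PhiS w θ B D' := by
  unfold PhiS
  gcongr

theorem PhiS_iUnion_le (w : En n → ℝ≥0∞) {θ : ℝ} (h0 : 0 < θ) (h1 : θ ≤ 1) (B : Set (En n))
    {ι : Type*} [Countable ι] (D : ι → Set (En n)) :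
    PhiS w θ B (⋃ i, D i) ≤ ∑' i, PhiS w θ B (D i) := by
  unfold PhiS
  rw [ENNReal.tsum_add, ENNReal.tsum_mul_left]
  refine add_le_add (measure_iUnion_le _) (mul_le_mul' le_rfl ?_)
  refine le_trans ?_ (ENNReal.tsum_rpow_le _ h0 h1)
  refine ENNReal.rpow_le_rpow ?_ h0.le
  simp only [div_eq_mul_inv]
  rw [ENNReal.tsum_mul_right]
  gcongr
  exact measure_iUnion_le _

theorem volume_preimage_add_smul_le {D : Set (En n)} (hD : MeasurableSet D) (x : En n) {j : ℕ}
    (hj : 1 ≤ j) : volume {h : En n | x + (j : ℝ) • h ∈ D} ≤ volume D := by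
  have hj' : (1 : ℝ) ≤ j := by exact_mod_cast hj
  have h := lintegral_comp_add_smul (F := D.indicator 1) (measurable_one.indicator hD) x
    (σ := (j : ℝ)) (by linarith)
  have h2 : ∫⁻ v, D.indicator (1 : En n → ℝ≥0∞) (x + (j : ℝ) • v) =
      volume {h : En n | x + (j : ℝ) • h ∈ D} := by
    rw [← lintegral_indicator_one]
    · rfl
    · exact measurableSet_preimage (f := fun h : En n => x + (j : ℝ) • h) (by fun_prop) hD
  rw [← h2, h, lintegral_indicator_one hD]
  refine mul_le_of_le_one_left zero_le ?_
  rw [ENNReal.ofReal_le_one]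
  exact inv_le_one_of_one_le₀ (one_le_pow₀ hj')

theorem exists_eS_le (n k : ℕ) {Λ R₀ : ℝ} (hΛ : 1 < Λ) (hR₀ : 0 < R₀) : ∃ C : ℝ≥0∞, C ≠ ⊤ ∧
    ∀ (i : ℤ) (c : En n) (E : Set (En n × En n)) (D : Set (En n)), MeasurableSet D → ∀ x,
      (∀ h ∈ Ann n Λ i, (x, h) ∈ E → ∃ j ∈ Finset.range (k + 1), x + (j : ℝ) • h ∈ D) →
      eS Λ i E x ≤ C * (D.indicator 1 x + volume D / volume (Metric.ball c (R₀ * Λ ^ i))) := by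
  have h0 : 0 < Λ := by linarith
  set v := volume (Metric.ball (0 : En n) 1) with hv
  have hvt : v ≠ ⊤ := volume_ball_ne_top _ _
  have hv0 : v ≠ 0 := volume_ball_ne_zero _ one_pos
  refine ⟨ENNReal.ofReal (Λ ^ n) * v + k * (ENNReal.ofReal (R₀ ^ n) * v), by finiteness,
    fun i c E D hD x hx => ?_⟩
  have hi : 0 < Λ ^ i := by positivity
  set a := ENNReal.ofReal ((Λ ^ i) ^ n)⁻¹ with ha
  have hball : ∀ (c : En n) {t : ℝ}, 0 < t → volume (Metric.ball c (t * Λ ^ i)) =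
      ENNReal.ofReal (t ^ n) * v * ENNReal.ofReal ((Λ ^ i) ^ n) := by
    intro c t ht
    rw [volume_ball_mul c ht, ← mul_one (Λ ^ i), volume_ball_mul c hi, hv,
      Measure.addHaar_ball_center volume c, mul_one]
    ring
  have haa : ENNReal.ofReal ((Λ ^ i) ^ n) * a = 1 := by
    rw [ha, ← ENNReal.ofReal_mul (by positivity), mul_inv_cancel₀ (by positivity),
      ENNReal.ofReal_one]
  have hsub : {h | h ∈ Ann n Λ i ∧ (x, h) ∈ E} ⊆ ⋃ j ∈ Finset.range (k + 1),
      {h | h ∈ Ann n Λ i ∧ x + (j : ℝ) • h ∈ D} := by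
    intro h hh
    obtain ⟨j, hj, hj'⟩ := hx h hh.1 hh.2
    exact mem_biUnion hj ⟨hh.1, hj'⟩
  have h1 : volume {h | h ∈ Ann n Λ i ∧ (x, h) ∈ E} ≤
      ENNReal.ofReal (Λ ^ n) * v * ENNReal.ofReal ((Λ ^ i) ^ n) * D.indicator 1 x +
        k * volume D := by
    refine (measure_mono hsub).trans ((measure_biUnion_finset_le _ _).trans ?_)
    rw [Finset.sum_range_succ', add_comm]
    refine add_le_add ?_ ?_
    · by_cases hxD : x ∈ D
      · rw [indicator_of_mem hxD, Pi.one_apply, mul_one, ← hball 0 h0]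
        refine measure_mono fun h hh => ?_
        rw [mem_ball_zero_iff]
        have := hh.1.2
        rwa [zpow_add_one₀ h0.ne', mul_comm] at this
      · simp [hxD]
    · refine (Finset.sum_le_card_nsmul _ _ (volume D) fun j _ => ?_).trans ?_
      · refine le_trans (measure_mono fun h hh => ?_)
          (volume_preimage_add_smul_le hD x (j := j + 1) (by omega))
        exact hh.2
      · simp
  have hVB : a = ENNReal.ofReal (R₀ ^ n) * v * (volume (Metric.ball c (R₀ * Λ ^ i)))⁻¹ := by
    rw [hball c hR₀]
    have hR : ENNReal.ofReal (R₀ ^ n) ≠ 0 := by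
      rw [Ne, ENNReal.ofReal_eq_zero, not_le]; positivity
    rw [ENNReal.mul_inv (Or.inl (mul_ne_zero hR hv0)) (Or.inl (by finiteness)), ← mul_assoc,
      ENNReal.mul_inv_cancel (mul_ne_zero hR hv0) (by finiteness), one_mul]
    exact ENNReal.eq_inv_of_mul_eq_one_left (by rw [mul_comm]; exact haa)
  calc eS Λ i E x ≤ a * (ENNReal.ofReal (Λ ^ n) * v * ENNReal.ofReal ((Λ ^ i) ^ n) *
        D.indicator 1 x + k * volume D) := by
        rw [eS]; gcongr
    _ = (ENNReal.ofReal ((Λ ^ i) ^ n) * a) * (ENNReal.ofReal (Λ ^ n) * v) * D.indicator 1 x +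
        k * (ENNReal.ofReal (R₀ ^ n) * v) *
          (volume D / volume (Metric.ball c (R₀ * Λ ^ i))) := by
        rw [mul_add, div_eq_mul_inv]
        congr 1
        · ring
        · rw [hVB]; ring
    _ ≤ _ := by
        rw [haa, one_mul, mul_add, add_mul, add_mul]
        exact add_le_add le_self_add le_add_self

theorem exists_scale_decomposition (hn : 0 < n) (k : ℕ) {Λ R₀ p q q' b : ℝ} (hΛ : 1 < Λ)
    (hR₀ : n ≤ R₀) (hp : 0 < p) (hq : 0 < q) (hqq : q < q') (hpq : p ≤ q') (hb : b ≠ 0) :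
    ∃ K : ℝ≥0∞, K ≠ ⊤ ∧ ∀ w : En n → ℝ≥0∞, ∀ E : Set (En n × En n), MeasurableSet E →
      (∀ x, (x, 0) ∉ E) → ∀ D : ℤ → (Fin n → ℤ) → Set (En n), (∀ i m, MeasurableSet (D i m)) →
      (∀ i m, ∀ x ∈ Metric.ball (ctr Λ i m) (n * Λ ^ i), ∀ h ∈ Ann n Λ i, (x, h) ∈ E →
        ∃ j ∈ Finset.range (k + 1), x + (j : ℝ) • h ∈ D i m) →
      ∫⁻ x, (∫⁻ h, if (x, h) ∈ E then ENNReal.ofReal (‖h‖ ^ (b * q - n)) else 0) ^ (p / q)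
          ∂(wm w) ≤
        K * ∑' i : ℤ, ENNReal.ofReal ((Λ ^ b) ^ i) ^ p * ∑' m : Fin n → ℤ,
          PhiS w (p / q') (Metric.ball (ctr Λ i m) (R₀ * Λ ^ i)) (D i m) := by
  have h0 : 0 < Λ := by linarith
  have hn' : (0 : ℝ) < n := by exact_mod_cast hn
  have hq' : 0 < q' := hq.trans hqq
  have hR₀' : 0 < R₀ := hn'.trans_le hR₀
  have hρ1 : Λ ^ b ≠ 1 := by
    rcases hb.lt_or_gt with h | h
    · exact (Real.rpow_lt_one_of_one_lt_of_neg hΛ h).ne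
    · exact (Real.one_lt_rpow hΛ h).ne'
  obtain ⟨C1, hC1, h1⟩ := exists_lintegral_le_tsum_eS (n := n) hΛ (b * q)
  obtain ⟨C2, hC2, h2⟩ := exists_eS_le n k hΛ hR₀'
  obtain ⟨E0, hE0, h3⟩ : ∃ E0 : ℝ≥0∞, E0 ≠ ⊤ ∧ ∀ (i : ℤ) (E : Set (En n × En n)) (x : En n),
      eS Λ i E x ≤ E0 := by
    refine ⟨ENNReal.ofReal (Λ ^ n) * volume (Metric.ball (0 : En n) 1),
      ENNReal.mul_ne_top ENNReal.ofReal_ne_top (volume_ball_ne_top _ _), fun i E x => ?_⟩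
    have hi : 0 < Λ ^ i := by positivity
    have hb1 : volume {h | h ∈ Ann n Λ i ∧ (x, h) ∈ E} ≤
        volume (Metric.ball (0 : En n) (Λ ^ i * (Λ * 1))) := by
      refine measure_mono fun h hh => ?_
      rw [mem_ball_zero_iff]
      have := hh.1.2
      rwa [mul_one, ← zpow_add_one₀ h0.ne']
    rw [volume_ball_mul _ hi, volume_ball_mul _ h0] at hb1
    refine (mul_le_mul' le_rfl hb1).trans ?_
    rw [← mul_assoc, ← ENNReal.ofReal_mul (by positivity), inv_mul_cancel₀ (by positivity),
      ENNReal.ofReal_one, one_mul]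
  obtain ⟨C3, hC3, h4⟩ := tsum_scale_le (p := p) (by positivity : 0 < Λ ^ b) hρ1 hp hq hqq E0 hE0
  refine ⟨C1 ^ (p / q) * C3 * C2 ^ (p / q'), by
    have := ENNReal.rpow_ne_top_of_nonneg (x := C1) (y := p / q) (by positivity) hC1
    have := ENNReal.rpow_ne_top_of_nonneg (x := C2) (y := p / q') (by positivity) hC2
    finiteness, fun w E hE hE0' D hDm hD => ?_⟩
  have hb' : ∀ i : ℤ, ENNReal.ofReal ((Λ ^ (b * q)) ^ i) = ENNReal.ofReal ((Λ ^ b) ^ i) ^ q := by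
    intro i
    rw [ENNReal.ofReal_rpow_of_pos (by positivity)]
    congr 1
    rw [← Real.rpow_intCast, ← Real.rpow_intCast, ← Real.rpow_mul h0.le, ← Real.rpow_mul h0.le,
      ← Real.rpow_mul h0.le]
    ring_nf
  have h5 : ∀ x, (∫⁻ h, if (x, h) ∈ E then ENNReal.ofReal (‖h‖ ^ (b * q - n)) else 0) ^ (p / q) ≤
      C1 ^ (p / q) * C3 * ∑' i : ℤ, ENNReal.ofReal ((Λ ^ b) ^ i) ^ p * eS Λ i E x ^ (p / q') := by
    intro x
    refine (ENNReal.rpow_le_rpow (h1 E hE hE0' x) (by positivity)).trans ?_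
    rw [ENNReal.mul_rpow_of_nonneg _ _ (by positivity), mul_assoc]
    simp only [hb']
    gcongr
    exact h4 _ fun i => h3 i E x
  have hem : ∀ i, Measurable fun x => eS Λ i E x ^ (p / q') := fun i =>
    (measurable_eS Λ i hE).pow_const _
  have h6 : ∀ i : ℤ, ∫⁻ x, eS Λ i E x ^ (p / q') ∂(wm w) ≤ C2 ^ (p / q') * ∑' m : Fin n → ℤ,
          PhiS w (p / q') (Metric.ball (ctr Λ i m) (R₀ * Λ ^ i)) (D i m) := by
    intro i
    have hi : 0 < Λ ^ i := by positivity
    have hcov : (univ : Set (En n)) ⊆ ⋃ m, Metric.ball (ctr Λ i m) (n * Λ ^ i) := by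
      intro x _
      obtain ⟨m, hm⟩ := exists_mem_ball_ctr hn h0 i x
      exact mem_iUnion.2 ⟨m, hm⟩
    rw [← setLIntegral_univ]
    refine (lintegral_mono_set hcov).trans ((lintegral_iUnion_le _ _).trans ?_)
    rw [← ENNReal.tsum_mul_left]
    refine ENNReal.tsum_le_tsum fun m => ?_
    set B := Metric.ball (ctr Λ i m) (R₀ * Λ ^ i) with hB
    calc ∫⁻ x in Metric.ball (ctr Λ i m) (n * Λ ^ i), eS Λ i E x ^ (p / q') ∂(wm w)
        ≤ ∫⁻ x in Metric.ball (ctr Λ i m) (n * Λ ^ i), C2 ^ (p / q') *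
          ((D i m).indicator 1 x + (volume (D i m) / volume B) ^ (p / q')) ∂(wm w) := by
          refine setLIntegral_mono' measurableSet_ball fun x hx => ?_
          refine (ENNReal.rpow_le_rpow (h2 i (ctr Λ i m) E (D i m) (hDm i m) x
            (hD i m x hx)) (by positivity)).trans ?_
          rw [ENNReal.mul_rpow_of_nonneg _ _ (by positivity)]
          gcongr
          refine (ENNReal.rpow_add_le_add_rpow _ _ (by positivity)
            (by rw [div_le_one hq']; exact hpq)).trans ?_
          gcongr
          by_cases hx : x ∈ D i m
          · simp [hx]
          · simp [hx, div_pos hp hq']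
      _ ≤ C2 ^ (p / q') * ∫⁻ x in B,
          ((D i m).indicator 1 x + (volume (D i m) / volume B) ^ (p / q')) ∂(wm w) := by
          rw [lintegral_const_mul _ (by
            exact (measurable_one.indicator (hDm i m)).add_const _)]
          gcongr
          exact Metric.ball_subset_ball (by gcongr)
      _ ≤ C2 ^ (p / q') * PhiS w (p / q') B (D i m) := by
          rw [lintegral_add_left (measurable_one.indicator (hDm i m)),
            lintegral_indicator_one (hDm i m), setLIntegral_const, PhiS, mul_comm (wm w B)]
          gcongr
          exact Measure.restrict_le_self
  refine (lintegral_mono h5).trans ?_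
  rw [lintegral_const_mul _ (by
    exact Measurable.tsum fun i => (hem i).const_mul _),
    lintegral_tsum fun i => ((hem i).const_mul _).aemeasurable, mul_assoc (C1 ^ (p / q) * C3)]
  gcongr C1 ^ (p / q) * C3 * ?_
  rw [← ENNReal.tsum_mul_left]
  refine ENNReal.tsum_le_tsum fun i => ?_
  rw [lintegral_const_mul _ (hem i), mul_left_comm]
  gcongr
  exact h6 i

/-- The averaging potential of order `L`; for `L = 0` it is the identity. -/
noncomputable def Jord : ℕ → En n → ℝ → (En n → ℝ≥0∞) → En n → ℝ≥0∞
  | 0, _, _, Γ => Γ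
  | d + 1, c, R, Γ => Jop d c R Γ

theorem measurable_Jord (L : ℕ) (c : En n) (R : ℝ) {Γ : En n → ℝ≥0∞} (hΓ : Measurable Γ) :
    Measurable (Jord L c R Γ) := by
  cases L with
  | zero => exact hΓ
  | succ d => exact measurable_Jop d c R hΓ

theorem kDiff_le_Jord {f : En n → ℝ} (hf : ContDiff ℝ (⊤ : ℕ∞) f) {k L : ℕ} (hk : 0 < k)
    (M : (Fin L → Fin n) → ℝ) (hM : L < k ∨ L ≤ k ∧ ∀ ι, M ι = 0)
    {c : En n} {R : ℝ} (hR : 0 < R) {x h : En n}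
    (hx : ∀ j ∈ Finset.range (k + 1), x + (j : ℝ) • h ∈ Metric.ball c R) :
    ENNReal.ofReal |kDiff k f h x| ≤ ENNReal.ofReal (2 ^ k * (2 * R) ^ L) *
      ∑ j ∈ Finset.range (k + 1), Jord L c R (oscG f M) (x + (j : ℝ) • h) := by
  cases L with
  | zero =>
    refine (kDiff_le_osc_zero hk M).trans (mul_le_mul' ?_ le_rfl)
    rw [pow_zero, mul_one, ENNReal.ofReal_pow zero_le_two, ENNReal.ofReal_ofNat]
  | succ d => exact kDiff_le_Jop hf k d M (by simpa [Nat.succ_le_iff] using hM) hR hx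

theorem continuous_kDiff {f : En n → ℝ} (hf : Continuous f) (k : ℕ) :
    Continuous fun z : En n × En n => kDiff k f z.2 z.1 := by
  unfold kDiff
  fun_prop

theorem measurableSet_memE {f : En n → ℝ} (hf : Continuous f) (k ℓ : ℕ) (lam b : ℝ) :
    MeasurableSet {z : En n × En n | memE k ℓ lam b f z.1 z.2} := by
  have h1 := (continuous_kDiff hf k).measurable
  unfold memE
  refine MeasurableSet.inter ?_ (measurableSet_lt
    (f := fun z : En n × En n => lam * ‖z.2‖ ^ ((ℓ : ℝ) + b)) (by fun_prop) h1.abs)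
  exact (measurableSet_singleton (0 : En n)).compl.preimage measurable_snd

/-- The part of a ball where the potential of the oscillation exceeds a threshold. -/
noncomputable def badSet (L : ℕ) (f : En n → ℝ) (M : (Fin L → Fin n) → ℝ) (c : En n) (R μ : ℝ) :
    Set (En n) :=
  {x | x ∈ Metric.ball c R ∧ ENNReal.ofReal μ < Jord L c R (oscG f M) x}

theorem measurableSet_badSet (L : ℕ) {f : En n → ℝ} (hf : ContDiff ℝ (⊤ : ℕ∞) f)
    (M : (Fin L → Fin n) → ℝ) (c : En n) (R μ : ℝ) : MeasurableSet (badSet L f M c R μ) :=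
  measurableSet_ball.inter (measurableSet_lt measurable_const
    (measurable_Jord L c R (measurable_oscG hf M)))

theorem exists_mem_badSet {k ℓ L : ℕ} (hk : 0 < k) {Λ b : ℝ} (hΛ : 1 < Λ) :
    ∃ c' : ℝ, 0 < c' ∧ ∀ (f : En n → ℝ), ContDiff ℝ (⊤ : ℕ∞) f → ∀ M : (Fin L → Fin n) → ℝ,
      (L < k ∨ L ≤ k ∧ ∀ ι, M ι = 0) → ∀ lam : ℝ, 0 < lam → ∀ (i : ℤ) (c : En n),
      ∀ x ∈ Metric.ball c (n * Λ ^ i), ∀ h ∈ Ann n Λ i, memE k ℓ lam b f x h →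
      ∃ j ∈ Finset.range (k + 1), x + (j : ℝ) • h ∈
        badSet L f M c ((n + k * Λ + 1) * Λ ^ i) (c' * lam * (Λ ^ (ℓ + b - L)) ^ i) := by
  have h0 : 0 < Λ := by linarith
  set R₀ : ℝ := n + k * Λ + 1 with hR₀
  have hR₀' : 0 < R₀ := by positivity
  set s : ℝ := ℓ + b with hs
  set c₁ : ℝ := min 1 (Λ ^ s) with hc₁
  have hc₁' : 0 < c₁ := lt_min one_pos (by positivity)
  set N : ℝ := 2 ^ k * (2 * R₀) ^ L * (k + 1) with hN
  have hN' : 0 < N := by positivity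
  refine ⟨c₁ / N, by positivity, fun f hf M hM lam hlam i c x hx h hh hE => ?_⟩
  have hi : 0 < Λ ^ i := by positivity
  have hball : ∀ j ∈ Finset.range (k + 1), x + (j : ℝ) • h ∈ Metric.ball c (R₀ * Λ ^ i) := by
    intro j hj
    rw [Metric.mem_ball, dist_eq_norm] at hx ⊢
    have hjk : (j : ℝ) ≤ k := by
      have := Finset.mem_range_succ_iff.1 hj
      exact_mod_cast this
    have h2 : ‖h‖ < Λ ^ i * Λ := by rw [← zpow_add_one₀ h0.ne']; exact hh.2
    calc ‖x + (j : ℝ) • h - c‖ = ‖(x - c) + (j : ℝ) • h‖ := by congr 1; abel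
      _ ≤ ‖x - c‖ + j * ‖h‖ := by
          refine (norm_add_le _ _).trans ?_
          rw [norm_smul, Real.norm_natCast]
      _ ≤ ‖x - c‖ + k * (Λ ^ i * Λ) := by gcongr
      _ < R₀ * Λ ^ i := by rw [hR₀]; nlinarith
  by_contra! hcon
  have hJ : ∀ j ∈ Finset.range (k + 1), Jord L c (R₀ * Λ ^ i) (oscG f M) (x + (j : ℝ) • h) ≤
      ENNReal.ofReal (c₁ / N * lam * (Λ ^ (s - L)) ^ i) := by
    intro j hj
    have := hcon j hj
    rw [badSet, mem_ofPred_eq, not_and, not_lt] at this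
    exact this (hball j hj)
  have h1 := kDiff_le_Jord hf hk M hM (mul_pos hR₀' hi) hball
  have h2 := h1.trans (mul_le_mul' le_rfl (Finset.sum_le_card_nsmul _ _ _ hJ))
  rw [Finset.card_range, nsmul_eq_mul, ← ENNReal.ofReal_natCast,
    ← ENNReal.ofReal_mul (by positivity), ← ENNReal.ofReal_mul (by positivity),
    ENNReal.ofReal_le_ofReal_iff (by positivity)] at h2
  have h3 := (rpow_le_of_mem_Ico hΛ hh s).1
  have h4 : (Λ ^ (s - L)) ^ i * (Λ ^ i) ^ L = (Λ ^ s) ^ i := by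
    rw [Real.rpow_sub h0, div_zpow, Real.rpow_natCast, ← zpow_natCast, ← zpow_natCast, ← zpow_mul,
      ← zpow_mul, mul_comm i]
    field_simp
  have h5 : 2 ^ k * (2 * (R₀ * Λ ^ i)) ^ L * (((k + 1 : ℕ) : ℝ) *
      (c₁ / N * lam * (Λ ^ (s - L)) ^ i)) = lam * (c₁ * (Λ ^ s) ^ i) := by
    rw [← h4, hN]
    push_cast
    rw [mul_pow, mul_pow, mul_pow]
    field_simp
  rw [h5] at h2
  have h6 := hE.2
  rw [← hs] at h6
  have h7 : lam * (c₁ * (Λ ^ s) ^ i) ≤ lam * ‖h‖ ^ s := by gcongr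
  linarith

theorem exists_innerInt_le_badSet (hn : 0 < n) {k ℓ L : ℕ} (hk : 0 < k) {Λ p q q' b : ℝ}
    (hΛ : 1 < Λ) (hp : 0 < p) (hq : 0 < q) (hqq : q < q') (hpq : p ≤ q') (hb : b ≠ 0) :
    ∃ K : ℝ≥0∞, K ≠ ⊤ ∧ ∃ c' : ℝ, 0 < c' ∧ ∀ (w : En n → ℝ≥0∞) (f : En n → ℝ),
      ContDiff ℝ (⊤ : ℕ∞) f → ∀ M : ℤ → (Fin n → ℤ) → (Fin L → Fin n) → ℝ,
      (L < k ∨ L ≤ k ∧ ∀ i m ι, M i m ι = 0) → ∀ lam : ℝ, 0 < lam →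
      ∫⁻ x, innerInt k ℓ lam b (b * q) f x ^ (p / q) ∂(wm w) ≤
        K * ∑' i : ℤ, ENNReal.ofReal ((Λ ^ b) ^ i) ^ p * ∑' m : Fin n → ℤ,
          PhiS w (p / q') (Metric.ball (ctr Λ i m) ((n + k * Λ + 1) * Λ ^ i))
            (badSet L f (M i m) (ctr Λ i m) ((n + k * Λ + 1) * Λ ^ i)
              (c' * lam * (Λ ^ (ℓ + b - L)) ^ i)) := by
  have h0 : 0 < Λ := by linarith
  obtain ⟨K, hK, h1⟩ := exists_scale_decomposition hn k (R₀ := n + k * Λ + 1) hΛ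
    (by have : 0 ≤ k * Λ := by positivity
        linarith) hp hq hqq hpq hb
  obtain ⟨c', hc', h2⟩ := exists_mem_badSet (n := n) (ℓ := ℓ) (L := L) (b := b) hk hΛ
  refine ⟨K, hK, c', hc', fun w f hf M hM lam hlam => ?_⟩
  exact h1 w {z | memE k ℓ lam b f z.1 z.2} (measurableSet_memE hf.continuous k ℓ lam b)
    (fun x hx => hx.1 rfl) _ (fun i m => measurableSet_badSet L hf _ _ _ _)
    fun i m x hx h hh hE => h2 f hf (M i m) (hM.imp id fun h => ⟨h.1, h.2 i m⟩) lam hlam i _ x hx h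
      hh hE

theorem exists_measure_lt_Jop_le (d : ℕ) {s r : ℝ} (hs : 1 ≤ s) (hsr : s ≤ r)
    (hnr : (n : ℝ) * (1 / s - 1 / r) < d + 1) {A : ℝ≥0∞} (hA : A ≠ ⊤) :
    ∃ K : ℝ≥0∞, K ≠ ⊤ ∧ ∀ w : En n → ℝ≥0∞, A1W A w → ∀ c R, 0 < R → ∀ Γ : En n → ℝ≥0∞,
      Measurable Γ → ∀ μ : ℝ, 0 < μ →
      wm w {x | x ∈ Metric.ball c R ∧ ENNReal.ofReal μ < Jop d c R Γ x} ≤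
        K * wm w (Metric.ball c R) * ((∫⁻ x in Metric.ball c R, Γ x ^ s ∂(wm w)) /
          wm w (Metric.ball c R) / ENNReal.ofReal μ ^ s) ^ (r / s) := by
  obtain ⟨K, hK, h⟩ := Jop_rpow_le (n := n) d hs hsr hnr hA
  refine ⟨K, hK, fun w hw c R hR Γ hΓ μ hμ => ?_⟩
  have hs0 : 0 < s := by linarith
  have hr0 : 0 < r := by linarith
  set e := ENNReal.ofReal μ with he
  have he0 : e ≠ 0 := by simpa [he] using hμ
  have het : e ≠ ⊤ := ENNReal.ofReal_ne_top
  have h1 := h w hw c R hR Γ hΓ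
  have h2 := mul_meas_ge_le_lintegral (μ := (wm w).restrict (Metric.ball c R))
    ((measurable_Jop d c R hΓ).pow_const r) (e ^ r)
  have h3 : wm w {x | x ∈ Metric.ball c R ∧ e < Jop d c R Γ x} ≤
      (wm w).restrict (Metric.ball c R) {x | e ^ r ≤ Jop d c R Γ x ^ r} := by
    rw [Measure.restrict_apply
      (measurableSet_le measurable_const ((measurable_Jop d c R hΓ).pow_const r))]
    refine measure_mono fun x hx => ⟨ENNReal.rpow_le_rpow hx.2.le hr0.le, hx.1⟩
  have h4 := (mul_le_mul' h3 (le_refl (e ^ r))).trans ((mul_comm _ _).le.trans (h2.trans h1))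
  rw [← ENNReal.le_div_iff_mul_le (Or.inl (by simp [he0, het]))
    (Or.inl (ENNReal.rpow_ne_top_of_nonneg hr0.le het))] at h4
  refine h4.trans (le_of_eq ?_)
  rw [ENNReal.div_rpow_of_nonneg _ (e ^ s) (by positivity), ← ENNReal.rpow_mul,
    show s * (r / s) = r by field_simp, mul_div_assoc]

theorem A1W.average_le {A : ℝ≥0∞} {w : En n → ℝ≥0∞} (hw : A1W A w) {F : En n → ℝ≥0∞}
    (hF : Measurable F) (c : En n) {R : ℝ} (hR : 0 < R) :
    (∫⁻ x in Metric.ball c R, F x) / volume (Metric.ball c R) ≤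
      A * ((∫⁻ x in Metric.ball c R, F x ∂(wm w)) / wm w (Metric.ball c R)) := by
  have h5 := hw.mul_lintegral_ball_le hF c R
  rw [← mul_div_assoc, ENNReal.le_div_iff_mul_le (Or.inl (hw.pos c R hR)) (Or.inl (hw.fin c R)),
    ← ENNReal.mul_div_right_comm, ENNReal.div_le_iff (volume_ball_ne_zero c hR)
      (volume_ball_ne_top c R)]
  calc _ = wm w (Metric.ball c R) * ∫⁻ x in Metric.ball c R, F x := by ring
    _ ≤ _ := h5
    _ = _ := by ring

theorem exists_PhiS_Jop_le (d : ℕ) {s t θ : ℝ} (hs : 1 ≤ s) (hθ : 0 < θ)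
    (hθ1 : θ ≤ 1) (hst : s ≤ t * θ) (hnt : (n : ℝ) * (1 / s - 1 / t) < d + 1) {A : ℝ≥0∞}
    (hA : A ≠ ⊤) :
    ∃ K : ℝ≥0∞, K ≠ ⊤ ∧ ∀ w : En n → ℝ≥0∞, A1W A w → ∀ c R, 0 < R → ∀ Γ : En n → ℝ≥0∞,
      Measurable Γ → ∀ μ : ℝ, 0 < μ →
      PhiS w θ (Metric.ball c R) {x | x ∈ Metric.ball c R ∧ ENNReal.ofReal μ < Jop d c R Γ x} ≤
        K * wm w (Metric.ball c R) * ((∫⁻ x in Metric.ball c R, Γ x ^ s ∂(wm w)) /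
          wm w (Metric.ball c R) / ENNReal.ofReal μ ^ s) ^ (t * θ / s) := by
  have hs0 : 0 < s := by linarith
  have ht0 : 0 < t := by
    by_contra! h
    have : t * θ ≤ 0 := mul_nonpos_of_nonpos_of_nonneg h hθ.le
    linarith
  have htt : t * θ ≤ t := by nlinarith
  have hnr : (n : ℝ) * (1 / s - 1 / (t * θ)) < d + 1 := by
    refine lt_of_le_of_lt ?_ hnt
    have : 1 / t ≤ 1 / (t * θ) := one_div_le_one_div_of_le (by positivity) htt
    gcongr
  obtain ⟨K1, hK1, h1⟩ := exists_measure_lt_Jop_le (n := n) d hs hst hnr hA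
  obtain ⟨K2, hK2, h2⟩ := exists_measure_lt_Jop_le (n := n) d hs (hst.trans htt) hnt
    (A := 1) (by simp)
  refine ⟨K1 + K2 ^ θ * A ^ (t * θ / s), by
    have := ENNReal.rpow_ne_top_of_nonneg (x := K2) hθ.le hK2
    have := ENNReal.rpow_ne_top_of_nonneg (x := A) (y := t * θ / s) (by positivity) hA
    finiteness, fun w hw c R hR Γ hΓ μ hμ => ?_⟩
  set B := Metric.ball c R with hB
  set D := {x | x ∈ B ∧ ENNReal.ofReal μ < Jop d c R Γ x} with hD
  set e := ENNReal.ofReal μ with he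
  have he0 : e ≠ 0 := by simpa [he] using hμ
  have het : e ≠ ⊤ := ENNReal.ofReal_ne_top
  have hV0 : volume B ≠ 0 := volume_ball_ne_zero c hR
  have hVt : volume B ≠ ⊤ := volume_ball_ne_top c R
  have hm0 : wm w B ≠ 0 := hw.pos c R hR
  have hmt : wm w B ≠ ⊤ := hw.fin c R
  have hone : wm (fun _ : En n => (1 : ℝ≥0∞)) = volume := by simp [wm]
  set I := ∫⁻ x in B, Γ x ^ s ∂(wm w) with hI
  have h3 := h2 _ A1W_one c R hR Γ hΓ μ hμ
  rw [hone, ← hB, ← hD, ← he] at h3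
  have h4 : (∫⁻ x in B, Γ x ^ s) / volume B ≤ A * (I / wm w B) :=
    hw.average_le (hΓ.pow_const s) c hR
  have h6 : (volume D / volume B) ^ θ ≤ K2 ^ θ * A ^ (t * θ / s) *
      (I / wm w B / e ^ s) ^ (t * θ / s) := by
    have h7 : volume D / volume B ≤ K2 * (A * (I / wm w B / e ^ s)) ^ (t / s) := by
      rw [ENNReal.div_le_iff hV0 hVt]
      refine h3.trans ?_
      rw [mul_right_comm]
      gcongr
      rw [← mul_div_assoc]
      gcongr
    refine (ENNReal.rpow_le_rpow h7 hθ.le).trans (le_of_eq ?_)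
    rw [ENNReal.mul_rpow_of_nonneg _ _ hθ.le, ← ENNReal.rpow_mul,
      show t / s * θ = t * θ / s by ring, ENNReal.mul_rpow_of_nonneg _ _ (by positivity), mul_assoc]
  rw [PhiS, add_mul, add_mul]
  refine add_le_add (h1 w hw c R hR Γ hΓ μ hμ) ?_
  rw [mul_right_comm, mul_comm]
  gcongr

theorem PhiS_le_two_mul (w : En n → ℝ≥0∞) {θ : ℝ} (hθ : 0 ≤ θ) {B D : Set (En n)} (h : D ⊆ B) :
    PhiS w θ B D ≤ 2 * wm w B := by
  rw [PhiS, two_mul]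
  refine add_le_add (measure_mono h) (mul_le_of_le_one_right zero_le ?_)
  refine ENNReal.rpow_le_one ?_ hθ
  exact ENNReal.div_le_of_le_mul (by rw [one_mul]; exact measure_mono h)

/-- The size of the derivatives of order `ℓ`. -/
noncomputable def ngrad (ℓ : ℕ) (f : En n → ℝ) : En n → ℝ≥0∞ :=
  oscG f (fun _ : Fin ℓ → Fin n => 0)

theorem measurable_ngrad (ℓ : ℕ) {f : En n → ℝ} (hf : ContDiff ℝ (⊤ : ℕ∞) f) :
    Measurable (ngrad ℓ f) := measurable_oscG hf _

theorem min_le_add_of_le {K X Y P : ℝ≥0∞} {t : ℝ} (ht : 1 ≤ t) (h2 : P ≤ 2)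
    (hP : P ≤ K * (X + Y) ^ t) : P ≤ (K * 2 ^ t + 2) * (X ^ t + Y) := by
  have ht0 : 0 < t := by linarith
  rcases le_total X Y with h | h
  · rcases le_total 1 Y with h1 | h1
    · calc P ≤ 2 * 1 := by simpa using h2
        _ ≤ _ := by
          gcongr
          · exact le_add_self
          · exact h1.trans le_add_self
    · calc P ≤ K * (X + Y) ^ t := hP
        _ ≤ K * (2 * Y) ^ t := by rw [two_mul]; gcongr
        _ = K * 2 ^ t * Y ^ t := by rw [ENNReal.mul_rpow_of_nonneg _ _ ht0.le, mul_assoc]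
        _ ≤ _ := by
          gcongr
          · exact le_self_add
          · exact (ENNReal.rpow_le_self_of_le_one h1 ht).trans le_add_self
  · calc P ≤ K * (X + Y) ^ t := hP
      _ ≤ K * (2 * X) ^ t := by rw [two_mul]; gcongr
      _ = K * 2 ^ t * X ^ t := by rw [ENNReal.mul_rpow_of_nonneg _ _ ht0.le, mul_assoc]
      _ ≤ _ := by
        gcongr
        · exact le_self_add
        · exact le_self_add

theorem exists_PhiS_Jop_le_split (d : ℕ) {s t θ : ℝ} (hs : 1 ≤ s) (hθ : 0 < θ)
    (hθ1 : θ ≤ 1) (hst : s ≤ t * θ) (hnt : (n : ℝ) * (1 / s - 1 / t) < d + 1) {A : ℝ≥0∞}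
    (hA : A ≠ ⊤) :
    ∃ K : ℝ≥0∞, K ≠ ⊤ ∧ ∀ w : En n → ℝ≥0∞, A1W A w → ∀ c R, 0 < R → ∀ Γ : En n → ℝ≥0∞,
      Measurable Γ → ∀ μ : ℝ, 0 < μ →
      PhiS w θ (Metric.ball c R) {x | x ∈ Metric.ball c R ∧ ENNReal.ofReal μ < Jop d c R Γ x} ≤
        K * ∫⁻ x in Metric.ball c R,
          (ENNReal.ofReal μ ^ (-(t * θ)) * (if Γ x ≤ ENNReal.ofReal μ then Γ x ^ (t * θ) else 0) +
          ENNReal.ofReal μ ^ (-s) * (if Γ x ≤ ENNReal.ofReal μ then 0 else Γ x ^ s)) ∂(wm w) := by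
  obtain ⟨K, hK, h⟩ := exists_PhiS_Jop_le (n := n) d hs hθ hθ1 hst hnt hA
  have hs0 : 0 < s := by linarith
  have hr0 : 0 < t * θ := by linarith
  have hrs : 1 ≤ t * θ / s := by rwa [le_div_iff₀ hs0, one_mul]
  refine ⟨K * 2 ^ (t * θ / s) + 2, by
    have := ENNReal.rpow_ne_top_of_nonneg (x := 2) (y := t * θ / s) (by positivity) (by simp)
    finiteness, fun w hw c R hR Γ hΓ μ hμ => ?_⟩
  have h1 := h w hw c R hR Γ hΓ μ hμ
  set B := Metric.ball c R with hB
  set D := {x | x ∈ B ∧ ENNReal.ofReal μ < Jop d c R Γ x} with hD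
  set e := ENNReal.ofReal μ with he
  have he0 : e ≠ 0 := by simpa [he] using hμ
  have het : e ≠ ⊤ := ENNReal.ofReal_ne_top
  have hm0 : wm w B ≠ 0 := hw.pos c R hR
  have hmt : wm w B ≠ ⊤ := hw.fin c R
  have hle : MeasurableSet {x | Γ x ≤ e} := measurableSet_le hΓ measurable_const
  have hM1 : ∀ z : ℝ, Measurable fun x => if Γ x ≤ e then Γ x ^ z else 0 := fun z =>
    Measurable.ite hle (hΓ.pow_const z) measurable_const
  have hM2 : Measurable fun x => if Γ x ≤ e then 0 else Γ x ^ s :=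
    Measurable.ite hle measurable_const (hΓ.pow_const s)
  set I1 := ∫⁻ x in B, (if Γ x ≤ e then Γ x ^ s else 0) ∂(wm w) with hI1
  set I2 := ∫⁻ x in B, (if Γ x ≤ e then 0 else Γ x ^ s) ∂(wm w) with hI2
  have hI : ∫⁻ x in B, Γ x ^ s ∂(wm w) = I1 + I2 := by
    rw [hI1, hI2, ← lintegral_add_left (hM1 s)]
    refine lintegral_congr fun x => ?_
    split_ifs <;> simp
  have h3 : PhiS w θ B D / wm w B ≤ 2 :=
    ENNReal.div_le_of_le_mul (PhiS_le_two_mul w hθ.le fun x hx => hx.1)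
  have h4 : PhiS w θ B D / wm w B ≤ K * (I1 / wm w B / e ^ s + I2 / wm w B / e ^ s) ^
      (t * θ / s) := by
    rw [ENNReal.div_le_iff hm0 hmt, mul_right_comm, ← ENNReal.add_div, ← ENNReal.add_div, ← hI]
    exact h1
  have h5 := min_le_add_of_le hrs h3 h4
  rw [ENNReal.div_le_iff hm0 hmt, mul_assoc] at h5
  refine h5.trans ?_
  gcongr
  rw [lintegral_add_left ((hM1 _).const_mul _), lintegral_const_mul _ (hM1 _),
    lintegral_const_mul _ hM2, ← hI2, add_mul]
  refine add_le_add ?_ (le_of_eq ?_)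
  · have hJ := lintegral_rpow_le_measure_mul ((wm w).restrict B) (hM1 s).aemeasurable hrs
    rw [← hI1, Measure.restrict_apply_univ] at hJ
    have h6 : ∀ x, (if Γ x ≤ e then Γ x ^ s else 0) ^ (t * θ / s) =
        if Γ x ≤ e then Γ x ^ (t * θ) else 0 := by
      intro x
      split_ifs
      · rw [← ENNReal.rpow_mul]; congr 1; field_simp
      · rw [ENNReal.zero_rpow_of_pos (by positivity)]
    simp only [h6] at hJ
    rw [ENNReal.div_rpow_of_nonneg _ _ (by positivity), ENNReal.div_rpow_of_nonneg _ _ (by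
      positivity), ← ENNReal.rpow_mul, show s * (t * θ / s) = t * θ by field_simp,
      ENNReal.rpow_neg, div_eq_mul_inv, mul_right_comm, mul_comm]
    gcongr
    rw [← ENNReal.mul_div_right_comm, ENNReal.div_le_iff (by simp [hm0, hmt])
      (ENNReal.rpow_ne_top_of_nonneg (by positivity) hmt)]
    refine (mul_le_mul' hJ le_rfl).trans (le_of_eq ?_)
    rw [mul_right_comm, mul_comm]
    congr 1
    conv_lhs => rw [← ENNReal.rpow_one (wm w B), ← ENNReal.rpow_mul, one_mul,
      ← ENNReal.rpow_add _ _ hm0 hmt, sub_add_cancel]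
  · rw [ENNReal.rpow_neg, div_eq_mul_inv, div_eq_mul_inv, mul_right_comm _ (wm w B)⁻¹, mul_assoc,
      ENNReal.inv_mul_cancel hm0 hmt, mul_one, mul_comm]

theorem exists_exponent_gt {n p a L : ℝ} (ha : 0 < a) (h : n * (1 / p - 1 / a) < L) :
    ∃ q' : ℝ, a < q' ∧ n * (1 / p - 1 / q') < L := by
  have hc : ContinuousAt (fun x : ℝ => n * (1 / p - 1 / x)) a := by
    fun_prop (disch := exact ha.ne')
  have h1 : ∀ᶠ x in 𝓝[>] a, n * (1 / p - 1 / x) < L :=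
    nhdsWithin_le_nhds (hc.eventually_lt continuousAt_const h)
  obtain ⟨x, hx, hxa⟩ := (h1.and self_mem_nhdsWithin).exists
  exact ⟨x, hxa, hx⟩

theorem exists_exponent_lt {n p a L : ℝ} (hp : 1 < p) (h : n * (1 / p - 1 / a) < L) :
    ∃ s : ℝ, 1 < s ∧ s < p ∧ n * (1 / s - 1 / a) < L := by
  have hc : ContinuousAt (fun x : ℝ => n * (1 / x - 1 / a)) p := by
    have : p ≠ 0 := by linarith
    fun_prop (disch := exact this)
  have h1 : ∀ᶠ x in 𝓝[<] p, n * (1 / x - 1 / a) < L :=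
    nhdsWithin_le_nhds (hc.eventually_lt continuousAt_const h)
  have h2 : ∀ᶠ x in 𝓝[<] p, 1 < x := nhdsWithin_le_nhds (lt_mem_nhds hp)
  obtain ⟨x, ⟨hx, hx1⟩, hxa⟩ := ((h1.and h2).and self_mem_nhdsWithin).exists
  exact ⟨x, hx1, hxa, hx⟩

theorem exists_exponent_pair {n p q L : ℝ} (hp : 0 < p) (hL : 0 < L)
    (h : n * (1 / p - 1 / q) < L) :
    ∃ q' t : ℝ, p < q' ∧ q < q' ∧ q' < t ∧ n * (1 / p - 1 / t) < L := by
  have h1 : n * (1 / p - 1 / max p q) < L := by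
    rcases le_total p q with h' | h'
    · rwa [max_eq_right h']
    · rw [max_eq_left h']; simpa using hL
  obtain ⟨q', hq', h2⟩ := exists_exponent_gt (lt_max_of_lt_left hp) h1
  obtain ⟨t, ht, h3⟩ := exists_exponent_gt ((lt_max_of_lt_left hp).trans hq') h2
  exact ⟨q', t, (le_max_left _ _).trans_lt hq', (le_max_right _ _).trans_lt hq', ht, h3⟩

theorem rpow_ne_one_of_one_lt {Λ b : ℝ} (hΛ : 1 < Λ) (hb : b ≠ 0) : Λ ^ b ≠ 1 := by
  rcases hb.lt_or_gt with h | h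
  · exact (Real.rpow_lt_one_of_one_lt_of_neg hΛ h).ne
  · exact (Real.one_lt_rpow hΛ h).ne'

theorem ngrad_ne_top (ℓ : ℕ) (f : En n → ℝ) (x : En n) : ngrad ℓ f x ≠ ⊤ := by
  unfold ngrad oscG
  exact (ENNReal.sum_lt_top.2 fun _ _ => ENNReal.ofReal_lt_top).ne

/-- Summation over the scales of the two parts of a function cut at geometric thresholds. -/
theorem exists_tsum_split_le {ρ p r s : ℝ} (hρ : 0 < ρ) (hρ1 : ρ ≠ 1) (hs : 0 < s) (hsp : s < p)
    (hpr : p < r) : ∃ C : ℝ≥0∞, C ≠ ⊤ ∧ ∀ (c : ℝ) (X : ℝ≥0∞), 0 < c → X ≠ ⊤ →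
      ∑' i : ℤ, ENNReal.ofReal (c * ρ ^ i) ^ p *
        (ENNReal.ofReal (c * ρ ^ i) ^ (-r) * (if X ≤ ENNReal.ofReal (c * ρ ^ i) then X ^ r else 0) +
        ENNReal.ofReal (c * ρ ^ i) ^ (-s) *
          (if X ≤ ENNReal.ofReal (c * ρ ^ i) then 0 else X ^ s)) ≤ C * X ^ p := by
  obtain ⟨C1, hC1, -, h1⟩ := tsum_geometric_le_cutoff (α := p - s) hρ hρ1 (by linarith)
  obtain ⟨C2, hC2, -, h2⟩ := tsum_geometric_ge_cutoff (α := p - r) hρ hρ1 (by linarith)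
  refine ⟨C1 + C2, by finiteness, fun c X hc hX => ?_⟩
  by_cases hX0 : X = 0
  · subst hX0
    have hr : r ≠ 0 := by linarith
    have hp : 0 < p := by linarith
    simp [ENNReal.zero_rpow_of_pos (show 0 < r by linarith)]
  have h3 : ∀ i : ℤ, ENNReal.ofReal (c * ρ ^ i) ^ p *
        (ENNReal.ofReal (c * ρ ^ i) ^ (-r) * (if X ≤ ENNReal.ofReal (c * ρ ^ i) then X ^ r else 0) +
        ENNReal.ofReal (c * ρ ^ i) ^ (-s) *
          (if X ≤ ENNReal.ofReal (c * ρ ^ i) then 0 else X ^ s)) ≤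
      X ^ s * (if ENNReal.ofReal (c * ρ ^ i) ≤ X then ENNReal.ofReal (c * ρ ^ i) ^ (p - s) else 0) +
      X ^ r * (if X ≤ ENNReal.ofReal (c * ρ ^ i) then ENNReal.ofReal (c * ρ ^ i) ^ (p - r)
        else 0) := by
    intro i
    set e := ENNReal.ofReal (c * ρ ^ i) with he
    have he0 : e ≠ 0 := by
      rw [he, Ne, ENNReal.ofReal_eq_zero, not_le]; positivity
    have het : e ≠ ⊤ := ENNReal.ofReal_ne_top
    rw [mul_add, ← mul_assoc, ← mul_assoc, ← ENNReal.rpow_add _ _ he0 het,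
      ← ENNReal.rpow_add _ _ he0 het, ← sub_eq_add_neg, ← sub_eq_add_neg]
    by_cases h : X ≤ e
    · simp only [if_pos h, mul_zero, add_zero]
      rw [mul_comm]
      exact le_add_self
    · simp only [if_neg h, mul_zero, add_zero, zero_add, if_pos (not_le.1 h).le]
      rw [mul_comm]
  refine (ENNReal.tsum_le_tsum h3).trans ?_
  rw [ENNReal.tsum_add, ENNReal.tsum_mul_left, ENNReal.tsum_mul_left, add_mul]
  refine add_le_add ((mul_le_mul' le_rfl (h1 c X hc)).trans (le_of_eq ?_))
    ((mul_le_mul' le_rfl (h2 c X hc)).trans (le_of_eq ?_))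
  · rw [mul_left_comm, ← ENNReal.rpow_add _ _ hX0 hX, add_sub_cancel]
  · rw [mul_left_comm, ← ENNReal.rpow_add _ _ hX0 hX, add_sub_cancel]

theorem smooth_bound_of_one_lt (hn : 0 < n) {k ℓ : ℕ} (hℓ : 0 < ℓ) (hkl : ℓ ≤ k) {p q b : ℝ}
    (hp : 1 < p) (hq : 0 < q) (hpq : (n : ℝ) * (1 / p - 1 / q) < ℓ) (hb : b ≠ 0) {A : ℝ≥0∞}
    (hA : A ≠ ⊤) : ∃ K : ℝ≥0∞, K ≠ ⊤ ∧ ∀ w : En n → ℝ≥0∞, A1W A w → ∀ f : En n → ℝ,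
      ContDiff ℝ (⊤ : ℕ∞) f → ∀ lam : ℝ, 0 < lam →
      ENNReal.ofReal lam ^ p * ∫⁻ x, innerInt k ℓ lam b (b * q) f x ^ (p / q) ∂(wm w) ≤
        K * ∫⁻ x, ngrad ℓ f x ^ p ∂(wm w) := by
  have hp0 : 0 < p := by linarith
  obtain ⟨q', t, hpq', hqq', hqt, hnt⟩ := exists_exponent_pair hp0
    (by exact_mod_cast hℓ : (0 : ℝ) < ℓ) hpq
  obtain ⟨s, hs1, hsp, hst⟩ := exists_exponent_lt hp hnt
  obtain ⟨d, rfl⟩ : ∃ d, ℓ = d + 1 := ⟨ℓ - 1, by omega⟩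
  have hq'0 : 0 < q' := hq.trans hqq'
  have hpr : p < t * (p / q') := by
    rw [← mul_div_assoc, lt_div_iff₀ hq'0]; nlinarith
  have hΛ : (1 : ℝ) < 2 := by norm_num
  set ρ : ℝ := 2 ^ b with hρdef
  have hρ : 0 < ρ := by positivity
  have hρ1 : ρ ≠ 1 := rpow_ne_one_of_one_lt hΛ hb
  obtain ⟨K1, hK1, c', hc', h1⟩ := exists_innerInt_le_badSet hn (k := k) (ℓ := d + 1) (L := d + 1)
    (by omega) hΛ hp0 hq hqq' hpq'.le hb
  obtain ⟨K2, hK2, h2⟩ := exists_PhiS_Jop_le_split (n := n) d hs1.le (θ := p / q') (by positivity)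
    (by rw [div_le_one hq'0]; exact hpq'.le) (hsp.le.trans hpr.le) (by exact_mod_cast hst) hA
  obtain ⟨K3, hK3, h3⟩ := exists_tsum_split_le hρ hρ1 (by linarith) hsp hpr
  set R₀ : ℝ := n + k * 2 + 1 with hR₀
  have hR₀' : 0 < R₀ := by positivity
  obtain ⟨N, hN, h4⟩ := exists_tsum_setLIntegral_le n R₀
  set ec := ENNReal.ofReal c' ^ p with hec
  have hec0 : ec ≠ 0 := by simp [hec, hc', hp0]
  have hect : ec ≠ ⊤ := ENNReal.rpow_ne_top_of_nonneg hp0.le ENNReal.ofReal_ne_top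
  refine ⟨K1 * (ec⁻¹ * (K2 * (N * K3))), by finiteness, fun w hw f hf lam hlam => ?_⟩
  have h5 := h1 w f hf (fun _ _ _ => 0) (Or.inr ⟨hkl, by simp⟩) lam hlam
  have hexp : (2 : ℝ) ^ (((d + 1 : ℕ) : ℝ) + b - ((d + 1 : ℕ) : ℝ)) = ρ := by
    rw [add_sub_cancel_left]
  simp only [hexp] at h5
  have hNG := measurable_ngrad (d + 1) hf
  set Γ := ngrad (d + 1) f with hΓ
  set μ : ℤ → ℝ := fun i => c' * lam * ρ ^ i with hμ
  have hμ0 : ∀ i, 0 < μ i := fun i => by positivity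
  set F : ℤ → En n → ℝ≥0∞ := fun i x => ENNReal.ofReal (μ i) ^ (-(t * (p / q'))) *
      (if Γ x ≤ ENNReal.ofReal (μ i) then Γ x ^ (t * (p / q')) else 0) +
      ENNReal.ofReal (μ i) ^ (-s) * (if Γ x ≤ ENNReal.ofReal (μ i) then 0 else Γ x ^ s) with hF
  have hFm : ∀ i, Measurable (F i) := by
    intro i
    have hle : MeasurableSet {x | Γ x ≤ ENNReal.ofReal (μ i)} :=
      measurableSet_le hNG measurable_const
    exact ((Measurable.ite hle (hNG.pow_const _) measurable_const).const_mul _).add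
      ((Measurable.ite hle measurable_const (hNG.pow_const _)).const_mul _)
  have h6 : ∀ i, ∑' m : Fin n → ℤ, PhiS w (p / q') (Metric.ball (ctr 2 i m) (R₀ * 2 ^ i))
      (badSet (d + 1) f (fun _ => 0) (ctr 2 i m) (R₀ * 2 ^ i) (μ i)) ≤
      K2 * (N * ∫⁻ x, F i x ∂(wm w)) := by
    intro i
    refine le_trans ?_ (mul_le_mul' le_rfl (h4 2 zero_lt_two i (wm w) (F i) (hFm i)))
    rw [← ENNReal.tsum_mul_left]
    exact ENNReal.tsum_le_tsum fun m => h2 w hw _ _ (by positivity) Γ hNG _ (hμ0 i)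
  have h7 : ∀ i, ec * ENNReal.ofReal lam ^ p * ENNReal.ofReal (ρ ^ i) ^ p =
      ENNReal.ofReal (μ i) ^ p := by
    intro i
    rw [hec, ← ENNReal.mul_rpow_of_nonneg _ _ hp0.le, ← ENNReal.mul_rpow_of_nonneg _ _ hp0.le,
      ← ENNReal.ofReal_mul hc'.le, ← ENNReal.ofReal_mul (by positivity)]
  calc ENNReal.ofReal lam ^ p * ∫⁻ x, innerInt k (d + 1) lam b (b * q) f x ^ (p / q) ∂(wm w)
      ≤ ENNReal.ofReal lam ^ p * (K1 * ∑' i : ℤ, ENNReal.ofReal (ρ ^ i) ^ p *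
          (K2 * (N * ∫⁻ x, F i x ∂(wm w)))) := by
        gcongr ENNReal.ofReal lam ^ p * ?_
        refine h5.trans ?_
        gcongr K1 * ?_
        exact ENNReal.tsum_le_tsum fun i => mul_le_mul' le_rfl (h6 i)
    _ = K1 * (ec⁻¹ * (K2 * (N * ∑' i : ℤ, ENNReal.ofReal (μ i) ^ p * ∫⁻ x, F i x ∂(wm w)))) := by
        rw [mul_left_comm, ← ENNReal.tsum_mul_left]
        congr 1
        simp only [← ENNReal.tsum_mul_left]
        congr 1
        ext i
        rw [← h7 i]
        have : ec⁻¹ * ec = 1 := ENNReal.inv_mul_cancel hec0 hect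
        calc _ = 1 * (ENNReal.ofReal lam ^ p * (ENNReal.ofReal (ρ ^ i) ^ p *
              (K2 * (N * ∫⁻ x, F i x ∂(wm w))))) := by rw [one_mul]
          _ = _ := by rw [← this]; ring
    _ ≤ K1 * (ec⁻¹ * (K2 * (N * (K3 * ∫⁻ x, Γ x ^ p ∂(wm w))))) := by
        gcongr
        simp only [← lintegral_const_mul _ (hFm _)]
        rw [← lintegral_tsum fun i => ((hFm i).const_mul _).aemeasurable,
          ← lintegral_const_mul _ (hNG.pow_const p)]
        exact lintegral_mono fun x => h3 (c' * lam) (Γ x) (by positivity) (ngrad_ne_top _ _ _)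
    _ = _ := by ring

theorem le_tsum_dyadic_of_le {K X P : ℝ≥0∞} {r : ℝ} (hr : 0 < r) (h2 : P ≤ 2)
    (hP : P ≤ K * X ^ r) :
    P ≤ (K + 2) * ∑' ν : ℕ, ENNReal.ofReal ((1 / 2) ^ ν) ^ r *
      (if ENNReal.ofReal ((1 / 2) ^ (ν + 1)) < X then 1 else 0) := by
  by_cases hX0 : X = 0
  · subst hX0
    rw [ENNReal.zero_rpow_of_pos hr, mul_zero] at hP
    exact hP.trans zero_le
  obtain ⟨ν, hν, hν'⟩ : ∃ ν : ℕ, ENNReal.ofReal ((1 / 2) ^ (ν + 1)) < X ∧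
      P ≤ (K + 2) * ENNReal.ofReal ((1 / 2) ^ ν) ^ r := by
    by_cases h1 : X ≤ 1
    · have hXt : X ≠ ⊤ := ne_top_of_le_ne_top ENNReal.one_ne_top h1
      obtain ⟨ν, h3, h4⟩ := exists_nat_pow_near_of_lt_one (x := X.toReal) (y := 1 / 2)
        (ENNReal.toReal_pos hX0 hXt) (by simpa using ENNReal.toReal_mono ENNReal.one_ne_top h1)
        (by norm_num) (by norm_num)
      refine ⟨ν, (ENNReal.ofReal_lt_iff_lt_toReal (by positivity) hXt).2 h3, hP.trans ?_⟩
      gcongr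
      · exact le_self_add
      · exact (ENNReal.le_ofReal_iff_toReal_le hXt (by positivity)).2 h4
    · refine ⟨0, lt_of_le_of_lt ?_ (not_le.1 h1), h2.trans ?_⟩
      · rw [ENNReal.ofReal_le_one]; norm_num
      · simp
  refine hν'.trans ?_
  gcongr
  refine le_trans ?_ (ENNReal.le_tsum ν)
  rw [if_pos hν, mul_one]

/-- The small balls meeting a fixed ball of comparable or larger size. -/
theorem exists_tsum_inter_ball_le {Λ b D : ℝ} (hΛ : 1 < Λ) (hb : 0 < b) (hD : 0 < D) {A : ℝ≥0∞}
    (hA : A ≠ ⊤) : ∃ C : ℝ≥0∞, C ≠ ⊤ ∧ ∀ w : En n → ℝ≥0∞, A1W A w → ∀ (c : ℝ), 0 < c →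
      ∀ (j : ℤ) (x : En n),
      ∑' i : ℤ, ∑' m : Fin n → ℤ, (if (Metric.ball (ctr Λ i m) (D * Λ ^ i) ∩
          Metric.ball x (D * Λ ^ j)).Nonempty ∧ D * Λ ^ i ≤ 2 * (D * Λ ^ j) then
          ENNReal.ofReal (c * (Λ ^ b) ^ i) * wm w (Metric.ball (ctr Λ i m) (D * Λ ^ i)) else 0) ≤
        C * (ENNReal.ofReal (c * (Λ ^ b) ^ j) * wm w (Metric.ball x (D * Λ ^ j))) := by
  have hΛ0 : 0 < Λ := by linarith
  obtain ⟨N, hN, h1⟩ := exists_tsum_setLIntegral_le n D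
  obtain ⟨C, hC, -, h2⟩ := tsum_geometric_le_cutoff hΛ0 hΛ.ne' hb
  refine ⟨N * (A * ENNReal.ofReal (5 ^ n)) * (C * ENNReal.ofReal (2 ^ b)), by finiteness,
    fun w hw c hc j x => ?_⟩
  set S := Metric.ball x (5 * (D * Λ ^ j)) with hS
  have hj : 0 < Λ ^ j := by positivity
  have h3 : wm w S ≤ A * ENNReal.ofReal (5 ^ n) * wm w (Metric.ball x (D * Λ ^ j)) :=
    hw.measure_ball_le x x (by positivity) (by norm_num) le_rfl
      (Metric.ball_subset_ball (by nlinarith [mul_pos hD hj]))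
  have hpow : ∀ i : ℤ, (Λ ^ b) ^ i = (Λ ^ i) ^ b := by
    intro i
    rw [← Real.rpow_intCast, ← Real.rpow_intCast, ← Real.rpow_mul hΛ0.le, ← Real.rpow_mul hΛ0.le,
      mul_comm]
  have h4 : ∀ i : ℤ, ∑' m : Fin n → ℤ, (if (Metric.ball (ctr Λ i m) (D * Λ ^ i) ∩
          Metric.ball x (D * Λ ^ j)).Nonempty ∧ D * Λ ^ i ≤ 2 * (D * Λ ^ j) then
          ENNReal.ofReal (c * (Λ ^ b) ^ i) * wm w (Metric.ball (ctr Λ i m) (D * Λ ^ i)) else 0) ≤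
      ENNReal.ofReal c * (if ENNReal.ofReal (1 * Λ ^ i) ≤ ENNReal.ofReal (2 * Λ ^ j) then
        ENNReal.ofReal (1 * Λ ^ i) ^ b else 0) * (N * wm w S) := by
    intro i
    have hi : 0 < Λ ^ i := by positivity
    by_cases hij : D * Λ ^ i ≤ 2 * (D * Λ ^ j)
    · have hij' : 1 * Λ ^ i ≤ 2 * Λ ^ j := by
        have : D * (1 * Λ ^ i) ≤ D * (2 * Λ ^ j) := by linarith
        exact le_of_mul_le_mul_left this hD
      rw [if_pos (ENNReal.ofReal_le_ofReal hij'), one_mul,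
        ENNReal.ofReal_rpow_of_pos hi, ← ENNReal.ofReal_mul hc.le, ← hpow]
      have h5 := h1 Λ hΛ0 i (wm w) (S.indicator 1) (measurable_one.indicator measurableSet_ball)
      rw [lintegral_indicator_one measurableSet_ball] at h5
      refine le_trans ?_ (mul_le_mul' le_rfl h5)
      rw [← ENNReal.tsum_mul_left]
      refine ENNReal.tsum_le_tsum fun m => ?_
      split_ifs with h6
      · gcongr
        rw [lintegral_indicator_one measurableSet_ball, Measure.restrict_apply measurableSet_ball,
          inter_eq_right.2]
        obtain ⟨⟨z, hz1, hz2⟩, -⟩ := h6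
        intro y hy
        rw [Metric.mem_ball] at hz1 hz2 hy ⊢
        have t1 := dist_triangle y (ctr Λ i m) x
        have t2 := dist_triangle_left (ctr Λ i m) x z
        linarith
      · exact zero_le
    · simp [hij]
  refine (ENNReal.tsum_le_tsum h4).trans ?_
  rw [ENNReal.tsum_mul_right, ENNReal.tsum_mul_left]
  calc _ ≤ ENNReal.ofReal c * (C * ENNReal.ofReal (2 * Λ ^ j) ^ b) *
        (N * (A * ENNReal.ofReal (5 ^ n) * wm w (Metric.ball x (D * Λ ^ j)))) := by
        gcongr
        exact h2 1 _ one_pos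
    _ = _ := by
        rw [ENNReal.ofReal_rpow_of_pos (by positivity), Real.mul_rpow zero_le_two hj.le, ← hpow,
          ENNReal.ofReal_mul (by positivity), ENNReal.ofReal_mul hc.le]
        ring

/-- Summation of the large balls in a weighted Carleson-type family. -/
theorem exists_tsum_ball_le_lintegral {Λ b D : ℝ} (hΛ : 1 < Λ) (hb : 0 < b) (hD : 0 < D)
    {A : ℝ≥0∞} (hA : A ≠ ⊤) : ∃ C : ℝ≥0∞, C ≠ ⊤ ∧ ∀ w : En n → ℝ≥0∞, A1W A w →
      ∀ Γ : En n → ℝ≥0∞, ∀ (c : ℝ), 0 < c →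
      ∑' i : ℤ, ∑' m : Fin n → ℤ, (if ENNReal.ofReal (c * (Λ ^ b) ^ i) *
          wm w (Metric.ball (ctr Λ i m) (D * Λ ^ i)) <
            ∫⁻ x in Metric.ball (ctr Λ i m) (D * Λ ^ i), Γ x ∂(wm w) then
          ENNReal.ofReal (c * (Λ ^ b) ^ i) * wm w (Metric.ball (ctr Λ i m) (D * Λ ^ i)) else 0) ≤
        C * ∫⁻ x, Γ x ∂(wm w) := by
  have hΛ0 : 0 < Λ := by linarith
  obtain ⟨C, hC, h1⟩ := exists_tsum_inter_ball_le (n := n) hΛ hb hD hA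
  refine ⟨C, hC, fun w hw Γ c hc => ?_⟩
  set B : ℤ × (Fin n → ℤ) → Set (En n) := fun a => Metric.ball (ctr Λ a.1 a.2) (D * Λ ^ a.1)
    with hB
  set F : ℤ × (Fin n → ℤ) → ℝ≥0∞ := fun a => ENNReal.ofReal (c * (Λ ^ b) ^ a.1) * wm w (B a)
    with hF
  have hr : ∀ a : ℤ × (Fin n → ℤ), 0 < D * Λ ^ a.1 := fun a => by positivity
  change ∑' i : ℤ, ∑' m : Fin n → ℤ, (fun a => if F a < ∫⁻ x in B a, Γ x ∂(wm w) then F a else 0)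
    (i, m) ≤ _
  rw [← ENNReal.tsum_prod' (f := fun a => if F a < ∫⁻ x in B a, Γ x ∂(wm w) then F a else 0),
    ENNReal.tsum_eq_iSup_sum]
  refine iSup_le fun T => ?_
  rw [← Finset.sum_filter]
  set T' := T.filter fun a => F a < ∫⁻ x in B a, Γ x ∂(wm w) with hT'
  obtain ⟨u, huT, hdisj, hcov⟩ := Vitali.exists_disjoint_subfamily_covering_enlargement B
    (T' : Set (ℤ × (Fin n → ℤ))) (fun a => D * Λ ^ a.1) 2 (by norm_num) (fun a _ => (hr a).le)
    (∑ a ∈ T', D * Λ ^ a.1)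
    (fun a ha => Finset.single_le_sum (f := fun a : ℤ × (Fin n → ℤ) => D * Λ ^ a.1)
      (fun a _ => (hr a).le) (Finset.mem_coe.1 ha))
    (fun a _ => Metric.nonempty_ball.2 (hr a))
  obtain ⟨U, rfl⟩ := (T'.finite_toSet.subset huT).exists_finset_coe
  set Rel : ℤ × (Fin n → ℤ) → ℤ × (Fin n → ℤ) → Prop := fun a e =>
    (B a ∩ B e).Nonempty ∧ D * Λ ^ a.1 ≤ 2 * (D * Λ ^ e.1) with hRel
  calc ∑ a ∈ T', F a ≤ ∑ a ∈ T', ∑ e ∈ U, if Rel a e then F a else 0 := by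
        refine Finset.sum_le_sum fun a ha => ?_
        obtain ⟨e, he, h⟩ := hcov a ha
        refine le_trans ?_ (Finset.single_le_sum (f := fun e => if Rel a e then F a else 0)
          (fun _ _ => zero_le) (Finset.mem_coe.1 he))
        rw [if_pos (show Rel a e from h)]
    _ = ∑ e ∈ U, ∑ a ∈ T', if Rel a e then F a else 0 := Finset.sum_comm
    _ ≤ ∑ e ∈ U, C * F e := by
        refine Finset.sum_le_sum fun e _ => ?_
        refine (ENNReal.sum_le_tsum T').trans ?_
        rw [ENNReal.tsum_prod']
        exact h1 w hw c hc e.1 (ctr Λ e.1 e.2)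
    _ ≤ ∑ e ∈ U, C * ∫⁻ x in B e, Γ x ∂(wm w) := by
        refine Finset.sum_le_sum fun e he => mul_le_mul' le_rfl ?_
        exact (Finset.mem_filter.1 (huT (Finset.mem_coe.2 he))).2.le
    _ = C * ∫⁻ x in ⋃ e ∈ U, B e, Γ x ∂(wm w) := by
        rw [← Finset.mul_sum, lintegral_biUnion_finset hdisj fun _ _ => measurableSet_ball]
    _ ≤ _ := by
        gcongr
        exact Measure.restrict_le_self

theorem exists_tsum_dyadic_le {Λ b D r : ℝ} (hΛ : 1 < Λ) (hb : 0 < b) (hD : 0 < D) (hr : 1 < r)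
    {A : ℝ≥0∞} (hA : A ≠ ⊤) : ∃ C : ℝ≥0∞, C ≠ ⊤ ∧ ∀ w : En n → ℝ≥0∞, A1W A w →
      ∀ Γ : En n → ℝ≥0∞, ∀ (c : ℝ), 0 < c →
      ∑' i : ℤ, ∑' m : Fin n → ℤ, ENNReal.ofReal (c * (Λ ^ b) ^ i) *
          (wm w (Metric.ball (ctr Λ i m) (D * Λ ^ i)) *
          ∑' ν : ℕ, ENNReal.ofReal ((1 / 2) ^ ν) ^ r *
            (if ENNReal.ofReal ((1 / 2) ^ (ν + 1)) <
              (∫⁻ x in Metric.ball (ctr Λ i m) (D * Λ ^ i), Γ x ∂(wm w)) /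
                wm w (Metric.ball (ctr Λ i m) (D * Λ ^ i)) /
                ENNReal.ofReal (c * (Λ ^ b) ^ i) then 1 else 0)) ≤
        C * ∫⁻ x, Γ x ∂(wm w) := by
  have hΛ0 : 0 < Λ := by linarith
  obtain ⟨C, hC, h1⟩ := exists_tsum_ball_le_lintegral (n := n) hΛ hb hD hA
  have hq0 : (0 : ℝ) < (1 / 2) ^ (r - 1) := by positivity
  have hq1 : (1 / 2 : ℝ) ^ (r - 1) < 1 :=
    Real.rpow_lt_one (by norm_num) (by norm_num) (by linarith)
  refine ⟨2 * (1 - ENNReal.ofReal ((1 / 2) ^ (r - 1)))⁻¹ * C, ?_, fun w hw Γ c hc => ?_⟩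
  · refine ENNReal.mul_ne_top (ENNReal.mul_ne_top (by finiteness) ?_) hC
    rw [ENNReal.inv_ne_top, Ne, tsub_eq_zero_iff_le, not_le]
    rwa [ENNReal.ofReal_lt_one]
  set B : ℤ → (Fin n → ℤ) → Set (En n) := fun i m => Metric.ball (ctr Λ i m) (D * Λ ^ i) with hB
  have hr' : ∀ i : ℤ, 0 < D * Λ ^ i := fun a => by positivity
  have h2 : ∀ (ν : ℕ) (i : ℤ) (m : Fin n → ℤ),
      ENNReal.ofReal (c * (Λ ^ b) ^ i) * (wm w (B i m) * (ENNReal.ofReal ((1 / 2) ^ ν) ^ r *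
            (if ENNReal.ofReal ((1 / 2) ^ (ν + 1)) < (∫⁻ x in B i m, Γ x ∂(wm w)) / wm w (B i m) /
                ENNReal.ofReal (c * (Λ ^ b) ^ i) then 1 else 0))) =
      2 * ENNReal.ofReal ((1 / 2) ^ (r - 1)) ^ ν *
      (if ENNReal.ofReal ((1 / 2) ^ (ν + 1) * c * (Λ ^ b) ^ i) * wm w (B i m) <
            ∫⁻ x in B i m, Γ x ∂(wm w) then
          ENNReal.ofReal ((1 / 2) ^ (ν + 1) * c * (Λ ^ b) ^ i) * wm w (B i m) else 0) := by
    intro ν i m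
    have hpos : 0 < c * (Λ ^ b) ^ i := by positivity
    have hiff : ENNReal.ofReal ((1 / 2) ^ (ν + 1)) < (∫⁻ x in B i m, Γ x ∂(wm w)) / wm w (B i m) /
        ENNReal.ofReal (c * (Λ ^ b) ^ i) ↔
        ENNReal.ofReal ((1 / 2) ^ (ν + 1) * c * (Λ ^ b) ^ i) * wm w (B i m) <
            ∫⁻ x in B i m, Γ x ∂(wm w) := by
      rw [ENNReal.lt_div_iff_mul_lt (Or.inl (by rw [Ne, ENNReal.ofReal_eq_zero, not_le]; exact hpos))
        (Or.inl ENNReal.ofReal_ne_top), ENNReal.lt_div_iff_mul_lt (Or.inl (hw.pos _ _ (hr' i)))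
        (Or.inl (hw.fin _ _)), ← ENNReal.ofReal_mul (by positivity), ← mul_assoc]
    by_cases h : ENNReal.ofReal ((1 / 2) ^ (ν + 1) * c * (Λ ^ b) ^ i) * wm w (B i m) <
            ∫⁻ x in B i m, Γ x ∂(wm w)
    · rw [if_pos h, if_pos (hiff.2 h), mul_one]
      have : ENNReal.ofReal (c * (Λ ^ b) ^ i) * ENNReal.ofReal ((1 / 2) ^ ν) ^ r =
          2 * ENNReal.ofReal ((1 / 2) ^ (r - 1)) ^ ν *
            ENNReal.ofReal ((1 / 2) ^ (ν + 1) * c * (Λ ^ b) ^ i) := by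
        rw [ENNReal.ofReal_rpow_of_pos (by positivity), ← ENNReal.ofReal_pow (by positivity),
          ← ENNReal.ofReal_mul (by positivity),
          show (2 : ℝ≥0∞) = ENNReal.ofReal 2 by simp, ← ENNReal.ofReal_mul (by positivity),
          ← ENNReal.ofReal_mul (by positivity)]
        congr 1
        rw [← Real.rpow_natCast (1 / 2) ν, ← Real.rpow_mul (by norm_num), mul_comm (ν : ℝ) r,
          Real.rpow_mul (by norm_num) r, Real.rpow_natCast, Real.rpow_sub_one (by norm_num), div_pow]
        have : ((1 : ℝ) / 2) ^ ν ≠ 0 := by positivity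
        rw [pow_succ (1 / 2 : ℝ) ν]
        field_simp
      rw [← mul_assoc, mul_right_comm, this, mul_assoc]
    · rw [if_neg h, if_neg (fun h' => h (hiff.1 h'))]
      simp
  calc _ = ∑' i : ℤ, ∑' m : Fin n → ℤ, ∑' ν : ℕ, 2 * ENNReal.ofReal ((1 / 2) ^ (r - 1)) ^ ν *
      (if ENNReal.ofReal ((1 / 2) ^ (ν + 1) * c * (Λ ^ b) ^ i) * wm w (B i m) <
            ∫⁻ x in B i m, Γ x ∂(wm w) then
          ENNReal.ofReal ((1 / 2) ^ (ν + 1) * c * (Λ ^ b) ^ i) * wm w (B i m) else 0) := by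
        simp only [← h2, ENNReal.tsum_mul_left]
        rfl
    _ = ∑' ν : ℕ, 2 * ENNReal.ofReal ((1 / 2) ^ (r - 1)) ^ ν * ∑' i : ℤ, ∑' m : Fin n → ℤ,
      (if ENNReal.ofReal ((1 / 2) ^ (ν + 1) * c * (Λ ^ b) ^ i) * wm w (B i m) <
            ∫⁻ x in B i m, Γ x ∂(wm w) then
          ENNReal.ofReal ((1 / 2) ^ (ν + 1) * c * (Λ ^ b) ^ i) * wm w (B i m) else 0) := by
        simp only [← ENNReal.tsum_mul_left]
        exact (tsum_congr fun i => ENNReal.tsum_comm).trans ENNReal.tsum_comm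
    _ ≤ ∑' ν : ℕ, 2 * ENNReal.ofReal ((1 / 2) ^ (r - 1)) ^ ν * (C * ∫⁻ x, Γ x ∂(wm w)) := by
        refine ENNReal.tsum_le_tsum fun ν => mul_le_mul' le_rfl ?_
        exact h1 w hw Γ _ (by positivity)
    _ = _ := by
        rw [ENNReal.tsum_mul_right, ENNReal.tsum_mul_left, ENNReal.tsum_geometric]
        ring

theorem smooth_bound_one_of_pos (hn : 0 < n) {k ℓ : ℕ} (hℓ : 0 < ℓ) (hkl : ℓ ≤ k) {q b : ℝ}
    (hq : 0 < q) (hpq : (n : ℝ) * (1 / 1 - 1 / q) < ℓ) (hb : 0 < b) {A : ℝ≥0∞}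
    (hA : A ≠ ⊤) : ∃ K : ℝ≥0∞, K ≠ ⊤ ∧ ∀ w : En n → ℝ≥0∞, A1W A w → ∀ f : En n → ℝ,
      ContDiff ℝ (⊤ : ℕ∞) f → ∀ lam : ℝ, 0 < lam →
      ENNReal.ofReal lam ^ (1 : ℝ) *
          ∫⁻ x, innerInt k ℓ lam b (b * q) f x ^ (1 / q) ∂(wm w) ≤
        K * ∫⁻ x, ngrad ℓ f x ^ (1 : ℝ) ∂(wm w) := by
  obtain ⟨q', t, hpq', hqq', hqt, hnt⟩ := exists_exponent_pair one_pos
    (by exact_mod_cast hℓ : (0 : ℝ) < ℓ) hpq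
  obtain ⟨d, rfl⟩ : ∃ d, ℓ = d + 1 := ⟨ℓ - 1, by omega⟩
  have hq'0 : 0 < q' := hq.trans hqq'
  have hpr : 1 < t * (1 / q') := by
    rw [← mul_div_assoc, mul_one, lt_div_iff₀ hq'0]; linarith
  have hΛ : (1 : ℝ) < 2 := by norm_num
  obtain ⟨K1, hK1, c', hc', h1⟩ := exists_innerInt_le_badSet hn (k := k) (ℓ := d + 1) (L := d + 1)
    (by omega) hΛ one_pos hq hqq' hpq'.le hb.ne'
  obtain ⟨K2, hK2, h2⟩ := exists_PhiS_Jop_le (n := n) d le_rfl (θ := 1 / q') (by positivity)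
    (by rw [div_le_one hq'0]; exact hpq'.le) hpr.le (by exact_mod_cast hnt) hA
  set R₀ : ℝ := n + k * 2 + 1 with hR₀
  have hR₀' : 0 < R₀ := by positivity
  obtain ⟨K3, hK3, h3⟩ := exists_tsum_dyadic_le (n := n) hΛ hb hR₀' hpr hA
  set ec := ENNReal.ofReal c' with hec
  have hec0 : ec ≠ 0 := by simp [hec, hc']
  have hect : ec ≠ ⊤ := ENNReal.ofReal_ne_top
  refine ⟨K1 * (ec⁻¹ * ((K2 + 2) * K3)), by finiteness, fun w hw f hf lam hlam => ?_⟩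
  have h5 := h1 w f hf (fun _ _ _ => 0) (Or.inr ⟨hkl, by simp⟩) lam hlam
  have hexp : (2 : ℝ) ^ (((d + 1 : ℕ) : ℝ) + b - ((d + 1 : ℕ) : ℝ)) = 2 ^ b := by
    rw [add_sub_cancel_left]
  simp only [hexp] at h5
  have hNG := measurable_ngrad (d + 1) hf
  set Γ := ngrad (d + 1) f with hΓ
  set μ : ℤ → ℝ := fun i => c' * lam * (2 ^ b) ^ i with hμ
  have hμ0 : ∀ i, 0 < μ i := fun i => by positivity
  have h6 : ∀ i m, PhiS w (1 / q') (Metric.ball (ctr 2 i m) (R₀ * 2 ^ i))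
      (badSet (d + 1) f (fun _ => 0) (ctr 2 i m) (R₀ * 2 ^ i) (μ i)) ≤
      (K2 + 2) * (wm w (Metric.ball (ctr 2 i m) (R₀ * 2 ^ i)) *
          ∑' ν : ℕ, ENNReal.ofReal ((1 / 2) ^ ν) ^ (t * (1 / q')) *
            (if ENNReal.ofReal ((1 / 2) ^ (ν + 1)) <
              (∫⁻ x in Metric.ball (ctr 2 i m) (R₀ * 2 ^ i), Γ x ∂(wm w)) /
                wm w (Metric.ball (ctr 2 i m) (R₀ * 2 ^ i)) /
                ENNReal.ofReal (μ i) then 1 else 0)) := by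
    intro i m
    set B := Metric.ball (ctr 2 i m) (R₀ * 2 ^ i) with hB
    have hRi : 0 < R₀ * (2 : ℝ) ^ i := by positivity
    have hw0 := hw.pos (ctr 2 i m) _ hRi
    have hwt := hw.fin (ctr 2 i m) (R₀ * 2 ^ i)
    have h8 := h2 w hw (ctr 2 i m) _ hRi Γ hNG _ (hμ0 i)
    simp only [ENNReal.rpow_one, div_one] at h8
    rw [mul_left_comm]
    refine (ENNReal.div_le_iff_le_mul (Or.inl hw0) (Or.inl hwt)).1 ?_ |>.trans_eq (mul_comm _ _)
    refine le_tsum_dyadic_of_le (by linarith) ?_ ?_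
    · rw [ENNReal.div_le_iff_le_mul (Or.inl hw0) (Or.inl hwt)]
      exact PhiS_le_two_mul w (by positivity) fun x hx => hx.1
    · rw [ENNReal.div_le_iff_le_mul (Or.inl hw0) (Or.inl hwt), mul_right_comm]
      exact h8
  rw [ENNReal.rpow_one]
  calc ENNReal.ofReal lam * ∫⁻ x, innerInt k (d + 1) lam b (b * q) f x ^ (1 / q) ∂(wm w)
      ≤ ENNReal.ofReal lam * (K1 * ∑' i : ℤ, ENNReal.ofReal ((2 ^ b) ^ i) ^ (1 : ℝ) *
          ∑' m, PhiS w (1 / q') (Metric.ball (ctr 2 i m) (R₀ * 2 ^ i))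
      (badSet (d + 1) f (fun _ => 0) (ctr 2 i m) (R₀ * 2 ^ i) (μ i))) := mul_le_mul' le_rfl h5
    _ ≤ ENNReal.ofReal lam * (K1 * ∑' i : ℤ, ENNReal.ofReal ((2 ^ b) ^ i) ^ (1 : ℝ) *
          ∑' m, ((K2 + 2) * (wm w (Metric.ball (ctr 2 i m) (R₀ * 2 ^ i)) *
          ∑' ν : ℕ, ENNReal.ofReal ((1 / 2) ^ ν) ^ (t * (1 / q')) *
            (if ENNReal.ofReal ((1 / 2) ^ (ν + 1)) <
              (∫⁻ x in Metric.ball (ctr 2 i m) (R₀ * 2 ^ i), Γ x ∂(wm w)) /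
                wm w (Metric.ball (ctr 2 i m) (R₀ * 2 ^ i)) /
                ENNReal.ofReal (μ i) then 1 else 0)))) := by
        gcongr with i m
        exact h6 i m
    _ = K1 * (ec⁻¹ * ((K2 + 2) * ∑' i : ℤ, ∑' m, ENNReal.ofReal (μ i) *
          (wm w (Metric.ball (ctr 2 i m) (R₀ * 2 ^ i)) *
          ∑' ν : ℕ, ENNReal.ofReal ((1 / 2) ^ ν) ^ (t * (1 / q')) *
            (if ENNReal.ofReal ((1 / 2) ^ (ν + 1)) <
              (∫⁻ x in Metric.ball (ctr 2 i m) (R₀ * 2 ^ i), Γ x ∂(wm w)) /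
                wm w (Metric.ball (ctr 2 i m) (R₀ * 2 ^ i)) /
                ENNReal.ofReal (μ i) then 1 else 0)))) := by
        simp only [ENNReal.tsum_mul_left (α := Fin n → ℤ)]
        simp only [← ENNReal.tsum_mul_left (α := ℤ)]
        refine tsum_congr fun i => ?_
        have h9 : ENNReal.ofReal lam * ENNReal.ofReal ((2 ^ b) ^ i) =
            ec⁻¹ * ENNReal.ofReal (μ i) := by
          rw [hμ, ENNReal.ofReal_mul (by positivity), ENNReal.ofReal_mul hc'.le, ← mul_assoc,
            ← mul_assoc, ENNReal.inv_mul_cancel hec0 hect, one_mul]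
        rw [ENNReal.rpow_one, mul_left_comm, ← mul_assoc (ENNReal.ofReal lam), h9]
        ring
    _ ≤ K1 * (ec⁻¹ * ((K2 + 2) * (K3 * ∫⁻ x, Γ x ∂(wm w)))) := by
        gcongr
        exact h3 w hw Γ (c' * lam) (by positivity)
    _ = _ := by simp only [ENNReal.rpow_one]; ring

theorem volume_image_inter_le {g g' : ℝ → ℝ} (hg : ∀ t, HasDerivAt g (g' t) t)
    {K : Set ℝ} (hK : MeasurableSet K) :
    volume (g '' Icc 0 1 ∩ K) ≤
      ∫⁻ t in Ioo (0 : ℝ) 1, K.indicator 1 (g t) * ENNReal.ofReal |g' t| := by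
  have hgc : Continuous g := continuous_iff_continuousAt.2 fun t => (hg t).continuousAt
  have hgK : MeasurableSet (g ⁻¹' K) := hgc.measurable hK
  have hs : MeasurableSet (Icc 0 1 ∩ g ⁻¹' K) := measurableSet_Icc.inter hgK
  have h1 := addHaar_image_le_lintegral_abs_det_fderiv (μ := volume) hs
    (f' := fun t => ContinuousLinearMap.toSpanSingleton ℝ (g' t))
    fun t _ => (hg t).hasFDerivAt.hasFDerivWithinAt
  simp only [ContinuousLinearMap.det_toSpanSingleton] at h1
  rw [image_inter_preimage] at h1
  refine h1.trans (le_of_eq ?_)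
  rw [inter_comm, ← Measure.restrict_restrict hgK, ← lintegral_indicator hgK,
    restrict_Ioo_eq_restrict_Icc]
  refine lintegral_congr fun t => ?_
  by_cases ht : g t ∈ K <;> simp [indicator, ht]

theorem hasDerivAt_Dt_line {j : ℕ} {f : En n → ℝ} (hf : ContDiff ℝ (⊤ : ℕ∞) f)
    (ι : Fin j → Fin n) (y v : En n) (t : ℝ) :
    HasDerivAt (fun t : ℝ => Dt f ι (y + t • v))
      (∑ i, v i * Dt f (Fin.cons i ι) (y + t • v)) t := by
  have h1 : HasFDerivAt (iteratedFDeriv ℝ j f) (fderiv ℝ (iteratedFDeriv ℝ j f) (y + t • v))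
      (y + t • v) :=
    (hf.differentiable_iteratedFDeriv (m := j)
      (by exact_mod_cast ENat.natCast_lt_top j) _).hasFDerivAt
  have h2 : HasDerivAt (fun t : ℝ => y + t • v) v t := by
    simpa using ((hasDerivAt_id t).smul_const v).const_add y
  have h3 := ((ContinuousMultilinearMap.apply ℝ (fun _ : Fin j => En n) ℝ
    (fun i => EuclideanSpace.single (ι i) (1 : ℝ))).hasFDerivAt).comp_hasDerivAt t
    (h1.comp_hasDerivAt t h2)
  refine h3.congr_deriv ?_
  have hv : v = ∑ i, v i • EuclideanSpace.single i (1 : ℝ) := by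
    have := (EuclideanSpace.basisFun (Fin n) ℝ).sum_repr v
    simpa using this.symm
  generalize y + t • v = x
  conv_lhs => rw [hv]
  rw [map_sum, map_sum]
  refine Finset.sum_congr rfl fun i _ => ?_
  rw [map_smul, map_smul, smul_eq_mul, Dt, iteratedFDeriv_succ_apply_left]
  simp [Fin.tail_def]

theorem abs_sum_mul_Dt_le {j : ℕ} (f : En n → ℝ) (ι : Fin j → Fin n) (x v : En n) :
    ENNReal.ofReal |∑ i, v i * Dt f (Fin.cons i ι) x| ≤
      ENNReal.ofReal ‖v‖ * ngrad (j + 1) f x := by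
  calc ENNReal.ofReal |∑ i, v i * Dt f (Fin.cons i ι) x|
      ≤ ENNReal.ofReal (∑ i, ‖v‖ * |Dt f (Fin.cons i ι) x|) := by
        refine ENNReal.ofReal_le_ofReal ((Finset.abs_sum_le_sum_abs _ _).trans ?_)
        refine Finset.sum_le_sum fun i _ => ?_
        rw [abs_mul]
        gcongr
        exact En.abs_apply_le v i
    _ = ENNReal.ofReal ‖v‖ * ∑ i : Fin n, ENNReal.ofReal |Dt f (Fin.cons i ι) x| := by
        rw [← Finset.mul_sum, ENNReal.ofReal_mul (norm_nonneg _),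
          ENNReal.ofReal_sum_of_nonneg fun _ _ => abs_nonneg _]
    _ ≤ _ := by
        gcongr
        simp only [ngrad, oscG, sub_zero]
        have hinj : Function.Injective fun i : Fin n => (Fin.cons i ι : Fin (j + 1) → Fin n) :=
          fun a b h => by simpa using congr_fun h 0
        rw [← Finset.sum_image (f := fun κ : Fin (j + 1) → Fin n => ENNReal.ofReal |Dt f κ x|)
          (s := Finset.univ) fun a _ b _ h => hinj h]
        exact Finset.sum_le_sum_of_subset (Finset.subset_univ _)

/-- A continuous function has a median on every ball. -/
theorem exists_median {u : En n → ℝ} (hu : Continuous u) (c : En n) {R : ℝ} (hR : 0 < R) :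
    ∃ M : ℝ, ∀ ε > 0,
      volume (Metric.ball c R) / 2 ≤ volume (Metric.ball c R ∩ {y | u y ≤ M + ε}) ∧
      volume (Metric.ball c R) / 2 ≤ volume (Metric.ball c R ∩ {y | M - ε ≤ u y}) := by
  set B := Metric.ball c R with hB
  have hB0 : volume B ≠ 0 := volume_ball_ne_zero c hR
  have hBt : volume B ≠ ⊤ := volume_ball_ne_top c R
  obtain ⟨b, hb⟩ := (isCompact_closedBall c R).bddAbove_image hu.continuousOn
  obtain ⟨a, ha⟩ := (isCompact_closedBall c R).bddBelow_image hu.continuousOn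
  have hb' : ∀ y ∈ B, u y ≤ b := fun y hy => hb ⟨y, Metric.ball_subset_closedBall hy, rfl⟩
  have ha' : ∀ y ∈ B, a ≤ u y := fun y hy => ha ⟨y, Metric.ball_subset_closedBall hy, rfl⟩
  set S : Set ℝ := {t | volume B / 2 ≤ volume (B ∩ {y | u y ≤ t})} with hS
  have hne : S.Nonempty := by
    refine ⟨b, ?_⟩
    have : B ∩ {y | u y ≤ b} = B := inter_eq_left.2 hb'
    rw [hS, mem_ofPred_eq, this]
    exact ENNReal.half_le_self
  have hbdd : BddBelow S := by
    refine ⟨a, fun t ht => ?_⟩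
    by_contra h
    have : B ∩ {y | u y ≤ t} = ∅ := by
      ext y
      simp only [mem_inter_iff, mem_ofPred_eq, mem_empty_iff_false, iff_false, not_and]
      intro hy h'
      linarith [ha' y hy]
    rw [hS, mem_ofPred_eq, this, measure_empty, nonpos_iff_eq_zero] at ht
    simp [hB0] at ht
  refine ⟨sInf S, fun ε hε => ⟨?_, ?_⟩⟩
  · obtain ⟨t, ht, h⟩ := exists_lt_of_csInf_lt hne (show sInf S < sInf S + ε by linarith)
    refine le_trans ht (measure_mono ?_)
    exact inter_subset_inter_right _ fun y hy => le_trans hy h.le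
  · have h1 : sInf S - ε ∉ S := fun h => by linarith [csInf_le hbdd h]
    rw [hS, mem_ofPred_eq, not_le] at h1
    have h2 : volume B ≤ volume (B ∩ {y | u y ≤ sInf S - ε}) +
        volume (B ∩ {y | sInf S - ε ≤ u y}) := by
      refine le_trans (measure_mono fun y hy => ?_) (measure_union_le _ _)
      rcases le_total (u y) (sInf S - ε) with h | h
      · exact Or.inl ⟨hy, h⟩
      · exact Or.inr ⟨hy, h⟩
    by_contra h3
    rw [not_le] at h3
    have := h2.trans_lt (ENNReal.add_lt_add h1 h3)
    rw [ENNReal.add_halves] at this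
    exact lt_irrefl _ this

/-- A function which is far from its median on a ball has a large segment average of its
derivative, even when this derivative is restricted to a window of values. -/
theorem le_Jop_indicator {L : ℕ} {f : En n → ℝ} (hf : ContDiff ℝ (⊤ : ℕ∞) f)
    (ι : Fin L → Fin n) (c : En n) {R : ℝ} (hR : 0 < R) {M t : ℝ}
    (hM : volume (Metric.ball c R) / 2 ≤ volume (Metric.ball c R ∩ {y | Dt f ι y ≤ M + t / 2}) ∧
      volume (Metric.ball c R) / 2 ≤ volume (Metric.ball c R ∩ {y | M - t / 2 ≤ Dt f ι y}))
    {K : Set ℝ} (hK : MeasurableSet K)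
    (hK1 : ENNReal.ofReal (t / 4) ≤ volume (K ∩ Icc (M + t / 2) (M + t)))
    (hK2 : ENNReal.ofReal (t / 4) ≤ volume (K ∩ Icc (M - t) (M - t / 2)))
    {z : En n} (hz : z ∈ Metric.ball c R) (ht : t < |Dt f ι z - M|) :
    ENNReal.ofReal (t / (16 * R)) ≤
      Jop 0 c R (fun y => K.indicator 1 (Dt f ι y) * ngrad (L + 1) f y) z := by
  set B := Metric.ball c R with hB
  set u := Dt f ι with hu
  have huc : Continuous u := continuous_Dt hf ι
  have hB0 : volume B ≠ 0 := volume_ball_ne_zero c hR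
  have hBt : volume B ≠ ⊤ := volume_ball_ne_top c R
  set G : En n → ℝ≥0∞ := fun y => K.indicator 1 (u y) * ngrad (L + 1) f y with hG
  have hGm : Measurable G :=
    ((measurable_one.indicator hK).comp huc.measurable).mul (measurable_ngrad _ hf)
  obtain ⟨S, hSm, hS, hSK⟩ : ∃ S : Set (En n), MeasurableSet S ∧ volume B / 2 ≤ volume (B ∩ S) ∧
      ∀ y ∈ S, ∃ I : Set ℝ, ENNReal.ofReal (t / 4) ≤ volume (K ∩ I) ∧ I ⊆ uIcc (u z) (u y) := by
    rcases lt_abs.1 ht with h | h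
    · refine ⟨{y | u y ≤ M + t / 2}, measurableSet_le huc.measurable measurable_const, hM.1,
        fun y hy => ⟨_, hK1, ?_⟩⟩
      rw [uIcc_comm]
      exact fun s hs => Icc_subset_uIcc ⟨le_trans hy hs.1, hs.2.trans (by linarith)⟩
    · refine ⟨{y | M - t / 2 ≤ u y}, measurableSet_le measurable_const huc.measurable, hM.2,
        fun y hy => ⟨_, hK2, ?_⟩⟩
      exact fun s hs => Icc_subset_uIcc ⟨le_trans (by linarith) hs.1, le_trans hs.2 hy⟩
  have h1 : ∀ y ∈ B ∩ S, ENNReal.ofReal (t / 4) ≤ ENNReal.ofReal (2 * R) *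
      ∫⁻ σ in Ioo (0 : ℝ) 1, ENNReal.ofReal (σ ^ 0) * G (z + σ • (y - z)) := by
    intro y hy
    obtain ⟨I, hI, hI'⟩ := hSK y hy.2
    have hd := hasDerivAt_Dt_line hf ι z (y - z)
    have hcont : Continuous fun σ : ℝ => u (z + σ • (y - z)) := huc.comp (by fun_prop)
    have hivt : uIcc (u z) (u y) ⊆ (fun σ : ℝ => u (z + σ • (y - z))) '' Icc 0 1 := by
      have := intermediate_value_uIcc (a := (0 : ℝ)) (b := 1)
        (f := fun σ : ℝ => u (z + σ • (y - z))) hcont.continuousOn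
      simpa [uIcc_of_le (zero_le_one (α := ℝ))] using this
    have hyz : ‖y - z‖ ≤ 2 * R := by
      have h1 := Metric.mem_ball.1 hy.1
      have h2 := Metric.mem_ball.1 hz
      have h3 := dist_triangle_right y z c
      rw [← dist_eq_norm]
      linarith
    calc ENNReal.ofReal (t / 4) ≤ volume (K ∩ I) := hI
      _ ≤ volume ((fun σ : ℝ => u (z + σ • (y - z))) '' Icc 0 1 ∩ K) := by
          refine measure_mono ?_
          rw [inter_comm]
          exact inter_subset_inter_left _ (hI'.trans hivt)
      _ ≤ _ := volume_image_inter_le hd hK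
      _ ≤ ∫⁻ σ in Ioo (0 : ℝ) 1, ENNReal.ofReal (2 * R) *
          (ENNReal.ofReal (σ ^ 0) * G (z + σ • (y - z))) := by
          refine lintegral_mono fun σ => ?_
          rw [pow_zero, ENNReal.ofReal_one, one_mul, hG]
          dsimp only
          rw [mul_left_comm]
          refine mul_le_mul' le_rfl ((abs_sum_mul_Dt_le f ι _ _).trans ?_)
          gcongr
      _ = _ := by
          refine lintegral_const_mul _ ?_
          have : Measurable fun σ : ℝ => G (z + σ • (y - z)) := hGm.comp (by fun_prop)
          fun_prop
  have h2 : volume B / 2 * ENNReal.ofReal (t / 4) ≤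
      ENNReal.ofReal (2 * R) * (volume B * Jop 0 c R G z) := by
    rw [← setLIntegral_lintegral_segment 0 hGm c hR z,
      ← lintegral_const_mul _ (measurable_lintegral_segment_right 0 hGm z)]
    calc volume B / 2 * ENNReal.ofReal (t / 4)
        ≤ volume (B ∩ S) * ENNReal.ofReal (t / 4) := by gcongr
      _ = ∫⁻ y in B ∩ S, ENNReal.ofReal (t / 4) := by rw [setLIntegral_const, mul_comm]
      _ ≤ ∫⁻ y in B ∩ S, ENNReal.ofReal (2 * R) *
          ∫⁻ σ in Ioo (0 : ℝ) 1, ENNReal.ofReal (σ ^ 0) * G (z + σ • (y - z)) :=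
        setLIntegral_mono' (measurableSet_ball.inter hSm) h1
      _ ≤ _ := lintegral_mono_set inter_subset_left
  have h3 : ENNReal.ofReal (t / (16 * R)) * (ENNReal.ofReal (2 * R) * volume B) =
      volume B / 2 * ENNReal.ofReal (t / 4) := by
    rw [← mul_assoc, ← ENNReal.ofReal_mul' (by positivity), mul_comm, ENNReal.div_eq_inv_mul,
      mul_comm _ (volume B), mul_assoc]
    congr 1
    rw [show (2 : ℝ≥0∞)⁻¹ = ENNReal.ofReal (1 / 2) by
      rw [ENNReal.ofReal_div_of_pos two_pos]; simp, ← ENNReal.ofReal_mul (by norm_num)]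
    congr 1
    field_simp
    ring
  rw [← mul_assoc, mul_comm _ (Jop 0 c R G z), ← h3] at h2
  refine (ENNReal.mul_le_mul_iff_left ?_ ?_).1 h2
  · exact mul_ne_zero (by simpa using hR) hB0
  · exact ENNReal.mul_ne_top ENNReal.ofReal_ne_top hBt

/-- The values at distance comparable to `T * ρ ^ i` from `M i m`, without the values close to
`M i' m'` for the balls of much larger scale meeting the given one. -/
def window (D T ρ : ℝ) (P : ℕ) (M : ℤ → (Fin n → ℤ) → ℝ) (i : ℤ) (m : Fin n → ℤ) : Set ℝ :=
  {s | T * ρ ^ i / 2 ≤ |s - M i m| ∧ |s - M i m| ≤ T * ρ ^ i} \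
    ⋃ (i' : ℤ) (m' : Fin n → ℤ) (_ : i + P ≤ i' ∧ (Metric.ball (ctr 2 i' m') (D * 2 ^ i') ∩
      Metric.ball (ctr 2 i m) (D * 2 ^ i)).Nonempty),
      Icc (M i' m' - T * ρ ^ i') (M i' m' + T * ρ ^ i')

theorem measurableSet_window (D T ρ : ℝ) (P : ℕ) (M : ℤ → (Fin n → ℤ) → ℝ) (i : ℤ)
    (m : Fin n → ℤ) : MeasurableSet (window D T ρ P M i m) := by
  refine MeasurableSet.diff ?_ (MeasurableSet.iUnion fun i' => MeasurableSet.iUnion fun m' =>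
    MeasurableSet.iUnion fun _ => measurableSet_Icc)
  have h : Measurable fun s : ℝ => |s - M i m| := by fun_prop
  exact (measurableSet_le measurable_const h).inter (measurableSet_le h measurable_const)

theorem exists_volume_window_ge (n : ℕ) (D : ℝ) {ρ : ℝ} (hρ : 0 < ρ) (hρ1 : ρ < 1) :
    ∃ P : ℕ, ∀ (M : ℤ → (Fin n → ℤ) → ℝ) (T : ℝ), 0 < T → ∀ i m,
      ENNReal.ofReal (T * ρ ^ i / 4) ≤ volume (window D T ρ P M i m ∩
        Icc (M i m + T * ρ ^ i / 2) (M i m + T * ρ ^ i)) ∧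
      ENNReal.ofReal (T * ρ ^ i / 4) ≤ volume (window D T ρ P M i m ∩
        Icc (M i m - T * ρ ^ i) (M i m - T * ρ ^ i / 2)) := by
  obtain ⟨N, hN⟩ := exists_card_ctr_le n (2 * D)
  obtain ⟨C, hC, -, h2⟩ := tsum_geometric_le_cutoff (α := 1) hρ hρ1.ne one_pos
  obtain ⟨P, hP⟩ := exists_pow_lt_of_lt_one (x := ((8 * (N * C.toReal + 1))⁻¹ : ℝ))
    (by positivity) hρ1
  refine ⟨P, fun M T hT i m => ?_⟩
  set t := T * ρ ^ i with ht
  have ht0 : 0 < t := by positivity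
  set U : Set ℝ := ⋃ (i' : ℤ) (m' : Fin n → ℤ) (_ : i + P ≤ i' ∧
      (Metric.ball (ctr 2 i' m') (D * 2 ^ i') ∩ Metric.ball (ctr 2 i m) (D * 2 ^ i)).Nonempty),
      Icc (M i' m' - T * ρ ^ i') (M i' m' + T * ρ ^ i') with hU
  have hcond : ∀ i' : ℤ, ∃ S : Finset (Fin n → ℤ), S.card ≤ N ∧ ∀ m', (i + P ≤ i' ∧
      (Metric.ball (ctr 2 i' m') (D * 2 ^ i') ∩ Metric.ball (ctr 2 i m) (D * 2 ^ i)).Nonempty) →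
      m' ∈ S := by
    intro i'
    obtain ⟨S, hS, h⟩ := hN 2 two_pos i' (ctr 2 i m)
    refine ⟨S, hS, fun m' hm' => h m' ?_⟩
    obtain ⟨h1, z, hz1, hz2⟩ := hm'
    rw [Metric.mem_ball] at hz1 hz2
    have h3 : (2 : ℝ) ^ i ≤ 2 ^ i' := zpow_le_zpow_right₀ (by norm_num) (by linarith [h1])
    have h4 := dist_triangle_left (ctr 2 i m) (ctr 2 i' m') z
    have hi' : (0 : ℝ) < 2 ^ i := by positivity
    have hD : 0 < D := by
      have := lt_of_le_of_lt dist_nonneg hz2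
      exact pos_of_mul_pos_left this hi'.le
    nlinarith
  have hvol : volume U ≤ ENNReal.ofReal (t / 4) := by
    calc volume U ≤ ∑' i' : ℤ, N * (if ENNReal.ofReal (2 * T * ρ ^ i') ≤
          ENNReal.ofReal (2 * T * ρ ^ (i + P)) then
          ENNReal.ofReal (2 * T * ρ ^ i') ^ (1 : ℝ) else 0) := by
          refine (measure_iUnion_le _).trans (ENNReal.tsum_le_tsum fun i' => ?_)
          obtain ⟨S, hS, h⟩ := hcond i'
          by_cases hi : i + P ≤ i'
          · have h1 : ENNReal.ofReal (2 * T * ρ ^ i') ≤ ENNReal.ofReal (2 * T * ρ ^ (i + P)) := by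
              refine ENNReal.ofReal_le_ofReal ?_
              gcongr ?_ * ?_
              exact zpow_le_zpow_right_of_le_one₀ hρ hρ1.le hi
            rw [if_pos h1, ENNReal.rpow_one]
            refine (measure_mono (t := ⋃ m' ∈ S,
              Icc (M i' m' - T * ρ ^ i') (M i' m' + T * ρ ^ i')) ?_).trans ?_
            · exact iUnion_mono fun m' => iUnion_mono' fun h' => ⟨h m' h', subset_rfl⟩
            · refine (measure_biUnion_finset_le _ _).trans ?_
              simp only [Real.volume_Icc]
              refine (Finset.sum_le_card_nsmul _ _ (ENNReal.ofReal (2 * T * ρ ^ i'))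
                fun m' _ => le_of_eq (by congr 1; ring)).trans ?_
              rw [nsmul_eq_mul]
              gcongr
          · simp [hi]
      _ ≤ N * (C * ENNReal.ofReal (2 * T * ρ ^ (i + P)) ^ (1 : ℝ)) := by
          rw [ENNReal.tsum_mul_left]
          gcongr
          exact h2 _ _ (by positivity)
      _ = ENNReal.ofReal (N * C.toReal * (2 * T * ρ ^ (i + P))) := by
          rw [ENNReal.rpow_one, ← mul_assoc, ENNReal.ofReal_mul (p := N * C.toReal) (by positivity),
            ENNReal.ofReal_mul (p := (N : ℝ)) (by positivity), ENNReal.ofReal_toReal hC, ENNReal.ofReal_natCast]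
      _ ≤ _ := by
          refine ENNReal.ofReal_le_ofReal ?_
          rw [zpow_add₀ hρ.ne', zpow_natCast]
          have h3 : (N * C.toReal + 1) * (8 * ρ ^ P) ≤ 1 := by
            rw [← one_div, lt_div_iff₀ (by positivity)] at hP
            linarith
          have h4 : (0 : ℝ) ≤ 8 * ρ ^ P := by positivity
          have h5 : N * C.toReal * (8 * ρ ^ P) ≤ 1 := by linarith
          calc _ = t / 4 * (N * C.toReal * (8 * ρ ^ P)) := by rw [ht]; ring
            _ ≤ t / 4 * 1 := by gcongr
            _ = _ := mul_one _
  have key : ∀ I : Set ℝ, volume I = ENNReal.ofReal (t / 2) →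
      (∀ s ∈ I, t / 2 ≤ |s - M i m| ∧ |s - M i m| ≤ t) →
      ENNReal.ofReal (t / 4) ≤ volume (window D T ρ P M i m ∩ I) := by
    intro I hI hsub
    have h1 : volume I ≤ volume (window D T ρ P M i m ∩ I) + volume U := by
      refine (measure_mono fun s hs => ?_).trans (measure_union_le _ _)
      by_cases h : s ∈ U
      · exact Or.inr h
      · exact Or.inl ⟨⟨hsub s hs, h⟩, hs⟩
    rw [hI, show t / 2 = t / 4 + t / 4 by ring, ENNReal.ofReal_add (by positivity)
      (by positivity)] at h1
    have h2 := h1.trans (add_le_add le_rfl hvol)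
    exact (ENNReal.add_le_add_iff_right ENNReal.ofReal_ne_top).1 h2
  constructor
  · refine key _ (by rw [Real.volume_Icc]; congr 1; ring) fun s hs => ?_
    rw [abs_of_nonneg (by linarith [hs.1])]
    exact ⟨by linarith [hs.1], by linarith [hs.2]⟩
  · refine key _ (by rw [Real.volume_Icc]; congr 1; ring) fun s hs => ?_
    rw [abs_of_nonpos (by linarith [hs.2])]
    exact ⟨by linarith [hs.2], by linarith [hs.1]⟩

theorem exists_tsum_window_le (n : ℕ) (D : ℝ) (P : ℕ) : ∃ N : ℝ≥0∞, N ≠ ⊤ ∧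
    ∀ (M : ℤ → (Fin n → ℤ) → ℝ) (T ρ s : ℝ) (y : En n),
      ∑' i : ℤ, ∑' m, (Metric.ball (ctr 2 i m) (D * 2 ^ i)).indicator
        (fun _ => (window D T ρ P M i m).indicator (1 : ℝ → ℝ≥0∞) s) y ≤ N := by
  obtain ⟨N, hN, h1⟩ := exists_tsum_indicator_le n D
  refine ⟨(2 * P) * N, by finiteness, fun M T ρ s y => ?_⟩
  set S : ℤ → Prop := fun i => ∃ m, y ∈ Metric.ball (ctr 2 i m) (D * 2 ^ i) ∧
    s ∈ window D T ρ P M i m with hS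
  have hsep : ∀ i i', S i → S i' → i' < i + P := by
    rintro i i' ⟨m, hy, hs⟩ ⟨m', hy', hs'⟩
    by_contra! h
    refine hs.2 (mem_iUnion.2 ⟨i', mem_iUnion.2 ⟨m', mem_iUnion.2 ⟨⟨h, ⟨y, hy', hy⟩⟩, ?_⟩⟩⟩)
    have := abs_le.1 hs'.1.2
    exact ⟨by linarith [this.1], by linarith [this.2]⟩
  have hzero : ∀ i, ¬ S i → ∑' m, (Metric.ball (ctr 2 i m) (D * 2 ^ i)).indicator
      (fun _ => (window D T ρ P M i m).indicator (1 : ℝ → ℝ≥0∞) s) y = 0 := by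
    intro i hi
    rw [ENNReal.tsum_eq_zero]
    intro m
    by_contra h
    rw [indicator_apply_eq_zero, Classical.not_imp, indicator_apply_eq_zero,
      Classical.not_imp] at h
    exact hi ⟨m, h.1, h.2.1⟩
  have hone : ∀ i : ℤ, ∑' m, (Metric.ball (ctr 2 i m) (D * 2 ^ i)).indicator
      (fun _ => (window D T ρ P M i m).indicator (1 : ℝ → ℝ≥0∞) s) y ≤ N := by
    intro i
    refine le_trans (ENNReal.tsum_le_tsum fun m => ?_) ((h1 2 two_pos i 1 y).trans_eq (by simp))
    exact indicator_le_indicator (indicator_le_self' (fun _ _ => zero_le) s)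
  by_cases hex : ∃ i, S i
  · obtain ⟨i₀, hi₀⟩ := hex
    rw [tsum_eq_sum (s := Finset.Ico (i₀ - P) (i₀ + P)) fun i hi => hzero i fun hSi => hi ?_]
    · refine (Finset.sum_le_card_nsmul _ _ N fun i _ => hone i).trans ?_
      rw [nsmul_eq_mul, Int.card_Ico, show i₀ + P - (i₀ - P) = ((2 * P : ℕ) : ℤ) by push_cast; ring,
        Int.toNat_natCast]
      push_cast
      exact le_rfl
    · rw [Finset.mem_Ico]
      exact ⟨by linarith [hsep i i₀ hSi hi₀], hsep i₀ i hi₀ hSi⟩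
  · push Not at hex
    simp [hzero _ (hex _)]

theorem exists_tsum_lintegral_window_le (n : ℕ) (D : ℝ) (P : ℕ) : ∃ N : ℝ≥0∞, N ≠ ⊤ ∧
    ∀ (M : ℤ → (Fin n → ℤ) → ℝ) (T ρ : ℝ) (μ : Measure (En n)) (u : En n → ℝ) (F : En n → ℝ≥0∞),
      Measurable u → Measurable F →
      ∑' i : ℤ, ∑' m, ∫⁻ y in Metric.ball (ctr 2 i m) (D * 2 ^ i),
        (window D T ρ P M i m).indicator 1 (u y) * F y ∂μ ≤ N * ∫⁻ y, F y ∂μ := by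
  obtain ⟨N, hN, h1⟩ := exists_tsum_window_le n D P
  refine ⟨N, hN, fun M T ρ μ u F hu hF => ?_⟩
  have hm : ∀ i m, Measurable fun y => (Metric.ball (ctr 2 i m) (D * 2 ^ i)).indicator
      (fun y => (window D T ρ P M i m).indicator (1 : ℝ → ℝ≥0∞) (u y) * F y) y := fun i m =>
    (((measurable_one.indicator (measurableSet_window D T ρ P M i m)).comp hu).mul hF).indicator
      measurableSet_ball
  simp only [← lintegral_indicator measurableSet_ball]
  simp only [← lintegral_tsum fun m => (hm _ m).aemeasurable]
  rw [← lintegral_tsum fun i => (Measurable.tsum fun m => hm i m).aemeasurable,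
    ← lintegral_const_mul _ hF]
  refine lintegral_mono fun y => ?_
  refine le_trans (le_of_eq ?_) (mul_le_mul' (h1 M T ρ (u y) y) le_rfl)
  rw [← ENNReal.tsum_mul_right]
  refine tsum_congr fun i => ?_
  rw [← ENNReal.tsum_mul_right]
  refine tsum_congr fun m => ?_
  by_cases hy : y ∈ Metric.ball (ctr 2 i m) (D * 2 ^ i) <;> simp [hy]

theorem Jord_le_of_le_tsum (L : ℕ) {c : En n} {R : ℝ} (hR : 0 < R) {J : Type*} [Countable J]
    {F : En n → ℝ≥0∞} (a₀ : ℝ≥0∞) (a : J → ℝ≥0∞) {Γ : J → En n → ℝ≥0∞}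
    (hΓ : ∀ j, Measurable (Γ j))
    (hF : ∀ y ∈ Metric.ball c R, F y ≤ a₀ + ∑' j, a j * Γ j y) {z : En n}
    (hz : z ∈ Metric.ball c R) :
    Jord L c R F z ≤ a₀ + ∑' j, a j * Jord L c R (Γ j) z := by
  cases L with
  | zero => exact hF z hz
  | succ d =>
    simp only [Jord, Jop]
    set B := Metric.ball c R with hB
    have hB0 : volume B ≠ 0 := volume_ball_ne_zero c hR
    have hBt : volume B ≠ ⊤ := volume_ball_ne_top c R
    have hm1 : ∀ j (σ : ℝ), Measurable fun y => Γ j (z + σ • (y - z)) := fun j σ =>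
      (hΓ j).comp (by fun_prop)
    have hm2 : ∀ j, Measurable fun σ : ℝ => ∫⁻ y in B, Γ j (z + σ • (y - z)) := fun j =>
      (measurable_lintegral_segment (hΓ j) B).comp (measurable_id.prodMk measurable_const)
    have hm3 : ∀ j, Measurable fun σ : ℝ => ENNReal.ofReal (σ ^ d) *
        ((volume B)⁻¹ * ∫⁻ y in B, Γ j (z + σ • (y - z))) := fun j =>
      Measurable.mul (by fun_prop) ((hm2 j).const_mul _)
    calc ∫⁻ σ in Ioo (0 : ℝ) 1, ENNReal.ofReal (σ ^ d) *
          ((volume B)⁻¹ * ∫⁻ y in B, F (z + σ • (y - z)))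
        ≤ ∫⁻ σ in Ioo (0 : ℝ) 1, (a₀ + ∑' j, a j * (ENNReal.ofReal (σ ^ d) *
          ((volume B)⁻¹ * ∫⁻ y in B, Γ j (z + σ • (y - z))))) := by
          refine setLIntegral_mono' measurableSet_Ioo fun σ hσ => ?_
          have h1 : ∫⁻ y in B, F (z + σ • (y - z)) ≤
              a₀ * volume B + ∑' j, a j * ∫⁻ y in B, Γ j (z + σ • (y - z)) := by
            calc ∫⁻ y in B, F (z + σ • (y - z))
                ≤ ∫⁻ y in B, (a₀ + ∑' j, a j * Γ j (z + σ • (y - z))) :=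
                  setLIntegral_mono' measurableSet_ball fun y hy =>
                    hF _ (segment_mem_ball hσ hz hy)
              _ = _ := by
                  rw [lintegral_add_left measurable_const, setLIntegral_const,
                    lintegral_tsum fun j => ((hm1 j σ).const_mul _).aemeasurable]
                  congr 1
                  exact tsum_congr fun j => lintegral_const_mul _ (hm1 j σ)
          have h2 : ENNReal.ofReal (σ ^ d) ≤ 1 :=
            ENNReal.ofReal_le_one.2 (pow_le_one₀ hσ.1.le hσ.2.le)
          calc _ ≤ ENNReal.ofReal (σ ^ d) * ((volume B)⁻¹ * (a₀ * volume B +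
                ∑' j, a j * ∫⁻ y in B, Γ j (z + σ • (y - z)))) := by gcongr
            _ = ENNReal.ofReal (σ ^ d) * a₀ + ∑' j, a j * (ENNReal.ofReal (σ ^ d) *
                  ((volume B)⁻¹ * ∫⁻ y in B, Γ j (z + σ • (y - z)))) := by
                rw [mul_add, mul_add, mul_comm a₀, ← mul_assoc (volume B)⁻¹,
                  ENNReal.inv_mul_cancel hB0 hBt, one_mul, ← ENNReal.tsum_mul_left,
                  ← ENNReal.tsum_mul_left]
                congr 1
                exact tsum_congr fun j => by ring
            _ ≤ _ := by
                gcongr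
                exact mul_le_of_le_one_left zero_le h2
      _ = _ := by
          rw [lintegral_add_left measurable_const, setLIntegral_const,
            lintegral_tsum fun j => ((hm3 j).const_mul _).aemeasurable, Real.volume_Ioo]
          simp only [sub_zero, ENNReal.ofReal_one, mul_one]
          congr 1
          exact tsum_congr fun j => lintegral_const_mul _ (hm3 j)

theorem le_mul_of_le_rpow_add {K Y P : ℝ≥0∞} {r r' : ℝ} (hr : 1 ≤ r) (hr' : 1 ≤ r') (h2 : P ≤ 2)
    (hP : P ≤ K * (Y ^ r + Y ^ r')) : P ≤ (2 * K + 2) * Y := by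
  rcases le_total 1 Y with h | h
  · calc P ≤ 2 * 1 := by simpa using h2
      _ ≤ _ := by
        gcongr
        exact le_add_self
  · calc P ≤ K * (Y ^ r + Y ^ r') := hP
      _ ≤ K * (Y + Y) := by
        gcongr <;> exact ENNReal.rpow_le_self_of_le_one h ‹_›
      _ = 2 * K * Y := by ring
      _ ≤ _ := by
        gcongr
        exact le_self_add

theorem exists_exponent_between {q' L : ℝ} (hn : 0 < n) (hL : 0 < L) (hq' : 1 < q')
    (h : (n : ℝ) * (1 / 1 - 1 / q') < L + 1) :
    ∃ s : ℝ, 1 < s ∧ s < q' ∧ (n : ℝ) * (1 / s - 1 / q') < L ∧ (n : ℝ) * (1 / 1 - 1 / s) < 1 := by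
  have hn' : (0 : ℝ) < n := by exact_mod_cast hn
  have hq0 : 0 < 1 / q' := by positivity
  have hq1 : 1 / q' < 1 := by rw [div_lt_one (by linarith)]; exact hq'
  have hn1 : 0 < 1 / (n : ℝ) := by positivity
  have hLn : 0 < L / n := by positivity
  obtain ⟨β, h1, h2⟩ := exists_between (a₁ := max (1 - 1 / (n : ℝ)) (1 / q'))
    (a₂ := min 1 (1 / q' + L / n)) (by
      rw [max_lt_iff, lt_min_iff, lt_min_iff]
      refine ⟨⟨by linarith, ?_⟩, hq1, by linarith⟩
      have : 1 / 1 - 1 / q' < (L + 1) / n := by rw [lt_div_iff₀ hn']; linarith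
      rw [add_div] at this
      linarith)
  rw [max_lt_iff] at h1
  rw [lt_min_iff] at h2
  have hβ : 0 < β := hq0.trans h1.2
  refine ⟨1 / β, by rw [one_lt_div hβ]; exact h2.1, (div_lt_comm₀ (by linarith) hβ).1 h1.2, ?_, ?_⟩
  · rw [one_div_one_div, mul_comm, ← lt_div_iff₀ hn']; linarith
  · rw [one_div_one_div, mul_comm, ← lt_div_iff₀ hn']; linarith

theorem exists_PhiS_Jord_indicator_le (hn : 0 < n) (L : ℕ) {q' : ℝ} (hq' : 1 < q')
    (hq : (n : ℝ) * (1 / 1 - 1 / q') < L + 1) {A : ℝ≥0∞} (hA : A ≠ ⊤) :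
    ∃ σ : ℝ, 0 < σ ∧ σ < 1 ∧ ∃ C : ℝ≥0∞, C ≠ ⊤ ∧ ∀ w : En n → ℝ≥0∞, A1W A w → ∀ c R, 0 < R →
      ∀ G : En n → ℝ≥0∞, Measurable G → ∀ τ κ : ℝ, 0 < τ → 0 < κ →
      PhiS w (1 / q') (Metric.ball c R) {x | x ∈ Metric.ball c R ∧ ENNReal.ofReal κ <
        Jord L c R ({z | z ∈ Metric.ball c R ∧ ENNReal.ofReal τ < Jop 0 c R G z}.indicator 1) x} ≤
      C * (wm w (Metric.ball c R) * (ENNReal.ofReal κ ^ (-σ) *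
        ((∫⁻ x in Metric.ball c R, G x ∂(wm w)) / wm w (Metric.ball c R) /
          ENNReal.ofReal τ))) := by
  have hq0 : 0 < q' := by linarith
  cases L with
  | zero =>
    obtain ⟨K, hK, h⟩ := exists_PhiS_Jop_le (n := n) 0 (s := 1) (t := q') (θ := 1 / q') le_rfl
      (by positivity) (by rw [div_le_one hq0]; exact hq'.le)
      (by rw [mul_one_div_cancel hq0.ne']) (by exact_mod_cast hq) hA
    refine ⟨1 / 2, by norm_num, by norm_num, K, hK, fun w hw c R hR G hG τ κ hτ hκ => ?_⟩
    simp only [Jord]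
    rcases le_or_gt 1 κ with h1 | h1
    · have : {x | x ∈ Metric.ball c R ∧ ENNReal.ofReal κ < ({z | z ∈ Metric.ball c R ∧
          ENNReal.ofReal τ < Jop 0 c R G z}.indicator 1 : En n → ℝ≥0∞) x} = ∅ := by
        rw [eq_empty_iff_forall_notMem]
        rintro x ⟨-, hx⟩
        refine absurd hx (not_lt.2 ((indicator_le_self' (fun _ _ => zero_le) x).trans ?_))
        simpa using h1
      rw [this, PhiS]
      simp [hq0]
    · have h2 := h w hw c R hR G hG τ hτ
      simp only [ENNReal.rpow_one, mul_one_div_cancel hq0.ne', div_one] at h2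
      refine (PhiS_mono w (by positivity) _ fun x hx => ?_).trans (h2.trans ?_)
      · by_contra hcon
        rw [mem_ofPred_eq, indicator_of_notMem hcon] at hx
        simp at hx
      · rw [mul_assoc]
        gcongr
        refine le_mul_of_one_le_left zero_le ?_
        refine ENNReal.one_le_rpow_of_pos_of_le_one_of_neg ?_ ?_ (by norm_num)
        · simpa using hκ
        · simpa using h1.le
  | succ d =>
    obtain ⟨s, hs1, hsq, hsn, hs'⟩ := exists_exponent_between hn (L := ((d + 1 : ℕ) : ℝ))
      (by positivity) hq' hq
    obtain ⟨r, hsr, hrn⟩ := exists_exponent_gt (by linarith) hs'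
    have hs0 : 0 < s := by linarith
    have hr0 : 0 < r := by linarith
    obtain ⟨K1, hK1, h1⟩ := exists_measure_lt_Jop_le (n := n) 0 (s := 1) (r := r) le_rfl
      (by linarith) (by simpa using hrn) hA
    obtain ⟨K2, hK2, h2⟩ := exists_measure_lt_Jop_le (n := n) 0 (s := 1) (r := r) le_rfl
      (by linarith) (by simpa using hrn) (A := 1) (by simp)
    obtain ⟨K3, hK3, h3⟩ := exists_measure_lt_Jop_le (n := n) d (s := s) (r := s) hs1.le
      le_rfl (by simp; positivity) hA
    obtain ⟨K4, hK4, h4⟩ := exists_measure_lt_Jop_le (n := n) d (s := s) (r := q') hs1.le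
      hsq.le (by exact_mod_cast hsn) (A := 1) (by simp)
    set θ := 1 / q' with hθ
    have hθ0 : 0 < θ := by positivity
    set K := K3 * K1 + K4 ^ θ * (K2 * A ^ r) ^ (1 / s) with hKdef
    have hKt : K ≠ ⊤ := by
      have e1 := ENNReal.rpow_ne_top_of_nonneg hθ0.le hK4
      have e2 := ENNReal.rpow_ne_top_of_nonneg hr0.le hA
      have e3 := ENNReal.rpow_ne_top_of_nonneg (x := K2 * A ^ r) (y := 1 / s) (by positivity)
        (by finiteness)
      finiteness
    refine ⟨s / r, by positivity, by rwa [div_lt_one hr0], 2 * K + 2, by finiteness,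
      fun w hw c R hR G hG τ κ hτ hκ => ?_⟩
    set B := Metric.ball c R with hB
    set E := {z | z ∈ B ∧ ENNReal.ofReal τ < Jop 0 c R G z} with hE
    have hEm : MeasurableSet E := measurableSet_ball.inter
      (measurableSet_lt measurable_const (measurable_Jop 0 c R hG))
    have hEB : E ⊆ B := fun z hz => hz.1
    have hχ : Measurable (E.indicator 1 : En n → ℝ≥0∞) := measurable_one.indicator hEm
    simp only [Jord]
    set D := {x | x ∈ B ∧ ENNReal.ofReal κ < Jop d c R (E.indicator 1) x} with hD
    have hm0 : wm w B ≠ 0 := hw.pos c R hR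
    have hmt : wm w B ≠ ⊤ := hw.fin c R
    have hV0 : volume B ≠ 0 := volume_ball_ne_zero c hR
    have hVt : volume B ≠ ⊤ := volume_ball_ne_top c R
    have hone : wm (fun _ : En n => (1 : ℝ≥0∞)) = volume := by simp [wm]
    set X := (∫⁻ x in B, G x ∂(wm w)) / wm w B / ENNReal.ofReal τ with hX
    set e := ENNReal.ofReal κ with he
    have he0 : e ≠ 0 := by simpa [he] using hκ
    have het : e ≠ ⊤ := ENNReal.ofReal_ne_top
    have h_int : ∀ μ : Measure (En n), ∫⁻ x in B, (E.indicator 1 x : ℝ≥0∞) ^ s ∂μ = μ E := by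
      intro μ
      have : ∀ x, (E.indicator 1 x : ℝ≥0∞) ^ s = E.indicator 1 x := by
        intro x
        by_cases hx : x ∈ E <;> simp [hx, hs0]
      simp only [this]
      rw [lintegral_indicator_one hEm, Measure.restrict_apply hEm, inter_eq_left.2 hEB]
    have g1 : wm w E / wm w B ≤ K1 * X ^ r := by
      have := h1 w hw c R hR G hG τ hτ
      simp only [ENNReal.rpow_one, div_one] at this
      rw [ENNReal.div_le_iff hm0 hmt, mul_right_comm]
      exact this
    have g2 : volume E / volume B ≤ K2 * A ^ r * X ^ r := by
      have := h2 _ A1W_one c R hR G hG τ hτ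
      simp only [ENNReal.rpow_one, div_one, hone] at this
      rw [mul_assoc K2, ← ENNReal.mul_rpow_of_nonneg _ _ hr0.le, ENNReal.div_le_iff hV0 hVt,
        mul_right_comm]
      refine this.trans ?_
      gcongr
      rw [hX, ← mul_div_assoc]
      gcongr
      exact hw.average_le hG c hR
    set Y := e ^ (-(s / r)) * X with hY
    have g3 : wm w D / wm w B ≤ K3 * K1 * Y ^ r := by
      have := h3 w hw c R hR _ hχ κ hκ
      rw [h_int, div_self hs0.ne', ENNReal.rpow_one] at this
      rw [ENNReal.div_le_iff hm0 hmt, mul_right_comm, mul_assoc]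
      refine this.trans ?_
      rw [mul_assoc, mul_assoc, mul_comm (wm w B)]
      gcongr K3 * ?_
      rw [mul_left_comm, mul_comm]
      gcongr wm w B * ?_
      rw [hY, ENNReal.mul_rpow_of_nonneg _ _ hr0.le, ← ENNReal.rpow_mul,
        show -(s / r) * r = -s by field_simp, ENNReal.rpow_neg, div_eq_mul_inv, mul_comm (e ^ s)⁻¹,
        ← mul_assoc]
      gcongr
    have g4 : (volume D / volume B) ^ θ ≤ K4 ^ θ * (K2 * A ^ r) ^ (1 / s) * Y ^ (r / s) := by
      have := h4 _ A1W_one c R hR _ hχ κ hκ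
      rw [hone, h_int] at this
      have h7 : volume D / volume B ≤ K4 * (K2 * A ^ r * X ^ r / e ^ s) ^ (q' / s) := by
        rw [ENNReal.div_le_iff hV0 hVt, mul_right_comm]
        refine this.trans ?_
        gcongr
      refine (ENNReal.rpow_le_rpow h7 hθ0.le).trans (le_of_eq ?_)
      rw [ENNReal.mul_rpow_of_nonneg _ _ hθ0.le, ← ENNReal.rpow_mul,
        show q' / s * θ = 1 / s by rw [hθ]; field_simp, mul_div_assoc,
        ENNReal.mul_rpow_of_nonneg _ _ (by positivity), ← mul_assoc]
      congr 1
      rw [ENNReal.div_rpow_of_nonneg _ _ (by positivity), ← ENNReal.rpow_mul, ← ENNReal.rpow_mul,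
        hY, ENNReal.mul_rpow_of_nonneg _ _ (by positivity), ← ENNReal.rpow_mul,
        show -(s / r) * (r / s) = -1 by field_simp, mul_one_div_cancel hs0.ne', ENNReal.rpow_one,
        ENNReal.rpow_neg_one, mul_one_div, div_eq_mul_inv, mul_comm]
    have hP2 : PhiS w θ B D / wm w B ≤ 2 :=
      ENNReal.div_le_of_le_mul (PhiS_le_two_mul w hθ0.le fun x hx => hx.1)
    have hP : PhiS w θ B D / wm w B ≤ K * (Y ^ r + Y ^ (r / s)) := by
      rw [PhiS, ENNReal.add_div, mul_comm (wm w B), ENNReal.mul_div_cancel_right hm0 hmt]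
      refine (add_le_add g3 g4).trans ?_
      rw [mul_add]
      gcongr
      · exact le_self_add
      · exact le_add_self
    have h5 := le_mul_of_le_rpow_add (by linarith) ((one_le_div hs0).2 hsr.le) hP2 hP
    rw [ENNReal.div_le_iff hm0 hmt, mul_assoc, mul_comm Y] at h5
    exact h5

theorem ofReal_le_tsum_dyadic {τ : ℝ} (hτ : 0 < τ) (v : ℝ) :
    ENNReal.ofReal v ≤ ENNReal.ofReal τ + ∑' ν : ℕ, ENNReal.ofReal (2 ^ (ν + 1) * τ) *
      (if 2 ^ ν * τ < v then 1 else 0) := by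
  rcases le_or_gt v τ with h | h
  · exact (ENNReal.ofReal_le_ofReal h).trans le_self_add
  · have hex : ∃ ν : ℕ, v ≤ 2 ^ (ν + 1) * τ := by
      obtain ⟨ν, hν⟩ := pow_unbounded_of_one_lt (v / τ) (one_lt_two (α := ℝ))
      refine ⟨ν, ((div_le_iff₀ hτ).1 hν.le).trans ?_⟩
      gcongr
      · exact one_le_two
      · omega
    obtain ⟨ν, h1, h2⟩ : ∃ ν : ℕ, v ≤ 2 ^ (ν + 1) * τ ∧ 2 ^ ν * τ < v := by
      refine ⟨Nat.find hex, Nat.find_spec hex, ?_⟩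
      rcases Nat.eq_zero_or_pos (Nat.find hex) with h0 | h0
      · rw [h0]; simpa using h
      · have := Nat.find_min hex (Nat.sub_lt h0 one_pos)
        rwa [not_le, show Nat.find hex - 1 + 1 = Nat.find hex from Nat.sub_add_cancel h0] at this
    refine le_trans ?_ (le_trans (ENNReal.le_tsum ν) le_add_self)
    rw [if_pos h2, mul_one]
    exact ENNReal.ofReal_le_ofReal h1

theorem exists_badSet_subset_iUnion (n L : ℕ) {x : ℝ} (hx : 0 < x) (hx1 : x < 1)
    {f : En n → ℝ} {M : (Fin L → Fin n) → ℝ} {c : En n} {R τ : ℝ} (hR : 0 < R)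
    (hτ : 0 < τ) {E : (Fin L → Fin n) → ℕ → Set (En n)} (hE : ∀ ι ν, MeasurableSet (E ι ν))
    (hsub : ∀ ι ν, ∀ z ∈ Metric.ball c R, 2 ^ ν * τ < |Dt f ι z - M ι| → z ∈ E ι ν) :
    badSet L f M c R (2 * Fintype.card (Fin L → Fin n) * τ) ⊆
      ⋃ j : (Fin L → Fin n) × ℕ, {z | z ∈ Metric.ball c R ∧
        ENNReal.ofReal ((1 - x) / 2 * (x / 2) ^ j.2) < Jord L c R ((E j.1 j.2).indicator 1) z} := by
  rintro z ⟨hz, hlt⟩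
  by_contra hcon
  simp only [mem_iUnion, mem_ofPred_eq, not_exists, not_and, not_lt] at hcon
  refine absurd hlt (not_lt.2 ?_)
  set N := Fintype.card (Fin L → Fin n) with hN
  have h1 := Jord_le_of_le_tsum L hR (F := oscG f M) (N * ENNReal.ofReal τ)
    (fun j : (Fin L → Fin n) × ℕ => ENNReal.ofReal (2 ^ (j.2 + 1) * τ))
    (Γ := fun j => (E j.1 j.2).indicator 1) (fun j => measurable_one.indicator (hE _ _))
    (fun y hy => by
      rw [ENNReal.tsum_prod (f := fun ι ν => ENNReal.ofReal (2 ^ (ν + 1) * τ) *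
        (E ι ν).indicator 1 y), tsum_fintype, oscG]
      calc ∑ ι, ENNReal.ofReal |Dt f ι y - M ι|
          ≤ ∑ ι : Fin L → Fin n, (ENNReal.ofReal τ + ∑' ν : ℕ, ENNReal.ofReal (2 ^ (ν + 1) * τ) *
            (E ι ν).indicator 1 y) := by
            refine Finset.sum_le_sum fun ι _ =>
              (ofReal_le_tsum_dyadic hτ _).trans ?_
            gcongr with ν
            split_ifs with h
            · rw [indicator_of_mem (hsub ι ν y hy h), Pi.one_apply]
            · exact zero_le
        _ = _ := by
            rw [Finset.sum_add_distrib, Finset.sum_const, nsmul_eq_mul, Finset.card_univ]) hz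
  refine h1.trans ?_
  calc _ ≤ N * ENNReal.ofReal τ + ∑' j : (Fin L → Fin n) × ℕ,
        ENNReal.ofReal (2 ^ (j.2 + 1) * τ) * ENNReal.ofReal ((1 - x) / 2 * (x / 2) ^ j.2) := by
        gcongr with j
        exact hcon j hz
    _ = N * ENNReal.ofReal τ + N * ∑' ν : ℕ, ENNReal.ofReal (τ * (1 - x) * x ^ ν) := by
        rw [ENNReal.tsum_prod (f := fun (_ : Fin L → Fin n) (ν : ℕ) =>
          ENNReal.ofReal (2 ^ (ν + 1) * τ) * ENNReal.ofReal ((1 - x) / 2 * (x / 2) ^ ν)),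
          tsum_fintype, Finset.sum_const, nsmul_eq_mul, Finset.card_univ]
        congr 2
        refine tsum_congr fun ν => ?_
        rw [← ENNReal.ofReal_mul (by positivity)]
        congr 1
        rw [div_pow]
        field_simp
        ring
    _ = N * ENNReal.ofReal τ + N * ENNReal.ofReal τ := by
        have h3 : HasSum (fun ν : ℕ => τ * (1 - x) * x ^ ν) τ := by
          have := (hasSum_geometric_of_lt_one hx.le hx1).mul_left (τ * (1 - x))
          rwa [mul_assoc τ, mul_inv_cancel₀ (by linarith), mul_one] at this
        have h4 : 0 < 1 - x := by linarith
        rw [← ENNReal.ofReal_tsum_of_nonneg (fun ν => by positivity) h3.summable, h3.tsum_eq]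
    _ = _ := by
        rw [← ENNReal.ofReal_natCast, ← ENNReal.ofReal_mul (by positivity),
          ← ENNReal.ofReal_add (by positivity) (by positivity)]
        congr 1
        ring

theorem exists_PhiS_badSet_le_levels (hn : 0 < n) (L : ℕ) {q' : ℝ} (hq' : 1 < q')
    (hq : (n : ℝ) * (1 / 1 - 1 / q') < L + 1) {A : ℝ≥0∞} (hA : A ≠ ⊤) :
    ∃ C : ℝ≥0∞, C ≠ ⊤ ∧ ∃ g : ℝ≥0∞, g < 1 ∧ ∀ w : En n → ℝ≥0∞, A1W A w →
      ∀ (f : En n → ℝ) (M : (Fin L → Fin n) → ℝ) (c : En n) (R τ : ℝ), 0 < R → 0 < τ →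
      ∀ G : (Fin L → Fin n) → ℕ → En n → ℝ≥0∞, (∀ ι ν, Measurable (G ι ν)) →
      (∀ ι ν, ∀ z ∈ Metric.ball c R, 2 ^ ν * τ < |Dt f ι z - M ι| →
        ENNReal.ofReal (2 ^ ν * τ / (32 * R)) < Jop 0 c R (G ι ν) z) →
      PhiS w (1 / q') (Metric.ball c R)
          (badSet L f M c R (2 * Fintype.card (Fin L → Fin n) * τ)) ≤
        C * (ENNReal.ofReal (R / τ) * ∑' ι, ∑' ν : ℕ,
          g ^ ν * ∫⁻ x in Metric.ball c R, G ι ν x ∂(wm w)) := by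
  obtain ⟨σ, hσ0, hσ1, C, hC, h⟩ := exists_PhiS_Jord_indicator_le hn L hq' hq hA
  have hq0 : 0 < q' := by linarith
  set x : ℝ := 2 ^ (σ - 1) with hx
  have hx0 : 0 < x := by positivity
  have hx1 : x < 1 := Real.rpow_lt_one_of_one_lt_of_neg (by norm_num) (by linarith)
  have hx1' : 0 < 1 - x := by linarith
  set g : ℝ := (x / 2) ^ (-σ) / 2 with hg
  have hg0 : 0 < g := by positivity
  have hg1 : g < 1 := by
    rw [hg, div_lt_one two_pos, hx, ← Real.rpow_sub_one two_ne_zero, ← Real.rpow_mul two_pos.le]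
    calc (2 : ℝ) ^ ((σ - 1 - 1) * -σ) < 2 ^ (1 : ℝ) :=
          Real.rpow_lt_rpow_of_exponent_lt one_lt_two (by nlinarith [sq_pos_of_pos (sub_pos.2 hσ1)])
      _ = 2 := Real.rpow_one 2
  set a : ℝ := ((1 - x) / 2) ^ (-σ) with ha
  refine ⟨C * ENNReal.ofReal (32 * a), by finiteness, ENNReal.ofReal g, by simpa using hg1,
    fun w hw f M c R τ hR hτ G hG hJ => ?_⟩
  set B := Metric.ball c R with hB
  have hm0 : wm w B ≠ 0 := hw.pos c R hR
  have hmt : wm w B ≠ ⊤ := hw.fin c R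
  set E : (Fin L → Fin n) → ℕ → Set (En n) := fun ι ν =>
    {z | z ∈ B ∧ ENNReal.ofReal (2 ^ ν * τ / (32 * R)) < Jop 0 c R (G ι ν) z} with hE
  have hEm : ∀ ι ν, MeasurableSet (E ι ν) := fun ι ν => measurableSet_ball.inter
    (measurableSet_lt measurable_const (measurable_Jop 0 c R (hG ι ν)))
  have h1 := exists_badSet_subset_iUnion n L hx0 hx1 (M := M) hR hτ hEm
    (fun ι ν z hz h => ⟨hz, hJ ι ν z hz h⟩)
  refine (PhiS_mono w (by positivity) B h1).trans ((PhiS_iUnion_le w (by positivity)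
    (by rw [div_le_one hq0]; exact hq'.le) B _).trans ?_)
  rw [ENNReal.tsum_prod (f := fun ι ν => PhiS w (1 / q') B {z | z ∈ Metric.ball c R ∧
    ENNReal.ofReal ((1 - x) / 2 * (x / 2) ^ ν) < Jord L c R ((E ι ν).indicator 1) z})]
  simp only [← ENNReal.tsum_mul_left]
  gcongr with ι ν
  refine (h w hw c R hR (G ι ν) (hG ι ν) (2 ^ ν * τ / (32 * R)) ((1 - x) / 2 * (x / 2) ^ ν)
    (by positivity) (by positivity)).trans (le_of_eq ?_)
  set I := ∫⁻ y in B, G ι ν y ∂(wm w) with hI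
  have h2 : ENNReal.ofReal ((1 - x) / 2 * (x / 2) ^ ν) ^ (-σ) *
      (ENNReal.ofReal (2 ^ ν * τ / (32 * R)))⁻¹ =
      ENNReal.ofReal (32 * a) * ENNReal.ofReal (R / τ) * ENNReal.ofReal g ^ ν := by
    rw [ENNReal.ofReal_rpow_of_pos (by positivity), ← ENNReal.ofReal_inv_of_pos (by positivity),
      ← ENNReal.ofReal_mul (by positivity), ← ENNReal.ofReal_mul (by positivity),
      ← ENNReal.ofReal_pow hg0.le, ← ENNReal.ofReal_mul (by positivity)]
    congr 1
    rw [Real.mul_rpow (by positivity) (by positivity), ← ha, ← Real.rpow_natCast (x / 2),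
      ← Real.rpow_mul (by positivity), mul_comm (ν : ℝ), Real.rpow_mul (by positivity),
      Real.rpow_natCast, hg, div_pow]
    field_simp
  have h3 : wm w B * (I / wm w B) = I := ENNReal.mul_div_cancel hm0 hmt
  calc C * (wm w B * (ENNReal.ofReal ((1 - x) / 2 * (x / 2) ^ ν) ^ (-σ) *
        (I / wm w B / ENNReal.ofReal (2 ^ ν * τ / (32 * R)))))
      = C * ((wm w B * (I / wm w B)) * (ENNReal.ofReal ((1 - x) / 2 * (x / 2) ^ ν) ^ (-σ) *
        (ENNReal.ofReal (2 ^ ν * τ / (32 * R)))⁻¹)) := by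
        rw [div_eq_mul_inv (I / wm w B)]; ring
    _ = _ := by rw [h2, h3]; ring

theorem smooth_bound_one_of_lt_neg_one (hn : 0 < n) {k ℓ : ℕ} (hℓ : 0 < ℓ) (hkl : ℓ ≤ k) {q b : ℝ}
    (hq : 0 < q) (hpq : (n : ℝ) * (1 / 1 - 1 / q) < ℓ) (hb : b < -1) {A : ℝ≥0∞}
    (hA : A ≠ ⊤) : ∃ K : ℝ≥0∞, K ≠ ⊤ ∧ ∀ w : En n → ℝ≥0∞, A1W A w → ∀ f : En n → ℝ,
      ContDiff ℝ (⊤ : ℕ∞) f → ∀ lam : ℝ, 0 < lam →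
      ENNReal.ofReal lam ^ (1 : ℝ) *
          ∫⁻ x, innerInt k ℓ lam b (b * q) f x ^ (1 / q) ∂(wm w) ≤
        K * ∫⁻ x, ngrad ℓ f x ^ (1 : ℝ) ∂(wm w) := by
  obtain ⟨q', t, hpq', hqq', hqt, hnt⟩ := exists_exponent_pair one_pos
    (by exact_mod_cast hℓ : (0 : ℝ) < ℓ) hpq
  obtain ⟨L, rfl⟩ : ∃ d, ℓ = d + 1 := ⟨ℓ - 1, by omega⟩
  have hq'0 : 0 < q' := hq.trans hqq'
  have hn' : (0 : ℝ) < n := by exact_mod_cast hn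
  have hnq : (n : ℝ) * (1 / 1 - 1 / q') < L + 1 := by
    refine lt_of_le_of_lt ?_ (by exact_mod_cast hnt)
    have := one_div_le_one_div_of_le hq'0 hqt.le
    gcongr
  obtain ⟨K1, hK1, c', hc', h1⟩ := exists_innerInt_le_badSet hn (k := k) (ℓ := L + 1) (L := L)
    (by omega) (one_lt_two (α := ℝ)) one_pos hq hqq' hpq'.le (b := b) (by linarith)
  obtain ⟨C, hC, g, hg, h2⟩ := exists_PhiS_badSet_le_levels hn L hpq' hnq hA
  set R₀ : ℝ := n + k * 2 + 1 with hR₀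
  have hR₀' : 0 < R₀ := by positivity
  set ρ : ℝ := 2 ^ (1 + b) with hρ
  have hρ0 : 0 < ρ := by positivity
  have hρ1 : ρ < 1 := Real.rpow_lt_one_of_one_lt_of_neg one_lt_two (by linarith)
  obtain ⟨P, hP⟩ := exists_volume_window_ge n R₀ hρ0 hρ1
  obtain ⟨N, hN, h3⟩ := exists_tsum_lintegral_window_le n R₀ P
  set N₀ := Fintype.card (Fin L → Fin n) with hN₀
  have hN₀' : (0 : ℝ) < N₀ := by
    have : Nonempty (Fin L → Fin n) := ⟨fun _ => ⟨0, hn⟩⟩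
    exact_mod_cast Fintype.card_pos
  have hgt : (1 - g)⁻¹ ≠ ⊤ := by
    rw [ENNReal.inv_ne_top]
    exact (tsub_pos_of_lt hg).ne'
  refine ⟨K1 * C * ENNReal.ofReal (R₀ * (2 * N₀) / c') * (N₀ * (1 - g)⁻¹ * N), by finiteness,
    fun w hw f hf lam hlam => ?_⟩
  have hRi : ∀ i : ℤ, 0 < R₀ * (2 : ℝ) ^ i := fun i => by positivity
  choose M hM using fun (i : ℤ) (m : Fin n → ℤ) (ι : Fin L → Fin n) =>
    exists_median (continuous_Dt hf ι) (ctr 2 i m) (hRi i)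
  have h5 := h1 w f hf M (Or.inl (by omega)) lam hlam
  have hexp : (2 : ℝ) ^ (((L + 1 : ℕ) : ℝ) + b - (L : ℝ)) = ρ := by
    rw [hρ]; congr 1; push_cast; ring
  simp only [hexp] at h5
  have hNG := measurable_ngrad (L + 1) hf
  set Γ := ngrad (L + 1) f with hΓ
  set T₀ : ℝ := c' * lam / (2 * N₀) with hT₀
  have hT₀' : 0 < T₀ := by positivity
  set W : (Fin L → Fin n) → ℕ → ℤ → (Fin n → ℤ) → Set ℝ := fun ι ν =>
    window R₀ (2 ^ ν * T₀) ρ P (fun i m => M i m ι) with hW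
  have hWm : ∀ ι ν i m, MeasurableSet (W ι ν i m) := fun ι ν i m => measurableSet_window _ _ _ _ _ _ _
  set G : ℤ → (Fin n → ℤ) → (Fin L → Fin n) → ℕ → En n → ℝ≥0∞ := fun i m ι ν y =>
    (W ι ν i m).indicator 1 (Dt f ι y) * Γ y with hG
  have hGm : ∀ i m ι ν, Measurable (G i m ι ν) := fun i m ι ν =>
    ((measurable_one.indicator (hWm ι ν i m)).comp (continuous_Dt hf ι).measurable).mul hNG
  have h6 : ∀ i m, PhiS w (1 / q') (Metric.ball (ctr 2 i m) (R₀ * 2 ^ i))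
      (badSet L f (M i m) (ctr 2 i m) (R₀ * 2 ^ i) (c' * lam * ρ ^ i)) ≤
      C * (ENNReal.ofReal (R₀ * 2 ^ i / (T₀ * ρ ^ i)) * ∑' ι, ∑' ν : ℕ,
        g ^ ν * ∫⁻ x in Metric.ball (ctr 2 i m) (R₀ * 2 ^ i), G i m ι ν x ∂(wm w)) := by
    intro i m
    rw [show c' * lam * ρ ^ i = 2 * N₀ * (T₀ * ρ ^ i) by rw [hT₀]; field_simp]
    refine h2 w hw f (M i m) (ctr 2 i m) _ _ (hRi i) (by positivity) (G i m) (hGm i m)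
      fun ι ν z hz hlt => ?_
    have ht0 : 0 < 2 ^ ν * T₀ * ρ ^ i := by positivity
    have hw' := hP (fun i m => M i m ι) (2 ^ ν * T₀) (by positivity) i m
    have h7 := le_Jop_indicator hf ι (ctr 2 i m) (hRi i) (M := M i m ι) (t := 2 ^ ν * T₀ * ρ ^ i)
      (hM i m ι _ (by positivity)) (hWm ι ν i m) hw'.1 hw'.2 hz (by rwa [mul_assoc])
    refine lt_of_lt_of_le ?_ h7
    have := hRi i
    rw [← mul_assoc, ENNReal.ofReal_lt_ofReal_iff (by positivity)]
    gcongr ?_ / ?_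
    linarith
  have h8 : ∀ i : ℤ, ENNReal.ofReal lam * (ENNReal.ofReal ((2 ^ b) ^ i) *
      ENNReal.ofReal (R₀ * 2 ^ i / (T₀ * ρ ^ i))) = ENNReal.ofReal (R₀ * (2 * N₀) / c') := by
    intro i
    have hb2 : ρ ^ i = 2 ^ i * ((2 : ℝ) ^ b) ^ i := by
      rw [hρ, Real.rpow_add two_pos, Real.rpow_one, mul_zpow]
    rw [← ENNReal.ofReal_mul (by positivity), ← ENNReal.ofReal_mul hlam.le, hb2, hT₀]
    congr 1
    field_simp
  rw [ENNReal.rpow_one]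
  calc ENNReal.ofReal lam * ∫⁻ x, innerInt k (L + 1) lam b (b * q) f x ^ (1 / q) ∂(wm w)
      ≤ ENNReal.ofReal lam * (K1 * ∑' i : ℤ, ENNReal.ofReal ((2 ^ b) ^ i) ^ (1 : ℝ) *
          ∑' m, PhiS w (1 / q') (Metric.ball (ctr 2 i m) (R₀ * 2 ^ i))
            (badSet L f (M i m) (ctr 2 i m) (R₀ * 2 ^ i) (c' * lam * ρ ^ i))) :=
        mul_le_mul' le_rfl h5
    _ ≤ ENNReal.ofReal lam * (K1 * ∑' i : ℤ, ENNReal.ofReal ((2 ^ b) ^ i) ^ (1 : ℝ) *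
          ∑' m, (C * (ENNReal.ofReal (R₀ * 2 ^ i / (T₀ * ρ ^ i)) * ∑' ι, ∑' ν : ℕ,
        g ^ ν * ∫⁻ x in Metric.ball (ctr 2 i m) (R₀ * 2 ^ i), G i m ι ν x ∂(wm w)))) := by
        gcongr with i m
        exact h6 i m
    _ = K1 * C * ENNReal.ofReal (R₀ * (2 * N₀) / c') * ∑' i : ℤ, ∑' m, ∑' ι, ∑' ν : ℕ,
        g ^ ν * ∫⁻ x in Metric.ball (ctr 2 i m) (R₀ * 2 ^ i), G i m ι ν x ∂(wm w) := by
        simp only [ENNReal.tsum_mul_left (α := Fin n → ℤ)]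
        simp only [← ENNReal.tsum_mul_left (α := ℤ)]
        refine tsum_congr fun i => ?_
        rw [ENNReal.rpow_one, ← h8 i]
        ring
    _ = K1 * C * ENNReal.ofReal (R₀ * (2 * N₀) / c') * ∑' ι, ∑' ν : ℕ, g ^ ν * ∑' i : ℤ, ∑' m,
        ∫⁻ x in Metric.ball (ctr 2 i m) (R₀ * 2 ^ i), G i m ι ν x ∂(wm w) := by
        congr 1
        simp only [← ENNReal.tsum_mul_left]
        rw [(tsum_congr fun i => ENNReal.tsum_comm).trans ENNReal.tsum_comm]
        refine tsum_congr fun ι => ?_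
        exact (tsum_congr fun i => ENNReal.tsum_comm).trans ENNReal.tsum_comm
    _ ≤ K1 * C * ENNReal.ofReal (R₀ * (2 * N₀) / c') * ∑' _ : Fin L → Fin n, ∑' ν : ℕ, g ^ ν *
        (N * ∫⁻ x, Γ x ∂(wm w)) := by
        gcongr with ι ν
        exact h3 (fun i m => M i m ι) _ ρ (wm w) (Dt f ι) Γ (continuous_Dt hf ι).measurable hNG
    _ = _ := by
        rw [ENNReal.tsum_mul_right, ENNReal.tsum_geometric, tsum_fintype, Finset.sum_const,
          nsmul_eq_mul, Finset.card_univ]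
        simp only [ENNReal.rpow_one]
        ring

/-- The iterated partial derivative along a list of coordinate directions. -/
noncomputable def listPd (l : List (Fin n)) (ψ : En n → ℝ) : En n → ℝ := l.foldr pd ψ

theorem contDiff_pd {ψ : En n → ℝ} (hψ : ContDiff ℝ (⊤ : ℕ∞) ψ) (i : Fin n) :
    ContDiff ℝ (⊤ : ℕ∞) (pd i ψ) :=
  (hψ.fderiv_right (m := (⊤ : ℕ∞)) (by simp)).clm_apply contDiff_const

theorem contDiff_listPd {ψ : En n → ℝ} (hψ : ContDiff ℝ (⊤ : ℕ∞) ψ) (l : List (Fin n)) :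
    ContDiff ℝ (⊤ : ℕ∞) (listPd l ψ) := by
  induction l with
  | nil => exact hψ
  | cons i l ih => exact contDiff_pd ih i

theorem hasCompactSupport_listPd {ψ : En n → ℝ} (hψ : HasCompactSupport ψ) (l : List (Fin n)) :
    HasCompactSupport (listPd l ψ) := by
  induction l with
  | nil => exact hψ
  | cons i l ih => exact ih.fderiv_apply ℝ _

theorem pd_comm {ψ : En n → ℝ} (hψ : ContDiff ℝ (⊤ : ℕ∞) ψ) (i j : Fin n) :
    pd i (pd j ψ) = pd j (pd i ψ) := by
  have key : ∀ i j : Fin n, ∀ x, pd i (pd j ψ) x = fderiv ℝ (fderiv ℝ ψ) x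
      (EuclideanSpace.single i 1) (EuclideanSpace.single j 1) := by
    intro i j x
    have hd : DifferentiableAt ℝ (fderiv ℝ ψ) x :=
      ((hψ.fderiv_right (m := (⊤ : ℕ∞)) (by simp)).differentiable (by simp)).differentiableAt
    have h : HasFDerivAt (pd j ψ) _ x :=
      hd.hasFDerivAt.clm_apply (hasFDerivAt_const (EuclideanSpace.single j (1 : ℝ)) x)
    rw [pd, h.fderiv]
    simp
  funext x
  rw [key, key]
  exact ((contDiff_infty.1 hψ 2).contDiffAt.isSymmSndFDerivAt
    (by rw [minSmoothness_of_isRCLikeNormedField]; norm_num)) _ _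

theorem listPd_perm {l₁ l₂ : List (Fin n)} (h : l₁.Perm l₂) {ψ : En n → ℝ}
    (hψ : ContDiff ℝ (⊤ : ℕ∞) ψ) : listPd l₁ ψ = listPd l₂ ψ := by
  induction h with
  | nil => rfl
  | cons i _ ih => exact congrArg (pd i) ih
  | swap i j l => exact pd_comm (contDiff_listPd hψ l) j i
  | trans _ _ h₁ h₂ => exact h₁.trans h₂

theorem mpd_eq_listPd (α : Fin n → ℕ) (ψ : En n → ℝ) :
    mpd α ψ = listPd ((List.finRange n).flatMap fun i => List.replicate (α i) i) ψ := by
  have h : ∀ (i : Fin n) (m : ℕ) (χ : En n → ℝ),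
      (List.replicate m i).foldr pd χ = (pd i)^[m] χ := by
    intro i m χ
    induction m with
    | zero => rfl
    | succ m ih => rw [List.replicate_succ, List.foldr_cons, ih, Function.iterate_succ_apply']
  simp only [mpd, listPd, List.foldr_flatMap, h]

/-- The multi-index counting the coordinate directions of a tuple. -/
def tupleCount {ℓ : ℕ} (ι : Fin ℓ → Fin n) (i : Fin n) : ℕ := (List.ofFn ι).count i

theorem sum_tupleCount {ℓ : ℕ} (ι : Fin ℓ → Fin n) : ∑ i, tupleCount ι i = ℓ := by
  have h := Multiset.sum_count_eq_card (s := Finset.univ) (m := (List.ofFn ι : Multiset (Fin n)))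
    (by simp)
  simpa [tupleCount] using h

theorem mpd_tupleCount {ℓ : ℕ} (ι : Fin ℓ → Fin n) {ψ : En n → ℝ}
    (hψ : ContDiff ℝ (⊤ : ℕ∞) ψ) : mpd (tupleCount ι) ψ = listPd (List.ofFn ι) ψ := by
  rw [mpd_eq_listPd]
  refine listPd_perm (List.perm_iff_count.2 fun a => ?_) hψ
  rw [List.count_flatMap]
  simp only [Function.comp_def, List.count_replicate, beq_iff_eq]
  rw [← List.ofFn_eq_map, List.sum_ofFn, Finset.sum_ite_eq' Finset.univ a]
  simp [tupleCount]

theorem Dt_eq_listPd {ℓ : ℕ} {f : En n → ℝ} (hf : ContDiff ℝ (⊤ : ℕ∞) f) (ι : Fin ℓ → Fin n) :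
    Dt f ι = listPd (List.ofFn ι) f := by
  induction ℓ with
  | zero => funext x; simp [Dt, listPd]
  | succ m ih =>
    rw [List.ofFn_succ]
    change _ = pd (ι 0) (listPd (List.ofFn fun i => ι i.succ) f)
    rw [← ih]
    funext x
    rw [Dt, iteratedFDeriv_succ_apply_left]
    have hd : HasFDerivAt (iteratedFDeriv ℝ m f) (fderiv ℝ (iteratedFDeriv ℝ m f) x) x :=
      (hf.differentiable_iteratedFDeriv (m := m)
        (by exact_mod_cast ENat.natCast_lt_top m) _).hasFDerivAt
    have h := ((ContinuousMultilinearMap.apply ℝ (fun _ : Fin m => En n) ℝ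
      (fun i => EuclideanSpace.single (ι i.succ) (1 : ℝ))).hasFDerivAt).comp x hd
    have h2 : HasFDerivAt (Dt f fun i => ι i.succ) _ x := h
    rw [pd, h2.fderiv]
    rfl

theorem listPd_comp_sub {ψ : En n → ℝ} (hψ : ContDiff ℝ (⊤ : ℕ∞) ψ) (x : En n)
    (l : List (Fin n)) :
    listPd l (fun y => ψ (x - y)) = fun y => (-1) ^ l.length * listPd l ψ (x - y) := by
  induction l with
  | nil => simp [listPd]
  | cons i l ih =>
    change pd i (listPd l _) = _
    rw [ih]
    funext y
    have hd : HasFDerivAt (listPd l ψ) (fderiv ℝ (listPd l ψ) (x - y)) (x - y) :=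
      ((contDiff_listPd hψ l).differentiable (by simp) _).hasFDerivAt
    have h := (hd.comp y ((hasFDerivAt_id y).const_sub x)).const_mul ((-1 : ℝ) ^ l.length)
    have h2 : HasFDerivAt (fun y => (-1 : ℝ) ^ l.length * listPd l ψ (x - y)) _ y := h
    rw [pd, h2.fderiv]
    simp [listPd, pd, pow_succ]

open scoped Convolution in
/-- Convolution of two real functions. -/
noncomputable def conv (ψ f : En n → ℝ) : En n → ℝ :=
  ψ ⋆[ContinuousLinearMap.lsmul ℝ ℝ, volume] f

theorem conv_apply (ψ f : En n → ℝ) (x : En n) : conv ψ f x = ∫ y, ψ (x - y) * f y := by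
  rw [conv, convolution_lsmul_swap]; rfl

theorem contDiff_conv {ψ f : En n → ℝ} (hψ : ContDiff ℝ (⊤ : ℕ∞) ψ) (hc : HasCompactSupport ψ)
    (hf : LocallyIntegrable f volume) : ContDiff ℝ (⊤ : ℕ∞) (conv ψ f) :=
  hc.contDiff_convolution_left _ hψ hf

theorem pd_conv {ψ f : En n → ℝ} (hψ : ContDiff ℝ (⊤ : ℕ∞) ψ) (hc : HasCompactSupport ψ)
    (hf : LocallyIntegrable f volume) (i : Fin n) : pd i (conv ψ f) = conv (pd i ψ) f := by
  funext x
  have h := hc.hasFDerivAt_convolution_left (ContinuousLinearMap.lsmul ℝ ℝ)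
    (hψ.of_le (by simp)) hf x
  have h2 : HasFDerivAt (conv ψ f) _ x := h
  have hi := ((hc.fderiv ℝ).convolutionExists_left
    ((ContinuousLinearMap.lsmul ℝ ℝ).precompL (En n)) (hψ.continuous_fderiv (by simp)) hf x)
  rw [pd, h2.fderiv, convolution_def, ContinuousLinearMap.integral_apply hi, conv,
    convolution_def]
  rfl

theorem listPd_conv {ψ f : En n → ℝ} (hψ : ContDiff ℝ (⊤ : ℕ∞) ψ) (hc : HasCompactSupport ψ)
    (hf : LocallyIntegrable f volume) (l : List (Fin n)) :
    listPd l (conv ψ f) = conv (listPd l ψ) f := by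
  induction l with
  | nil => rfl
  | cons i l ih =>
    change pd i (listPd l _) = _
    rw [ih, pd_conv (contDiff_listPd hψ l) (hasCompactSupport_listPd hc l) hf]
    rfl

/-- Derivatives of a mollification are mollifications of the weak derivatives. -/
theorem Dt_conv {ℓ : ℕ} {ψ f : En n → ℝ} {g : (Fin n → ℕ) → En n → ℝ}
    (hψ : ContDiff ℝ (⊤ : ℕ∞) ψ) (hc : HasCompactSupport ψ) (hf : LocallyIntegrable f volume)
    (hg : HasWeakDerivs ℓ f g) (ι : Fin ℓ → Fin n) :
    Dt (conv ψ f) ι = conv ψ (g (tupleCount ι)) := by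
  funext x
  rw [Dt_eq_listPd (contDiff_conv hψ hc hf), listPd_conv hψ hc hf, conv_apply, conv_apply]
  have hψx : ContDiff ℝ (⊤ : ℕ∞) fun y => ψ (x - y) := hψ.comp (contDiff_const.sub contDiff_id)
  have h := hg.2 (tupleCount ι) (sum_tupleCount ι) (fun y => ψ (x - y)) hψx
    (hc.comp_homeomorph (Homeomorph.subLeft x))
  rw [mpd_tupleCount ι hψx, listPd_comp_sub hψ] at h
  simp only [List.length_ofFn] at h
  have h3 : ∫ y, f y * ((-1) ^ ℓ * listPd (List.ofFn ι) ψ (x - y))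
      = (-1) ^ ℓ * ∫ y, listPd (List.ofFn ι) ψ (x - y) * f y := by
    rw [← integral_const_mul]
    congr 1; funext y; ring
  rw [h3] at h
  have h4 := mul_left_cancel₀ (pow_ne_zero ℓ (by norm_num : (-1 : ℝ) ≠ 0)) h
  rw [h4]
  congr 1; funext y; ring

theorem gradLen_eq_sum (m : ℕ) (g : (Fin n → ℕ) → En n → ℝ) (x : En n) :
    gradLen m g x = Real.sqrt (∑ α ∈ Finset.piAntidiag Finset.univ m, (g α x) ^ 2) := by
  rw [gradLen, tsum_eq_sum (s := Finset.piAntidiag Finset.univ m)]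
  · congr 1
    refine Finset.sum_congr rfl fun α hα => ?_
    rw [if_pos (by simpa using hα)]
  · intro α hα
    rw [if_neg (by simpa using hα)]

theorem abs_le_gradLen {m : ℕ} (g : (Fin n → ℕ) → En n → ℝ) {α : Fin n → ℕ}
    (hα : ∑ i, α i = m) (x : En n) : |g α x| ≤ gradLen m g x := by
  rw [gradLen_eq_sum]
  refine Real.abs_le_sqrt ?_
  exact Finset.single_le_sum (f := fun α => (g α x) ^ 2) (fun _ _ => sq_nonneg _)
    (by simpa using hα)

theorem HasWeakDerivs.aemeasurable_gradLen {m : ℕ} {f : En n → ℝ} {g : (Fin n → ℕ) → En n → ℝ}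
    (hg : HasWeakDerivs m f g) : AEMeasurable (gradLen m g) volume := by
  have h : gradLen m g =
      fun x => Real.sqrt (∑ α ∈ Finset.piAntidiag Finset.univ m, (g α x) ^ 2) :=
    funext (gradLen_eq_sum m g)
  rw [h]
  refine Real.continuous_sqrt.measurable.comp_aemeasurable ?_
  refine Finset.aemeasurable_fun_sum _ fun α hα => ?_
  exact (hg.1 α (by simpa using hα)).aestronglyMeasurable.aemeasurable.pow_const 2

theorem ngrad_conv_le {ℓ : ℕ} {ψ f : En n → ℝ} {g : (Fin n → ℕ) → En n → ℝ}
    (hψ : ContDiff ℝ (⊤ : ℕ∞) ψ) (hc : HasCompactSupport ψ) (h0 : ∀ y, 0 ≤ ψ y)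
    (hf : LocallyIntegrable f volume) (hg : HasWeakDerivs ℓ f g) (x : En n) :
    ngrad ℓ (conv ψ f) x ≤
      (n : ℝ≥0∞) ^ ℓ * ∫⁻ y, ENNReal.ofReal (ψ (x - y)) * ENNReal.ofReal (gradLen ℓ g y) := by
  have h : ∀ ι : Fin ℓ → Fin n, ENNReal.ofReal |Dt (conv ψ f) ι x - 0| ≤
      ∫⁻ y, ENNReal.ofReal (ψ (x - y)) * ENNReal.ofReal (gradLen ℓ g y) := by
    intro ι
    rw [Dt_conv hψ hc hf hg, sub_zero, conv_apply, ← Real.norm_eq_abs, ofReal_norm]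
    refine (enorm_integral_le_lintegral_enorm _).trans (lintegral_mono fun y => ?_)
    rw [enorm_mul, Real.enorm_of_nonneg (h0 _), ← ofReal_norm (g _ y), Real.norm_eq_abs]
    gcongr
    exact abs_le_gradLen g (sum_tupleCount ι) y
  refine (Finset.sum_le_sum fun ι _ => h ι).trans (le_of_eq ?_)
  simp

theorem lintegral_mul_normed_le {A : ℝ≥0∞} {w : En n → ℝ≥0∞} (hw : A1W A w)
    (φ : ContDiffBump (0 : En n)) (hφ : φ.rOut ≤ 2 * φ.rIn) :
    ∀ᵐ y, ∫⁻ x, w x * ENNReal.ofReal (φ.normed volume (x - y)) ≤ 2 ^ n * A * w y := by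
  filter_upwards [hw.ae_lintegral_sub_smul_le] with y hy
  have h1 := hy 1 φ.rOut one_pos φ.rOut_pos
  simp only [one_smul] at h1
  set V := volume (Metric.ball (0 : En n) φ.rOut) with hV
  have hV0 : V ≠ 0 := volume_ball_ne_zero _ φ.rOut_pos
  have hVt : V ≠ ⊤ := volume_ball_ne_top _ _
  have hb : ∀ v, ENNReal.ofReal (φ.normed volume (-v)) ≤
      (Metric.ball (0 : En n) φ.rOut).indicator (fun _ => 2 ^ n / V) v := by
    intro v
    rw [φ.normed_neg]
    by_cases hv : v ∈ Metric.ball (0 : En n) φ.rOut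
    · rw [indicator_of_mem hv]
      have h := φ.normed_le_div_measure_closedBall_rOut volume 2 hφ v
      rw [finrank_euclideanSpace, Fintype.card_fin] at h
      have h2 : V.toReal ≤ (volume : Measure (En n)).real (Metric.closedBall 0 φ.rOut) :=
        ENNReal.toReal_mono measure_closedBall_lt_top.ne (measure_mono Metric.ball_subset_closedBall)
      have h3 : 0 < V.toReal := ENNReal.toReal_pos hV0 hVt
      replace h := h.trans (div_le_div_of_nonneg_left (by positivity) h3 h2)
      refine (ENNReal.ofReal_le_ofReal h).trans (le_of_eq ?_)
      rw [ENNReal.ofReal_div_of_pos h3, ENNReal.ofReal_toReal hVt,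
        ENNReal.ofReal_pow zero_le_two, ENNReal.ofReal_ofNat]
    · rw [indicator_of_notMem hv]
      rw [← φ.support_normed_eq (μ := volume), Function.notMem_support] at hv
      simp [hv]
  calc ∫⁻ x, w x * ENNReal.ofReal (φ.normed volume (x - y))
      = ∫⁻ v, w (y - v) * ENNReal.ofReal (φ.normed volume (y - v - y)) :=
        (lintegral_sub_left_eq_self
          (fun x => w x * ENNReal.ofReal (φ.normed volume (x - y))) y).symm
    _ ≤ ∫⁻ v, (Metric.ball (0 : En n) φ.rOut).indicator
          (fun v => 2 ^ n / V * w (y - v)) v := by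
        refine lintegral_mono fun v => ?_
        have h := hb v
        rw [show y - v - y = -v by abel]
        by_cases hv : v ∈ Metric.ball (0 : En n) φ.rOut
        · rw [indicator_of_mem hv] at h ⊢
          rw [mul_comm]; gcongr
        · rw [indicator_of_notMem hv] at h ⊢
          rw [nonpos_iff_eq_zero.1 h, mul_zero]
    _ = 2 ^ n / V * ∫⁻ v in Metric.ball 0 φ.rOut, w (y - v) := by
        rw [lintegral_indicator measurableSet_ball,
          lintegral_const_mul _ (f := fun v => w (y - v))
            (hw.meas.comp (measurable_const.sub measurable_id))]
    _ ≤ 2 ^ n / V * (A * V * w y) := by gcongr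
    _ = 2 ^ n * A * w y := by
        rw [show 2 ^ n / V * (A * V * w y) = 2 ^ n / V * V * A * w y by ring,
          ENNReal.div_mul_cancel hV0 hVt]

/-- Mollification is bounded on the weighted homogeneous Sobolev space. -/
theorem lintegral_ngrad_conv_le {A : ℝ≥0∞} {w : En n → ℝ≥0∞} (hw : A1W A w)
    (φ : ContDiffBump (0 : En n)) (hφ : φ.rOut ≤ 2 * φ.rIn) {ℓ : ℕ} {p : ℝ} (hp : 1 ≤ p)
    {f : En n → ℝ} {g : (Fin n → ℕ) → En n → ℝ} (hf : LocallyIntegrable f volume)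
    (hg : HasWeakDerivs ℓ f g) :
    ∫⁻ x, ngrad ℓ (conv (φ.normed volume) f) x ^ p ∂(wm w) ≤
      ((n : ℝ≥0∞) ^ ℓ) ^ p * (2 ^ n * A) *
        ∫⁻ x, ENNReal.ofReal (gradLen ℓ g x) ^ p * w x := by
  have hp0 : 0 ≤ p := by linarith
  set ψ := φ.normed (volume : Measure (En n)) with hψdef
  have hψs : ContDiff ℝ (⊤ : ℕ∞) ψ := φ.contDiff_normed
  have hψm : Measurable ψ := hψs.continuous.measurable
  obtain ⟨H, hHm, hH⟩ : AEMeasurable (fun y => ENNReal.ofReal (gradLen ℓ g y)) volume :=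
    hg.aemeasurable_gradLen.ennreal_ofReal
  have hmass : ∀ x, ∫⁻ y, ENNReal.ofReal (ψ (x - y)) = 1 := by
    intro x
    rw [lintegral_sub_left_eq_self (fun y => ENNReal.ofReal (ψ y)) x,
      ← ofReal_integral_eq_lintegral_ofReal φ.integrable_normed
        (Eventually.of_forall φ.nonneg_normed), φ.integral_normed, ENNReal.ofReal_one]
  have hpt : ∀ x, ngrad ℓ (conv ψ f) x ^ p ≤
      ((n : ℝ≥0∞) ^ ℓ) ^ p * ∫⁻ y, ENNReal.ofReal (ψ (x - y)) * H y ^ p := by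
    intro x
    have hm : Measurable fun y => ENNReal.ofReal (ψ (x - y)) := by fun_prop
    have h1 := ngrad_conv_le hψs φ.hasCompactSupport_normed φ.nonneg_normed hf hg x
    have h2 : ∫⁻ y, ENNReal.ofReal (ψ (x - y)) * ENNReal.ofReal (gradLen ℓ g y) =
        ∫⁻ y, H y ∂(volume.withDensity fun y => ENNReal.ofReal (ψ (x - y))) := by
      rw [lintegral_withDensity_eq_lintegral_mul _ hm hHm]
      refine lintegral_congr_ae ?_
      filter_upwards [hH] with y hy
      rw [hy]; rfl
    have h3 := lintegral_rpow_le_measure_mul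
      (volume.withDensity fun y => ENNReal.ofReal (ψ (x - y))) hHm.aemeasurable hp
    rw [withDensity_apply _ MeasurableSet.univ, setLIntegral_univ, hmass, ENNReal.one_rpow,
      one_mul, lintegral_withDensity_eq_lintegral_mul _ hm (hHm.pow_const p)] at h3
    rw [h2] at h1
    refine (ENNReal.rpow_le_rpow h1 hp0).trans ?_
    rw [ENNReal.mul_rpow_of_nonneg _ _ hp0]
    exact mul_le_mul' le_rfl h3
  have hHp : Measurable fun y => H y ^ p := hHm.pow_const p
  have hj : Measurable fun z : En n × En n => ENNReal.ofReal (ψ (z.1 - z.2)) * H z.2 ^ p := by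
    fun_prop
  have hin : Measurable fun x => ∫⁻ y, ENNReal.ofReal (ψ (x - y)) * H y ^ p :=
    hj.lintegral_prod_right'
  calc ∫⁻ x, ngrad ℓ (conv ψ f) x ^ p ∂(wm w)
      ≤ ∫⁻ x, (((n : ℝ≥0∞) ^ ℓ) ^ p * ∫⁻ y, ENNReal.ofReal (ψ (x - y)) * H y ^ p) ∂(wm w) :=
        lintegral_mono hpt
    _ = ((n : ℝ≥0∞) ^ ℓ) ^ p *
          ∫⁻ x, w x * ∫⁻ y, ENNReal.ofReal (ψ (x - y)) * H y ^ p := by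
        rw [lintegral_const_mul _ hin, ← setLIntegral_univ,
          hw.lintegral_wm hin univ MeasurableSet.univ, setLIntegral_univ]
    _ = ((n : ℝ≥0∞) ^ ℓ) ^ p *
          ∫⁻ x, ∫⁻ y, w x * (ENNReal.ofReal (ψ (x - y)) * H y ^ p) := by
        congr 2; funext x
        rw [lintegral_const_mul _ (by fun_prop)]
    _ = ((n : ℝ≥0∞) ^ ℓ) ^ p *
          ∫⁻ y, ∫⁻ x, w x * (ENNReal.ofReal (ψ (x - y)) * H y ^ p) := by
        rw [lintegral_lintegral_swap]
        have := hw.meas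
        exact ((this.comp measurable_fst).mul hj).aemeasurable
    _ = ((n : ℝ≥0∞) ^ ℓ) ^ p *
          ∫⁻ y, H y ^ p * ∫⁻ x, w x * ENNReal.ofReal (ψ (x - y)) := by
        congr 2; funext y
        have := hw.meas
        rw [← lintegral_const_mul _ (by fun_prop)]
        congr 1; funext x; ring
    _ ≤ ((n : ℝ≥0∞) ^ ℓ) ^ p *
          ∫⁻ y, 2 ^ n * A * (ENNReal.ofReal (gradLen ℓ g y) ^ p * w y) := by
        refine mul_le_mul' le_rfl (lintegral_mono_ae ?_)
        filter_upwards [lintegral_mul_normed_le hw φ hφ, hH] with y hy hy2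
        rw [hy2]
        refine (mul_le_mul' le_rfl hy).trans (le_of_eq (by ring))
    _ = _ := by
        have hm : AEMeasurable (fun y => ENNReal.ofReal (gradLen ℓ g y) ^ p * w y) volume :=
          (hg.aemeasurable_gradLen.ennreal_ofReal.pow_const p).mul hw.meas.aemeasurable
        rw [lintegral_const_mul'' _ hm, mul_assoc _ (2 ^ n * A)]

theorem measurable_innerInt_integrand {F : En n → ℝ} (hF : Continuous F) (k ℓ : ℕ)
    (lam b γ : ℝ) : Measurable fun z : En n × En n =>
      if memE k ℓ lam b F z.1 z.2 then ENNReal.ofReal (‖z.2‖ ^ (γ - (n : ℝ))) else 0 :=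
  Measurable.ite (measurableSet_memE hF k ℓ lam b) (by fun_prop) measurable_const

theorem measurable_innerInt {F : En n → ℝ} (hF : Continuous F) (k ℓ : ℕ) (lam b γ : ℝ) :
    Measurable (innerInt k ℓ lam b γ F) :=
  (measurable_innerInt_integrand hF k ℓ lam b γ).lintegral_prod_right'

/-- Almost everywhere convergence along almost every arithmetic progression. -/
theorem ae_ae_tendsto_add_smul {F : ℕ → En n → ℝ} {f : En n → ℝ}
    (h : ∀ᵐ x, Tendsto (fun N => F N x) atTop (𝓝 (f x))) :
    ∀ᵐ x, ∀ᵐ y, ∀ j : ℕ, Tendsto (fun N => F N (x + (j : ℝ) • y)) atTop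
      (𝓝 (f (x + (j : ℝ) • y))) := by
  filter_upwards [h] with x hx
  rw [ae_all_iff]
  intro j
  rcases Nat.eq_zero_or_pos j with rfl | hj
  · simpa using hx
  · have hj' : (j : ℝ) ≠ 0 := by exact_mod_cast hj.ne'
    rw [ae_iff] at h ⊢
    have h2 := Measure.addHaar_preimage_smul (volume : Measure (En n)) hj'
      ((fun y => x + y) ⁻¹' {z | ¬ Tendsto (fun N => F N z) atTop (𝓝 (f z))})
    rw [measure_preimage_add, h, mul_zero] at h2
    exact h2

/-- The inner integral is lower semicontinuous under almost everywhere convergence. -/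
theorem ae_innerInt_le_liminf {F : ℕ → En n → ℝ} (hF : ∀ N, Continuous (F N)) {f : En n → ℝ}
    (h : ∀ᵐ x, Tendsto (fun N => F N x) atTop (𝓝 (f x))) (k ℓ : ℕ) (lam b γ : ℝ) :
    ∀ᵐ x, innerInt k ℓ lam b γ f x ≤
      liminf (fun N => innerInt k ℓ lam b γ (F N) x) atTop := by
  filter_upwards [ae_ae_tendsto_add_smul h] with x hx
  refine le_trans (lintegral_mono_ae ?_) (lintegral_liminf_le fun N =>
    (measurable_innerInt_integrand (hF N) k ℓ lam b γ).comp measurable_prodMk_left)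
  filter_upwards [hx] with y hy
  by_cases hm : memE k ℓ lam b f x y
  · have hk : Tendsto (fun N => |kDiff k (F N) y x|) atTop (𝓝 |kDiff k f y x|) := by
      refine Tendsto.abs ?_
      unfold kDiff
      exact tendsto_finsetSum _ fun j _ => (hy j).const_mul _
    refine le_liminf_of_le (by isBoundedDefault) ?_
    filter_upwards [hk.eventually_const_lt hm.2] with N hN
    rw [if_pos hm, if_pos ⟨hm.1, hN⟩]
  · rw [if_neg hm]; exact bot_le

theorem lintegral_innerInt_rpow_le_of_tendsto {F : ℕ → En n → ℝ} (hF : ∀ N, Continuous (F N))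
    {f : En n → ℝ} (h : ∀ᵐ x, Tendsto (fun N => F N x) atTop (𝓝 (f x))) {k ℓ : ℕ}
    {lam b γ θ : ℝ} (hθ : 0 ≤ θ) {μ : Measure (En n)} (hμ : μ ≪ volume) {T : ℝ≥0∞}
    (hT : ∀ N, ∫⁻ x, innerInt k ℓ lam b γ (F N) x ^ θ ∂μ ≤ T) :
    ∫⁻ x, innerInt k ℓ lam b γ f x ^ θ ∂μ ≤ T := by
  calc ∫⁻ x, innerInt k ℓ lam b γ f x ^ θ ∂μ
      ≤ ∫⁻ x, liminf (fun N => innerInt k ℓ lam b γ (F N) x ^ θ) atTop ∂μ := by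
        refine lintegral_mono_ae ?_
        filter_upwards [hμ.ae_le (ae_innerInt_le_liminf hF h k ℓ lam b γ)] with x hx
        refine (ENNReal.rpow_le_rpow hx hθ).trans (le_of_eq ?_)
        exact (ENNReal.monotone_rpow_of_nonneg hθ).map_liminf_of_continuousAt _
          ENNReal.continuous_rpow_const.continuousAt
    _ ≤ liminf (fun N => ∫⁻ x, innerInt k ℓ lam b γ (F N) x ^ θ ∂μ) atTop :=
        lintegral_liminf_le fun N => (measurable_innerInt (hF N) k ℓ lam b γ).pow_const θ
    _ ≤ T := liminf_le_of_le (by isBoundedDefault) fun a ha => by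
        obtain ⟨N, hN⟩ := ha.exists
        exact hN.trans (hT N)

/-- A standard sequence of mollifiers. -/
noncomputable def mollifier (n N : ℕ) : ContDiffBump (0 : En n) where
  rIn := 1 / ((N : ℝ) + 1)
  rOut := 2 * (1 / ((N : ℝ) + 1))
  rIn_pos := by positivity
  rIn_lt_rOut := by
    have : 0 < 1 / ((N : ℝ) + 1) := by positivity
    linarith

theorem ae_tendsto_conv_mollifier {f : En n → ℝ} (hf : LocallyIntegrable f volume) :
    ∀ᵐ x, Tendsto (fun N => conv ((mollifier n N).normed volume) f x) atTop (𝓝 (f x)) := by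
  refine ContDiffBump.ae_convolution_tendsto_right_of_locallyIntegrable (K := 2) ?_
    (Eventually.of_forall fun N => le_rfl) hf
  simpa [mollifier] using tendsto_one_div_add_atTop_nhds_zero_nat.const_mul (2 : ℝ)

theorem exists_smooth_bound (hn : 0 < n) {k ℓ : ℕ} (hℓ : 0 < ℓ) (hkl : ℓ ≤ k) {p q γ : ℝ}
    (hp : 1 ≤ p) (hq : 0 < q) (hpq : (n : ℝ) * (1 / p - 1 / q) < ℓ) (hγ : γ ∈ Gam p q)
    {A : ℝ≥0∞} (hA : A ≠ ⊤) :
    ∃ K : ℝ≥0∞, K ≠ ⊤ ∧ ∀ w : En n → ℝ≥0∞, A1W A w → ∀ f : En n → ℝ,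
      ContDiff ℝ (⊤ : ℕ∞) f → ∀ lam : ℝ, 0 < lam →
      ENNReal.ofReal lam ^ p * ∫⁻ x, innerInt k ℓ lam (γ / q) γ f x ^ (p / q) ∂(wm w) ≤
        K * ∫⁻ x, ngrad ℓ f x ^ p ∂(wm w) := by
  have hγq : γ = γ / q * q := by field_simp
  rcases hp.eq_or_lt with rfl | hp1
  · rw [Gam, if_pos rfl] at hγ
    rcases hγ with hγ | hγ
    · have hb : γ / q < -1 := by rw [div_lt_iff₀ hq]; simpa using hγ
      have := smooth_bound_one_of_lt_neg_one hn hℓ hkl hq hpq hb hA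
      rwa [← hγq] at this
    · have := smooth_bound_one_of_pos hn hℓ hkl hq hpq (div_pos hγ hq) hA
      rwa [← hγq] at this
  · rw [Gam, if_neg hp1.ne'] at hγ
    have hb : γ / q ≠ 0 := div_ne_zero hγ hq.ne'
    have := smooth_bound_of_one_lt hn hℓ hkl hp1 hq hpq hb hA
    rwa [← hγq] at this

theorem exists_weak_bound (hn : 0 < n) {k ℓ : ℕ} (hℓ : 0 < ℓ) (hkl : ℓ ≤ k) {p q γ : ℝ}
    (hp : 1 ≤ p) (hq : 0 < q) (hpq : (n : ℝ) * (1 / p - 1 / q) < ℓ) (hγ : γ ∈ Gam p q)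
    {A : ℝ≥0∞} (hA : A ≠ ⊤) :
    ∃ K : ℝ≥0∞, K ≠ ⊤ ∧ ∀ w : En n → ℝ≥0∞, A1W A w →
      ∀ (f : En n → ℝ) (g : (Fin n → ℕ) → En n → ℝ), LocallyIntegrable f volume →
      HasWeakDerivs ℓ f g → ∀ lam : ℝ, 0 < lam →
      ENNReal.ofReal lam ^ p * ∫⁻ x, innerInt k ℓ lam (γ / q) γ f x ^ (p / q) ∂(wm w) ≤
        K * ∫⁻ x, ENNReal.ofReal (gradLen ℓ g x) ^ p * w x := by
  have hp0 : 0 < p := by linarith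
  obtain ⟨K, hK, hsmooth⟩ := exists_smooth_bound hn hℓ hkl hp hq hpq hγ hA
  refine ⟨K * (((n : ℝ≥0∞) ^ ℓ) ^ p * (2 ^ n * A)), by finiteness,
    fun w hw f g hf hg lam hlam => ?_⟩
  have hl0 : ENNReal.ofReal lam ^ p ≠ 0 := by
    simp [ENNReal.rpow_eq_zero_iff, hlam, hp0.not_gt]
  have hlt : ENNReal.ofReal lam ^ p ≠ ⊤ := by finiteness
  rw [mul_comm, ← ENNReal.le_div_iff_mul_le (Or.inl hl0) (Or.inl hlt)]
  have hs : ∀ N, ContDiff ℝ (⊤ : ℕ∞) (conv ((mollifier n N).normed volume) f) := fun N =>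
    contDiff_conv (mollifier n N).contDiff_normed (mollifier n N).hasCompactSupport_normed hf
  refine lintegral_innerInt_rpow_le_of_tendsto (fun N => (hs N).continuous)
    (ae_tendsto_conv_mollifier hf) (by positivity) (withDensity_absolutelyContinuous _ _)
    fun N => ?_
  rw [ENNReal.le_div_iff_mul_le (Or.inl hl0) (Or.inl hlt), mul_comm]
  refine (hsmooth w hw _ (hs N) lam hlam).trans ?_
  rw [mul_assoc]
  exact mul_le_mul' le_rfl (lintegral_ngrad_conv_le hw (mollifier n N) le_rfl hp hf hg)

theorem A1W.mono {A B : ℝ≥0∞} {w : En n → ℝ≥0∞} (hw : A1W A w) (hAB : A ≤ B) : A1W B w where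
  meas := hw.meas
  fin := hw.fin
  pos := hw.pos
  ae := by
    filter_upwards [hw.ae] with z hz c R hzc
    exact (hz c R hzc).trans (by gcongr)

end

open MeasureTheory Set
open scoped ENNReal

/-- weighted upper estimate, Theorem `thm-up-ap`. -/
theorem statement4 (n k ℓ : ℕ) (hn : 0 < n) (hℓ : 0 < ℓ) (hkl : ℓ ≤ k)
    (p q γ : ℝ) (hp : 1 ≤ p) (hq : 0 < q)
    (hpq : (n : ℝ) * (1 / p - 1 / q) < (ℓ : ℝ)) (hγ : γ ∈ Gam p q) :
    ∃ C : ℝ, 0 < C ∧ ∃ ψ : ℝ → ℝ, MonotoneOn ψ (Ici 0) ∧ ContinuousOn ψ (Ici 0) ∧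
      ∀ υ : En n → ℝ, IsAp 1 υ →
        ∀ (f : En n → ℝ) (g : (Fin n → ℕ) → En n → ℝ),
          LocallyIntegrable f volume → HasWeakDerivs ℓ f g →
          (∫⁻ x, ENNReal.ofReal (gradLen ℓ g x ^ p * υ x)) < ⊤ →
          (⨆ lam ∈ Ioi (0 : ℝ), ENNReal.ofReal lam ^ p *
              ∫⁻ x, (innerInt k ℓ lam (γ / q) γ f x) ^ (p / q) * ENNReal.ofReal (υ x))
            ≤ ENNReal.ofReal (C * ψ ((ApConst 1 υ).toReal)) *
                ∫⁻ x, ENNReal.ofReal (gradLen ℓ g x ^ p * υ x) := by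
  obtain ⟨κ, hκ, hweight⟩ := exists_A1W_of_ApConst hn
  have hA : ∀ N : ℕ, κ * (N : ℝ≥0∞) ≠ ⊤ := fun N => by finiteness
  choose K hK hbound using fun N : ℕ => exists_weak_bound hn hℓ hkl hp hq hpq hγ (hA N)
  obtain ⟨ψ, hψm, hψc, hψ⟩ := exists_continuous_monotone_ge K hK
  refine ⟨1, one_pos, ψ, hψm, hψc, fun υ hυ f g hf hg _ => iSup₂_le fun lam hlam => ?_⟩
  obtain ⟨w, hwυ, hw⟩ := hweight υ hυ
  have hright : ∫⁻ x, ENNReal.ofReal (gradLen ℓ g x ^ p * υ x) =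
      ∫⁻ x, ENNReal.ofReal (gradLen ℓ g x) ^ p * w x := by
    refine lintegral_congr_ae ?_
    filter_upwards [hwυ] with x hx
    have h0 : 0 ≤ gradLen ℓ g x := Real.sqrt_nonneg _
    rw [hx, ENNReal.ofReal_mul (by positivity), ENNReal.ofReal_rpow_of_nonneg h0 (by linarith)]
  have hleft : ∫⁻ x, (innerInt k ℓ lam (γ / q) γ f x) ^ (p / q) * ENNReal.ofReal (υ x) =
      ∫⁻ x, w x * innerInt k ℓ lam (γ / q) γ f x ^ (p / q) := by
    refine lintegral_congr_ae ?_
    filter_upwards [hwυ] with x hx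
    rw [hx, mul_comm]
  rw [hright, hleft, one_mul]
  rcases hw with hw | hw
  · have h0 : ∫⁻ x, w x * innerInt k ℓ lam (γ / q) γ f x ^ (p / q) = 0 := by
      refine (lintegral_congr_ae (g := fun _ => 0) ?_).trans lintegral_zero
      filter_upwards [hw] with x hx
      rw [hx, Pi.zero_apply, zero_mul]
    rw [h0, mul_zero]
    exact bot_le
  · have hceil : ApConst 1 υ ≤ (⌈(ApConst 1 υ).toReal⌉₊ : ℝ≥0∞) := by
      rw [← ENNReal.ofReal_toReal hυ.2.2.ne, ← ENNReal.ofReal_natCast,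
        ENNReal.toReal_ofReal ENNReal.toReal_nonneg]
      exact ENNReal.ofReal_le_ofReal (Nat.le_ceil _)
    have hw' := hw.mono (mul_le_mul' le_rfl hceil)
    have hfin : ∀ᵐ x, w x < ⊤ := by
      filter_upwards [hwυ] with x hx
      rw [hx]; exact ENNReal.ofReal_lt_top
    have h := hbound _ w hw' f g hf hg lam hlam
    rw [lintegral_withDensity_eq_lintegral_mul_non_measurable _ hw'.meas hfin] at h
    exact h.trans (mul_le_mul' (hψ _ ENNReal.toReal_nonneg) le_rfl)
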